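/- Suppose (A1)-(A3) and (A4') hold. Then for every q ∈ S_+^d: (i) the function h_q(x) = exp(a(q)·x) Π_{i∈Λ(q)} x^i − E_x(exp(a(q)·S(τ)) Π_{i∈Λ(q)} S^i(τ); τ < ∞) is strictly positive and harmonic for (Z(t)); (ii) every sequence x_n ∈ ℤ_+^d with |x_n| → ∞ and x_n/|x_n| → q is fundamental for the Markov chain (Z(t)), and for every x ∈ ℤ_+^d, lim_n G(x,x_n)/G(x_0,x_n) = h_q(x)/h_q(x_0). -/

import Mathlib

open Filter Topology

attribute [local instance] Classical.propDecidable

noncomputable section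

variable {V : Type*} [AddCommGroup V]

/-- `n`-step transition kernel of the random walk with step distribution `μ`,
killed upon leaving the set `A` : `kern μ A n x y = P_x(S n = y, τ_A > n)`,
where `τ_A` is the first exit time from `A`. -/
def kern (μ : V → ℝ) (A : Set V) : ℕ → V → V → ℝ
  | 0 => fun x y => if x = y ∧ x ∈ A then 1 else 0
  | n + 1 => fun x y => ∑' z : V, (if x ∈ A then μ (z - x) else 0) * kern μ A n z y

/-- Green function of the walk killed outside `A`. -/
def green (μ : V → ℝ) (A : Set V) (x y : V) : ℝ :=
  ∑' n : ℕ, kern μ A n x y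

/-- `E_x [ g(S τ) ; S τ ∈ B, τ < ∞ ]`, where `τ` is the first exit time from `A`. -/
def exitExp (μ : V → ℝ) (A B : Set V) (g : V → ℝ) (x : V) : ℝ :=
  ∑' n : ℕ, ∑' z : V, kern μ A n x z *
    ∑' y : V, (if y ∉ A ∧ y ∈ B then μ (y - z) else 0) * g y

/-- `ℝ≥0∞`-valued version of `exitExp`. -/
def exitExpE (μ : V → ℝ) (A B : Set V) (g : V → ℝ) (x : V) : ENNReal :=
  ∑' n : ℕ, ∑' z : V, ENNReal.ofReal (kern μ A n x z) *
    ∑' y : V, ENNReal.ofReal ((if y ∉ A ∧ y ∈ B then μ (y - z) else 0) * g y)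

/-- `P_x(S t = y for some t ≥ 0)` for the walk killed outside `A`
(first passage decomposition). -/
def hitProb (μ : V → ℝ) (A : Set V) (x y : V) : ℝ :=
  (if x = y ∧ x ∈ A then 1 else 0) +
    ∑' n : ℕ, ∑' z : V, kern μ (A \ {y}) n x z * (if y ∈ A then μ (y - z) else 0)

/-- `h` is (strictly speaking, satisfies the mean value property of a) harmonic
function on `A` for the walk with step distribution `μ` killed outside `A`. -/
def HarmOn (μ : V → ℝ) (A : Set V) (h : V → ℝ) : Prop :=
  ∀ x ∈ A, h x = ∑' y : V, if y ∈ A then μ (y - x) * h y else 0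

/-- Irreducibility of the walk killed outside `A`. -/
def Irred (μ : V → ℝ) (A : Set V) : Prop :=
  ∀ x ∈ A, ∀ x' ∈ A, ∃ (k : ℕ) (c : ℕ → V), c 0 = x ∧ c k = x' ∧
    (∀ j ≤ k, c j ∈ A) ∧ ∀ j < k, 0 < μ (c (j + 1) - c j)

/-- A sequence `xs` is fundamental for the walk killed outside `A` :
the Martin kernels `G(x, xs n)/G(x₀, xs n)` converge for every `x ∈ A`. -/
def Fundamental (μ : V → ℝ) (A : Set V) (x₀ : V) (xs : ℕ → V) : Prop :=
  ∀ x ∈ A, ∃ L : ℝ,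
    Tendsto (fun n => green μ A x (xs n) / green μ A x₀ (xs n)) atTop (𝓝 L)

/-- ℓ¹-norm of an integer vector. -/
def znorm {ι : Type*} [Fintype ι] (x : ι → ℤ) : ℝ := ∑ i, |(x i : ℝ)|

/-- ℓ¹-norm of a real vector. -/
def rnorm {ι : Type*} [Fintype ι] (q : ι → ℝ) : ℝ := ∑ i, |q i|

variable {d : ℕ}

/-- `ℤ^{Λ,d}_+ = {x ∈ ℤ^d : xⁱ > 0 for all i ∈ Λ}`. -/
def posDom (Λ : Set (Fin d)) : Set (Fin d → ℤ) := {x | ∀ i ∈ Λ, 0 < x i}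

/-- `ℤ^d_+ = {x ∈ ℤ^d : xⁱ > 0 for all i}`. -/
def posAll : Set (Fin d → ℤ) := {x | ∀ i, 0 < x i}

/-- `a · z` for `a ∈ ℝ^d`, `z ∈ ℤ^d`. -/
def dotZ (a : Fin d → ℝ) (z : Fin d → ℤ) : ℝ := ∑ i, a i * (z i : ℝ)

/-- `a · q` for `a, q ∈ ℝ^d`. -/
def dotR (a q : Fin d → ℝ) : ℝ := ∑ i, a i * q i

/-- jump generating function `φ(a) = Σ_z μ(z) exp(a·z)` (valued in `ℝ≥0∞`). -/
def phiE (μ : (Fin d → ℤ) → ℝ) (a : Fin d → ℝ) : ENNReal :=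
  ∑' z : Fin d → ℤ, ENNReal.ofReal (μ z * Real.exp (dotZ a z))

/-- `D = {a ∈ ℝ^d : φ(a) ≤ 1}`. -/
def Dset (μ : (Fin d → ℤ) → ℝ) : Set (Fin d → ℝ) := {a | phiE μ a ≤ 1}

/-- mean vector `M = Σ_z μ(z) z`. -/
def Mvec (μ : (Fin d → ℤ) → ℝ) : Fin d → ℝ := fun i => ∑' z : Fin d → ℤ, μ z * (z i : ℝ)

/-- `Λ(M) = {i : Mⁱ = 0}`. -/
def LambdaM (μ : (Fin d → ℤ) → ℝ) : Set (Fin d) := {i | Mvec μ i = 0}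

/-- Assumption (A1) : irreducibility on every `ℤ^{Λ,d}_+`. -/
def A1 (μ : (Fin d → ℤ) → ℝ) : Prop := ∀ Λ : Set (Fin d), Irred μ (posDom Λ)

/-- Assumption (A2) : `φ` is finite on a neighborhood of the set `D`. -/
def A2 (μ : (Fin d → ℤ) → ℝ) : Prop :=
  ∃ U : Set (Fin d → ℝ), IsOpen U ∧ Dset μ ⊆ U ∧ ∀ a ∈ U, phiE μ a ≠ ⊤

/-- Assumption (A3) : `M ≠ 0`. -/
def A3 (μ : (Fin d → ℤ) → ℝ) : Prop := Mvec μ ≠ 0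

/-- projection `x ↦ x^Λ`. -/
def projL (Λ : Set (Fin d)) (x : Fin d → ℤ) : ↥Λ → ℤ := fun i => x (i : Fin d)

/-- jump distribution `μ_Λ(v) = Σ_{x : x^Λ = v} μ(x)` of the projected walk. -/
def muL (μ : (Fin d → ℤ) → ℝ) (Λ : Set (Fin d)) (v : ↥Λ → ℤ) : ℝ :=
  ∑' x : Fin d → ℤ, if projL Λ x = v then μ x else 0

/-- `ℤ^Λ_+`. -/
def posL (Λ : Set (Fin d)) : Set (↥Λ → ℤ) := {u | ∀ i, 0 < u i}

end

/-- `h_q(x) = exp(a(q)·x) Π_{i∈Λ(q)} xⁱ − E_x(exp(a(q)·S(τ)) Π_{i∈Λ(q)} Sⁱ(τ); τ < ∞)`. -/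
noncomputable def hq6 {d : ℕ} (μ : (Fin d → ℤ) → ℝ) (q aq : Fin d → ℝ)
    (x : Fin d → ℤ) : ℝ :=
  Real.exp (dotZ aq x) * (∏ i, if q i = 0 then (x i : ℝ) else 1) -
    exitExp μ posAll Set.univ
      (fun y => Real.exp (dotZ aq y) * ∏ i, if q i = 0 then (y i : ℝ) else 1) x

section HalfLine

lemma exp_le_quadratic (u : ℝ) : Real.exp u ≤ 1 + u + u ^ 2 * Real.exp |u| := by
  have h1 : Real.exp u - 1 ≤ u * Real.exp u := by
    have h := Real.add_one_le_exp (-u)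
    have h2 : Real.exp u * Real.exp (-u) = 1 := by rw [← Real.exp_add]; simp
    nlinarith [Real.exp_pos u, mul_le_mul_of_nonneg_left h (Real.exp_pos u).le]
  rcases le_total 0 u with hu | hu
  · rw [abs_of_nonneg hu]
    nlinarith [mul_le_mul_of_nonneg_left h1 hu]
  · have h3 := Real.add_one_le_exp u
    have h4 : 1 ≤ Real.exp |u| := Real.one_le_exp (abs_nonneg u)
    nlinarith [mul_le_mul_of_nonneg_left h4 (sq_nonneg u),
      mul_nonneg (neg_nonneg.2 hu) (by linarith : 0 ≤ Real.exp u - (u + 1))]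

variable {m : ℤ → ℝ} {r : ℝ}

lemma summable_exp (hm : ∀ k, 0 ≤ m k) (hs : Summable fun k : ℤ => m k * Real.exp (r * |(k : ℝ)|))
    {t : ℝ} (ht : |t| ≤ r) : Summable fun k : ℤ => m k * Real.exp (t * k) := by
  refine hs.of_nonneg_of_le (fun k => mul_nonneg (hm k) (Real.exp_pos _).le) fun k => ?_
  refine mul_le_mul_of_nonneg_left (Real.exp_le_exp.2 ?_) (hm k)
  calc t * k ≤ |t * k| := le_abs_self _
    _ = |t| * |(k : ℝ)| := abs_mul _ _
    _ ≤ r * |(k : ℝ)| := mul_le_mul_of_nonneg_right ht (abs_nonneg _)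

lemma summable_mass (hm : ∀ k, 0 ≤ m k) (hr : 0 < r)
    (hs : Summable fun k : ℤ => m k * Real.exp (r * |(k : ℝ)|)) : Summable m := by
  simpa using summable_exp hm hs (t := 0) (by simpa using hr.le)

lemma summable_abs_mul (hm : ∀ k, 0 ≤ m k) (hr : 0 < r)
    (hs : Summable fun k : ℤ => m k * Real.exp (r * |(k : ℝ)|)) :
    Summable fun k : ℤ => m k * |(k : ℝ)| := by
  refine (hs.mul_left r⁻¹).of_nonneg_of_le (fun k => mul_nonneg (hm k) (abs_nonneg _)) fun k => ?_
  have h := Real.add_one_le_exp (r * |(k : ℝ)|)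
  have : |(k : ℝ)| ≤ r⁻¹ * Real.exp (r * |(k : ℝ)|) := by
    rw [inv_mul_eq_div, le_div_iff₀ hr]; linarith
  calc m k * |(k : ℝ)| ≤ m k * (r⁻¹ * Real.exp (r * |(k : ℝ)|)) :=
        mul_le_mul_of_nonneg_left this (hm k)
    _ = _ := by ring

lemma summable_mul_id (hm : ∀ k, 0 ≤ m k) (hr : 0 < r)
    (hs : Summable fun k : ℤ => m k * Real.exp (r * |(k : ℝ)|)) :
    Summable fun k : ℤ => m k * (k : ℝ) :=
  (summable_abs_mul hm hr hs).of_norm_bounded fun k => by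
    simp [abs_of_nonneg (hm k)]

lemma tsum_exp_le (hm : ∀ k, 0 ≤ m k) (hr : 0 < r)
    (hs : Summable fun k : ℤ => m k * Real.exp (r * |(k : ℝ)|)) :
    ∃ C : ℝ, 0 ≤ C ∧ ∀ t : ℝ, |t| ≤ r / 2 →
      ∑' k : ℤ, m k * Real.exp (t * k) ≤ ∑' k, m k + t * ∑' k : ℤ, m k * (k : ℝ) + C * t ^ 2 := by
  refine ⟨8 / r ^ 2 * ∑' k : ℤ, m k * Real.exp (r * |(k : ℝ)|),
    mul_nonneg (by positivity) (tsum_nonneg fun k => mul_nonneg (hm k) (Real.exp_pos _).le),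
    fun t ht => ?_⟩
  have s0 := summable_mass hm hr hs
  have s1 := (summable_mul_id hm hr hs).mul_left t
  have s2 := hs.mul_left (8 / r ^ 2 * t ^ 2)
  have key : ∀ k : ℤ, m k * Real.exp (t * k) ≤
      m k + t * (m k * k) + 8 / r ^ 2 * t ^ 2 * (m k * Real.exp (r * |(k : ℝ)|)) := by
    intro k
    have h1 := exp_le_quadratic (t * k)
    have h2 : Real.exp |t * k| ≤ Real.exp (r / 2 * |(k : ℝ)|) := by
      rw [abs_mul]
      exact Real.exp_le_exp.2 (mul_le_mul_of_nonneg_right ht (abs_nonneg _))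
    have h3 := Real.quadratic_le_exp_of_nonneg (x := r / 2 * |(k : ℝ)|) (by positivity)
    have h4 : Real.exp (r * |(k : ℝ)|) =
        Real.exp (r / 2 * |(k : ℝ)|) * Real.exp (r / 2 * |(k : ℝ)|) := by
      rw [← Real.exp_add]; ring_nf
    have h5 : (k : ℝ) ^ 2 ≤ 8 / r ^ 2 * Real.exp (r / 2 * |(k : ℝ)|) := by
      rw [div_mul_eq_mul_div, le_div_iff₀ (by positivity)]
      have : (r / 2 * |(k : ℝ)|) ^ 2 = r ^ 2 * (k : ℝ) ^ 2 / 4 := by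
        rw [mul_pow, sq_abs]; ring
      have h6 : 0 ≤ r / 2 * |(k : ℝ)| := by positivity
      nlinarith
    have h7 : (t * k) ^ 2 * Real.exp |t * k| ≤
        8 / r ^ 2 * t ^ 2 * Real.exp (r * |(k : ℝ)|) := by
      rw [h4, mul_pow]
      calc t ^ 2 * (k : ℝ) ^ 2 * Real.exp |t * k|
          ≤ t ^ 2 * (8 / r ^ 2 * Real.exp (r / 2 * |(k : ℝ)|)) *
            Real.exp (r / 2 * |(k : ℝ)|) := by gcongr
        _ = _ := by ring
    have h8 : Real.exp (t * k) ≤ 1 + t * k + 8 / r ^ 2 * t ^ 2 * Real.exp (r * |(k : ℝ)|) := by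
      linarith
    calc _ ≤ m k * (1 + t * k + 8 / r ^ 2 * t ^ 2 * Real.exp (r * |(k : ℝ)|)) :=
          mul_le_mul_of_nonneg_left h8 (hm k)
      _ = _ := by ring
  have hst : Summable fun k : ℤ => m k * Real.exp (t * k) :=
    summable_exp hm hs (ht.trans (by linarith))
  refine (hst.tsum_le_tsum key ((s0.add s1).add s2)).trans (le_of_eq ?_)
  rw [(s0.add s1).tsum_add s2, s0.tsum_add s1, tsum_mul_left, tsum_mul_left]
  ring

lemma lt_tsum_exp (hm : ∀ k, 0 ≤ m k) (s0 : Summable m)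
    (s1 : Summable fun k : ℤ => m k * (k : ℝ)) {t : ℝ}
    (st : Summable fun k : ℤ => m k * Real.exp (t * k)) (ht : t ≠ 0) {j : ℤ} (hj : j ≠ 0)
    (hmj : 0 < m j) :
    ∑' k, m k + t * ∑' k : ℤ, m k * (k : ℝ) < ∑' k : ℤ, m k * Real.exp (t * k) := by
  rw [← tsum_mul_left, ← s0.tsum_add (s1.mul_left t)]
  refine Summable.tsum_lt_tsum (i := j) (fun k => ?_) ?_ (s0.add (s1.mul_left t)) st
  · nlinarith [mul_le_mul_of_nonneg_left (Real.add_one_le_exp (t * k)) (hm k)]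
  · have : t * (j : ℝ) ≠ 0 := mul_ne_zero ht (by exact_mod_cast hj)
    nlinarith [mul_lt_mul_of_pos_left (Real.add_one_lt_exp this) hmj]

lemma le_tsum_exp (hm : ∀ k, 0 ≤ m k) (s0 : Summable m)
    (s1 : Summable fun k : ℤ => m k * (k : ℝ)) {t : ℝ}
    (st : Summable fun k : ℤ => m k * Real.exp (t * k)) :
    ∑' k, m k + t * ∑' k : ℤ, m k * (k : ℝ) ≤ ∑' k : ℤ, m k * Real.exp (t * k) := by
  rw [← tsum_mul_left, ← s0.tsum_add (s1.mul_left t)]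
  refine Summable.tsum_le_tsum (fun k => ?_) (s0.add (s1.mul_left t)) st
  nlinarith [mul_le_mul_of_nonneg_left (Real.add_one_le_exp (t * k)) (hm k)]

/-- The part of the convolution with `m` that stays on the positive half-line. -/
noncomputable def halfOp (m u : ℤ → ℝ) (x k : ℤ) : ℝ := if 0 < x + k then m k * u (x + k) else 0

/-- A positive function on the half-line, subharmonic for the walk killed at `0`,
increasing and sublinear. -/
structure SubBarrier (m w : ℤ → ℝ) : Prop where
  pos : ∀ x, 0 < x → 0 < w x
  mono : ∀ x y, 0 < x → x ≤ y → w x ≤ w y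
  slope : ∀ x y : ℤ, 0 < x → x ≤ y → w y * x ≤ w x * y
  summ : ∀ x, 0 < x → Summable (halfOp m w x)
  sub : ∀ x, 0 < x → (∑' k, m k) * w x ≤ ∑' k, halfOp m w x k

/-- `x` if `p` holds and `1` otherwise. -/
noncomputable def linOrOne (p : Prop) (x : ℤ) : ℝ := if p then (x : ℝ) else 1

lemma linOrOne_pos (p : Prop) {x : ℤ} (hx : 0 < x) : 0 < linOrOne p x := by
  unfold linOrOne; split_ifs
  · exact_mod_cast hx
  · exact one_pos

lemma subBarrier_linear (hm : ∀ k, 0 ≤ m k) (hr : 0 < r)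
    (hs : Summable fun k : ℤ => m k * Real.exp (r * |(k : ℝ)|))
    (hv : 0 ≤ ∑' k : ℤ, m k * (k : ℝ)) : SubBarrier m (fun x => (x : ℝ)) := by
  have s0 := summable_mass hm hr hs
  have s1 := summable_mul_id hm hr hs
  have s1a := summable_abs_mul hm hr hs
  have hsum : ∀ x : ℤ, 0 < x → Summable (halfOp m (fun x => (x : ℝ)) x) := by
    intro x hx
    refine ((s0.mul_left (x : ℝ)).add s1a).of_norm_bounded fun k => ?_
    have hx' : (0 : ℝ) < x := by exact_mod_cast hx
    unfold halfOp
    split_ifs with h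
    · push_cast
      rw [Real.norm_eq_abs, abs_mul, abs_of_nonneg (hm k)]
      have : |(x : ℝ) + k| ≤ x + |(k : ℝ)| := (abs_add_le _ _).trans (by rw [abs_of_pos hx'])
      nlinarith [mul_le_mul_of_nonneg_left this (hm k)]
    · rw [norm_zero]
      have := hm k
      positivity
  refine ⟨fun x hx => by exact_mod_cast hx, fun x y _ h => by exact_mod_cast h,
    fun x y _ _ => by nlinarith, hsum, fun x hx => ?_⟩
  calc (∑' k, m k) * (x : ℝ) ≤ ∑' k, (x * m k + m k * k) := by
        rw [(s0.mul_left (x : ℝ)).tsum_add s1, tsum_mul_left]; linarith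
    _ ≤ _ := by
        refine Summable.tsum_le_tsum (fun k => ?_) ((s0.mul_left (x : ℝ)).add s1) (hsum x hx)
        unfold halfOp
        split_ifs with h
        · push_cast; linarith
        · have : ((x : ℝ) + k) ≤ 0 := by exact_mod_cast not_lt.1 h
          nlinarith [mul_nonneg (hm k) (neg_nonneg.2 this)]

lemma subBarrier_exp (hm : ∀ k, 0 ≤ m k) (s0 : Summable m) {η : ℝ} (hη : 0 < η)
    (st : Summable fun k : ℤ => m k * Real.exp (-η * k))
    (hle : ∑' k : ℤ, m k * Real.exp (-η * k) ≤ ∑' k, m k) :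
    SubBarrier m (fun x => 1 - Real.exp (-η * x)) := by
  have hpos : ∀ x : ℤ, 0 < x → 0 < 1 - Real.exp (-η * x) := by
    intro x hx
    have hx' : (0 : ℝ) < x := by exact_mod_cast hx
    have : Real.exp (-η * x) < 1 := by
      simpa using Real.exp_lt_exp.2 (show -η * (x : ℝ) < 0 by nlinarith)
    linarith
  have hsum : ∀ x : ℤ, 0 < x → Summable (halfOp m (fun x => 1 - Real.exp (-η * x)) x) := by
    intro x hx
    refine s0.of_norm_bounded fun k => ?_
    unfold halfOp
    split_ifs with h
    · rw [Real.norm_eq_abs, abs_mul, abs_of_nonneg (hm k), abs_of_pos (hpos _ h)]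
      nlinarith [hm k, mul_nonneg (hm k) (Real.exp_pos (-η * ((x + k : ℤ) : ℝ))).le]
    · simpa using hm k
  refine ⟨hpos, fun x y _ h => ?_, fun x y hx h => ?_, hsum, fun x hx => ?_⟩
  · have : (x : ℝ) ≤ y := by exact_mod_cast h
    have := Real.exp_le_exp.2 (show -η * (y : ℝ) ≤ -η * x by nlinarith)
    linarith
  · have hx' : (0 : ℝ) < x := by exact_mod_cast hx
    have hxy : (x : ℝ) ≤ y := by exact_mod_cast h
    have hy' : (0 : ℝ) < y := hx'.trans_le hxy
    have hc := convexOn_exp.2 (Set.mem_univ (0 : ℝ)) (Set.mem_univ (-η * (y : ℝ)))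
      (show (0 : ℝ) ≤ 1 - x / y by rw [sub_nonneg, div_le_one hy']; exact hxy)
      (show (0 : ℝ) ≤ x / y by positivity) (by ring)
    simp only [smul_eq_mul, mul_zero, zero_add, Real.exp_zero, mul_one] at hc
    have he : (x : ℝ) / y * (-η * y) = -η * x := by field_simp
    rw [he] at hc
    have h2 : (y : ℝ) * Real.exp (-η * x) ≤ y * (1 - x / y + x / y * Real.exp (-η * y)) :=
      mul_le_mul_of_nonneg_left hc hy'.le
    have h3 : (y : ℝ) * (1 - x / y + x / y * Real.exp (-η * y)) =
        y - x + x * Real.exp (-η * y) := by field_simp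
    nlinarith
  · have e : ∀ k : ℤ, m k * (1 - Real.exp (-η * ((x : ℝ) + k))) =
        m k - Real.exp (-η * x) * (m k * Real.exp (-η * k)) := fun k => by
      rw [mul_add, Real.exp_add]; ring
    calc (∑' k, m k) * (1 - Real.exp (-η * x))
        ≤ ∑' k, (m k - Real.exp (-η * x) * (m k * Real.exp (-η * k))) := by
          rw [s0.tsum_sub (st.mul_left _), tsum_mul_left]
          nlinarith [mul_le_mul_of_nonneg_left hle (Real.exp_pos (-η * x)).le]
      _ ≤ _ := by
          refine Summable.tsum_le_tsum (fun k => ?_) (s0.sub (st.mul_left _)) (hsum x hx)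
          rw [← e]
          unfold halfOp
          split_ifs with h
          · push_cast; exact le_rfl
          · have : ((x : ℝ) + k) ≤ 0 := by exact_mod_cast not_lt.1 h
            have : 1 ≤ Real.exp (-η * ((x : ℝ) + k)) := Real.one_le_exp (by nlinarith)
            nlinarith [hm k, mul_le_mul_of_nonneg_left this (hm k)]

lemma exists_subBarrier (hm : ∀ k, 0 ≤ m k) (hr : 0 < r)
    (hs : Summable fun k : ℤ => m k * Real.exp (r * |(k : ℝ)|)) (p : Prop)
    (hp : p → ∑' k : ℤ, m k * (k : ℝ) = 0) (hnp : ¬ p → 0 < ∑' k : ℤ, m k * (k : ℝ)) :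
    ∃ w, SubBarrier m w ∧ (∀ x, 0 < x → w x ≤ linOrOne p x) ∧
      ∃ κ : ℝ, 0 < κ ∧ ∀ x, 0 < x → linOrOne p x ≤ κ * w x := by
  by_cases h : p
  · refine ⟨_, subBarrier_linear hm hr hs (hp h).ge, fun x _ => ?_, 1, one_pos, fun x _ => ?_⟩ <;>
    simp [linOrOne, h]
  · obtain ⟨C, hC, hb⟩ := tsum_exp_le hm hr hs
    set v := ∑' k : ℤ, m k * (k : ℝ)
    have hv : 0 < v := hnp h
    have hη : 0 < min (r / 2) (v / (C + 1)) := by positivity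
    set η := min (r / 2) (v / (C + 1))
    have h1 : η ≤ r / 2 := min_le_left _ _
    have h2 : η * (C + 1) ≤ v := by
      rw [← le_div_iff₀ (by positivity)]; exact min_le_right _ _
    have habs : |(-η)| ≤ r / 2 := by rw [abs_neg, abs_of_pos hη]; exact h1
    have h3 := hb (-η) habs
    have w := subBarrier_exp hm (summable_mass hm hr hs) hη
      (summable_exp hm hs (habs.trans (by linarith))) (h3.trans (by nlinarith))
    refine ⟨_, w, fun x _ => ?_, (1 - Real.exp (-η * (1 : ℤ)))⁻¹,
      inv_pos.2 (w.pos 1 one_pos), fun x hx => ?_⟩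
    · simp only [linOrOne, h, if_false]
      linarith [Real.exp_pos (-η * x)]
    · simp only [linOrOne, h, if_false]
      rw [inv_mul_eq_div, le_div_iff₀ (w.pos 1 one_pos), one_mul]
      exact w.mono 1 x one_pos hx

end HalfLine

section Comparison

variable {m : ℤ → ℝ} {r : ℝ}

lemma pow_mul_le_of_step {u : ℤ → ℝ} {p : ℝ} (hp : 0 < p)
    (h : ∀ x, 0 < x → p * u (x + 1) ≤ u x) (n : ℕ) {x : ℤ} (hx : 0 < x) :
    p ^ n * u (x + n) ≤ u x := by
  induction n with
  | zero => simp
  | succ n ih =>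
    have := h (x + n) (by omega)
    calc p ^ (n + 1) * u (x + (n + 1 : ℕ)) = p ^ n * (p * u (x + n + 1)) := by
          push_cast; rw [pow_succ, ← add_assoc]; ring
      _ ≤ p ^ n * u (x + n) := mul_le_mul_of_nonneg_left this (by positivity)
      _ ≤ _ := ih

/-- An auxiliary function of the position `y`, eventually negative beyond `N`. -/
noncomputable def compFn (w : ℤ → ℝ) (θ C : ℝ) (N y : ℤ) : ℝ :=
  w y / w N + (Real.exp (θ * (y - N)) - Real.exp (-θ * N)) - C * Real.exp (2 * θ * (y - N))

lemma compFn_nonpos {w : ℤ → ℝ} (hw : SubBarrier m w) {θ : ℝ} (hθ : 0 < θ) {N y : ℤ}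
    (hN : 0 < N) (hy : N ≤ y) : compFn w θ (2 + 1 / θ) N y ≤ 0 := by
  have hN' : (1 : ℝ) ≤ N := by exact_mod_cast hN
  have ht : (0 : ℝ) ≤ (y : ℝ) - N := by
    rw [sub_nonneg]; exact_mod_cast hy
  have h1 : w y / w N ≤ 1 + ((y : ℝ) - N) := by
    rw [div_le_iff₀ (hw.pos N hN)]
    have h := hw.slope N y hN hy
    have hwN := hw.pos N hN
    have : w N * y ≤ w N * (1 + (y - N)) * N := by
      rw [mul_assoc]; exact mul_le_mul_of_nonneg_left (by nlinarith) hwN.le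
    nlinarith
  have h2 := Real.add_one_le_exp (θ * ((y : ℝ) - N))
  have h3 : Real.exp (θ * ((y : ℝ) - N)) ≤ Real.exp (2 * θ * (y - N)) :=
    Real.exp_le_exp.2 (by nlinarith [mul_nonneg hθ.le ht])
  have h4 : (y : ℝ) - N ≤ 1 / θ * Real.exp (θ * (y - N)) := by
    rw [div_mul_eq_mul_div, one_mul, le_div_iff₀ hθ]; linarith
  have h5 : 1 / θ * Real.exp (θ * ((y : ℝ) - N)) ≤ 1 / θ * Real.exp (2 * θ * (y - N)) :=
    mul_le_mul_of_nonneg_left h3 (by positivity)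
  have h6 := mul_nonneg hθ.le ht
  unfold compFn
  have := Real.exp_pos (-θ * N)
  rw [add_mul]
  nlinarith

lemma compFn_le_two {w : ℤ → ℝ} (hw : SubBarrier m w) {θ C : ℝ} (hθ : 0 < θ) (hC : 0 ≤ C)
    {N y : ℤ} (hy0 : 0 < y) (hy : y ≤ N) : compFn w θ C N y ≤ 2 := by
  have ht : (y : ℝ) - N ≤ 0 := by
    rw [sub_nonpos]; exact_mod_cast hy
  have h1 : w y / w N ≤ 1 :=
    (div_le_one (hw.pos N (hy0.trans_le hy))).2 (hw.mono y N hy0 hy)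
  have h2 : Real.exp (θ * ((y : ℝ) - N)) ≤ 1 := Real.exp_le_one_iff.2 (by nlinarith)
  have h3 := Real.exp_pos (-θ * N)
  have h4 := mul_nonneg hC (Real.exp_pos (2 * θ * ((y : ℝ) - N))).le
  unfold compFn
  linarith

lemma le_compFn {w : ℤ → ℝ} (hw : SubBarrier m w) {θ C : ℝ} (hθ : 0 < θ)
    {N y : ℤ} (hy0 : 0 < y) (hy : y ≤ N)
    (hs : 2 * C * (1 + ((N : ℝ) - y)) ≤ Real.exp (2 * θ * (N - y))) :
    w y / (2 * w N) ≤ compFn w θ C N y := by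
  have hN : 0 < N := hy0.trans_le hy
  have hy0' : (1 : ℝ) ≤ y := by exact_mod_cast hy0
  have hs0 : (0 : ℝ) ≤ (N : ℝ) - y := by
    rw [sub_nonneg]; exact_mod_cast hy
  have hwN := hw.pos N hN
  have h1 : Real.exp (-θ * N) ≤ Real.exp (θ * ((y : ℝ) - N)) :=
    Real.exp_le_exp.2 (by nlinarith)
  have h2 : 1 ≤ w y / w N * (1 + ((N : ℝ) - y)) := by
    rw [div_mul_eq_mul_div, le_div_iff₀ hwN, one_mul]
    have h := hw.slope y N hy0 hy
    have hwy := hw.pos y hy0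
    have : w y * N ≤ w y * (1 + (N - y)) * y := by
      rw [mul_assoc]; exact mul_le_mul_of_nonneg_left (by nlinarith) hwy.le
    nlinarith
  have h3 : C * Real.exp (2 * θ * ((y : ℝ) - N)) ≤ w y / w N / 2 := by
    have e : Real.exp (2 * θ * ((y : ℝ) - N)) = (Real.exp (2 * θ * (N - y)))⁻¹ := by
      rw [← Real.exp_neg]; ring_nf
    rw [e, ← div_eq_mul_inv, div_le_iff₀ (Real.exp_pos _)]
    have h4 : C * (1 + ((N : ℝ) - y)) ≤ w y / w N / 2 * Real.exp (2 * θ * (N - y)) *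
        (1 + ((N : ℝ) - y)) := by
      have := Real.exp_pos (2 * θ * ((N : ℝ) - y))
      nlinarith
    exact le_of_mul_le_mul_right h4 (by linarith)
  have e2 : w y / (2 * w N) = w y / w N / 2 := by rw [mul_comm, div_div]
  rw [e2]
  unfold compFn
  linarith

lemma sub_compFn (hm : ∀ k, 0 ≤ m k) (hr : 0 < r)
    (hs : Summable fun k : ℤ => m k * Real.exp (r * |(k : ℝ)|)) {w : ℤ → ℝ}
    (hw : SubBarrier m w) {θ C : ℝ} (hθ : 0 < θ) (hθr : 2 * θ ≤ r) (hC : 0 ≤ C) {N z : ℤ}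
    (hz : 0 < z) (hN : 0 < N)
    (hsm : Summable (halfOp m (fun y => max (compFn w θ C N y) 0) z))
    (hle : C * (∑' k : ℤ, m k * Real.exp (2 * θ * k) - ∑' k, m k) ≤
      (∑' k : ℤ, m k * Real.exp (θ * k) - ∑' k, m k) * Real.exp (θ * (N - z))) :
    (∑' k, m k) * compFn w θ C N z ≤
      ∑' k, halfOp m (fun y => max (compFn w θ C N y) 0) z k := by
  have s0 := summable_mass hm hr hs
  have s1 : Summable fun k : ℤ => m k * Real.exp (θ * k) :=
    summable_exp hm hs (by rw [abs_of_pos hθ]; linarith)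
  have s2 : Summable fun k : ℤ => m k * Real.exp (2 * θ * k) :=
    summable_exp hm hs (by rw [abs_of_pos (by positivity)]; exact hθr)
  have sw := hw.summ z hz
  have hwN := hw.pos N hN
  set E := Real.exp (θ * ((z : ℝ) - N)) with hE
  have hE2 : Real.exp (2 * θ * ((z : ℝ) - N)) = E * E := by
    rw [hE, ← Real.exp_add]; ring_nf
  have hE3 : E * Real.exp (θ * ((N : ℝ) - z)) = 1 := by
    rw [hE, ← Real.exp_add, ← mul_add, sub_add_sub_cancel, sub_self, mul_zero, Real.exp_zero]
  have key : ∀ k, halfOp m w z k * (w N)⁻¹ + (m k * Real.exp (θ * k) * E -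
      m k * Real.exp (-θ * N)) - m k * Real.exp (2 * θ * k) * (C * (E * E)) ≤
      halfOp m (fun y => max (compFn w θ C N y) 0) z k := by
    intro k
    have e1 : Real.exp (θ * k) * E = Real.exp (θ * (((z + k : ℤ) : ℝ) - N)) := by
      rw [hE, ← Real.exp_add]; push_cast; ring_nf
    have e2 : Real.exp (2 * θ * k) * (E * E) =
        Real.exp (2 * θ * (((z + k : ℤ) : ℝ) - N)) := by
      rw [← hE2, ← Real.exp_add]; push_cast; ring_nf
    unfold halfOp
    split_ifs with h
    · have := mul_le_mul_of_nonneg_left (le_max_left (compFn w θ C N (z + k)) 0) (hm k)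
      refine le_trans (le_of_eq ?_) this
      unfold compFn
      rw [← e1, ← e2]; ring
    · have h0 : (((z + k : ℤ) : ℝ)) ≤ 0 := by exact_mod_cast not_lt.1 h
      have h1 : Real.exp (θ * (((z + k : ℤ) : ℝ) - N)) ≤ Real.exp (-θ * N) :=
        Real.exp_le_exp.2 (by nlinarith)
      have h2 := mul_le_mul_of_nonneg_left h1 (hm k)
      rw [← e1] at h2
      have h3 := mul_nonneg (mul_nonneg (hm k) (Real.exp_pos (2 * θ * k)).le)
        (mul_nonneg hC (mul_self_nonneg E))
      nlinarith
  have sA := sw.mul_right (w N)⁻¹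
  have sB := s1.mul_right E
  have sC := s0.mul_right (Real.exp (-θ * N))
  have sD := s2.mul_right (C * (E * E))
  refine le_trans ?_ (((sA.add (sB.sub sC)).sub sD).tsum_le_tsum key hsm)
  rw [(sA.add (sB.sub sC)).tsum_sub sD, sA.tsum_add (sB.sub sC), sB.tsum_sub sC,
    tsum_mul_right, tsum_mul_right, tsum_mul_right, tsum_mul_right]
  have h4 : (∑' k, m k) * (w z / w N) ≤ (∑' k, halfOp m w z k) * (w N)⁻¹ := by
    rw [div_eq_mul_inv, ← mul_assoc]
    exact mul_le_mul_of_nonneg_right (hw.sub z hz) (inv_nonneg.2 hwN.le)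
  have hEp : 0 < E := Real.exp_pos _
  have h5 := mul_le_mul_of_nonneg_left hle (mul_self_nonneg E)
  unfold compFn
  rw [hE2, ← hE]
  have h6 : E * E * ((∑' k : ℤ, m k * Real.exp (θ * k) - ∑' k, m k) * Real.exp (θ * (N - z))) =
      (∑' k : ℤ, m k * Real.exp (θ * k) - ∑' k, m k) * E := by
    calc _ = (∑' k : ℤ, m k * Real.exp (θ * k) - ∑' k, m k) * E *
        (E * Real.exp (θ * ((N : ℝ) - z))) := by ring
      _ = _ := by rw [hE3, mul_one]
  nlinarith

lemma le_of_sub_super (hm : ∀ k, 0 ≤ m k) {j : ℤ} (hj : 0 < j) (hmj : 0 < m j)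
    {u Ψ : ℤ → ℝ} {K : ℝ} {N l : ℤ} (hu : ∀ x, 0 < x → 0 < u x) (hK : 0 ≤ K)
    (hus : ∀ x, 0 < x → Summable (halfOp m u x) ∧ ∑' k, halfOp m u x k ≤ (∑' k, m k) * u x)
    (hΨ0 : ∀ y, 0 < y → N ≤ y → Ψ y ≤ 0)
    (hsub : ∀ z, 0 < z → z < l → 0 < Ψ z → Summable (halfOp m Ψ z) ∧
      (∑' k, m k) * Ψ z ≤ ∑' k, halfOp m Ψ z k)
    (hl : ∀ z, 0 < z → l ≤ z → z ≤ N → Ψ z ≤ K * u z) :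
    ∀ z, 0 < z → z ≤ N → Ψ z ≤ K * u z := by
  intro x hx hxN
  by_contra! hcon
  obtain ⟨z0, hz0, hmax⟩ := (Finset.Icc 1 N).exists_max_image (fun y => Ψ y / u y)
    ⟨x, Finset.mem_Icc.2 ⟨hx, hxN⟩⟩
  set R := Ψ z0 / u z0
  obtain ⟨z, hz, hzmax⟩ := ((Finset.Icc 1 N).filter (fun y => Ψ y / u y = R)).exists_max_image id
    ⟨z0, Finset.mem_filter.2 ⟨hz0, rfl⟩⟩
  obtain ⟨hzI, hzR⟩ := Finset.mem_filter.1 hz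
  obtain ⟨hz1, hzN⟩ := Finset.mem_Icc.1 hzI
  have hRK : K < R := by
    refine lt_of_lt_of_le ?_ (hmax x (Finset.mem_Icc.2 ⟨hx, hxN⟩))
    rwa [lt_div_iff₀ (hu x hx)]
  have hR : 0 < R := hK.trans_lt hRK
  have hzpos : 0 < z := by omega
  have hΨz : Ψ z = R * u z := by
    rw [← hzR, div_mul_cancel₀ _ (hu z hzpos).ne']
  have hzl : z < l := by
    by_contra! h
    have := hl z hzpos h hzN
    rw [hΨz] at this
    exact absurd (le_of_mul_le_mul_right this (hu z hzpos)) (not_le.2 hRK)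
  have hle : ∀ y, 0 < y → Ψ y ≤ R * u y := by
    intro y hy
    rcases le_total y N with h | h
    · have := hmax y (Finset.mem_Icc.2 ⟨hy, h⟩)
      rwa [div_le_iff₀ (hu y hy)] at this
    · exact (hΨ0 y hy h).trans (mul_pos hR (hu y hy)).le
  have hlt : Ψ (z + j) < R * u (z + j) := by
    have hy : 0 < z + j := by omega
    rcases le_or_gt (z + j) N with h | h
    · refine lt_of_le_of_ne (hle _ hy) fun heq => ?_
      have := hzmax (z + j) (Finset.mem_filter.2 ⟨Finset.mem_Icc.2 ⟨hy, h⟩, by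
        rw [heq, mul_div_cancel_right₀ _ (hu _ hy).ne']⟩)
      simp only [id] at this
      omega
    · exact (hΨ0 _ hy h.le).trans_lt (mul_pos hR (hu _ hy))
  obtain ⟨hs1, hs2⟩ := hsub z hzpos hzl (hΨz ▸ mul_pos hR (hu z hzpos))
  obtain ⟨hs3, hs4⟩ := hus z hzpos
  have : ∑' k, halfOp m Ψ z k < ∑' k, R * halfOp m u z k := by
    refine Summable.tsum_lt_tsum (i := j) (fun k => ?_) ?_ hs1 (hs3.mul_left R)
    · unfold halfOp
      split_ifs with h
      · nlinarith [mul_le_mul_of_nonneg_left (hle _ h) (hm k)]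
      · simp
    · have hy : 0 < z + j := by omega
      simp only [halfOp, hy, if_true]
      nlinarith [mul_lt_mul_of_pos_left hlt hmj]
  rw [tsum_mul_left] at this
  have h7 := mul_le_mul_of_nonneg_left hs4 hR.le
  rw [hΨz] at hs2
  nlinarith

lemma barrier_comparison (hm : ∀ k, 0 ≤ m k) (hr : 0 < r)
    (hs : Summable fun k : ℤ => m k * Real.exp (r * |(k : ℝ)|)) {w : ℤ → ℝ}
    (hw : SubBarrier m w) (hv : 0 ≤ ∑' k : ℤ, m k * (k : ℝ)) {j : ℤ} (hj : 0 < j)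
    (hmj : 0 < m j) {p : ℝ} (hp : 0 < p) (hp1 : p ≤ 1) :
    ∃ c : ℝ, 0 < c ∧ ∀ u : ℤ → ℝ, (∀ x, 0 < x → 0 ≤ u x) →
      (∀ x, 0 < x → p * u (x + 1) ≤ u x) → (∀ x, 0 < x → p * u x ≤ u (x + 1)) →
      (∀ x, 0 < x → Summable (halfOp m u x) ∧ ∑' k, halfOp m u x k ≤ (∑' k, m k) * u x) →
      ∀ x N, 0 < x → x ≤ N → c * (u N * w x) ≤ u x * w N := by
  have s0 := summable_mass hm hr hs
  have s1 := summable_mul_id hm hr hs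
  set θ := r / 2 with hθdef
  have hθ : 0 < θ := by positivity
  set C := 2 + 1 / θ
  have hC : 0 < C := by positivity
  set α := ∑' k : ℤ, m k * Real.exp (θ * k) - ∑' k, m k
  set β := ∑' k : ℤ, m k * Real.exp (2 * θ * k) - ∑' k, m k
  have hα : 0 < α := by
    have := lt_tsum_exp hm s0 s1 (summable_exp hm hs (t := θ)
      (by rw [abs_of_pos hθ]; linarith)) hθ.ne' hj.ne' hmj
    have h2 := mul_nonneg hθ.le hv
    simp only [α]; linarith
  set κ := min 1 θ
  have hκ : 0 < κ := by positivity
  obtain ⟨L, hL⟩ := exists_nat_ge (2 * C / κ ^ 2 + C * |β| / (α * θ))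
  have hL1 : 2 * C / κ ^ 2 ≤ L := le_trans (le_add_of_nonneg_right (by positivity)) hL
  have hL2 : C * |β| / (α * θ) ≤ L := le_trans (le_add_of_nonneg_left (by positivity)) hL
  rw [div_le_iff₀ (by positivity)] at hL1 hL2
  refine ⟨p ^ L / 4, by positivity, fun u hu0 hp2 hp3 hus x N hx hxN => ?_⟩
  have hN : 0 < N := hx.trans_le hxN
  have hwN := hw.pos N hN
  have hwx := hw.pos x hx
  rcases (hu0 N hN).eq_or_lt with huN | huN
  · rw [← huN]; simpa using mul_nonneg (hu0 x hx) hwN.le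
  have hnear : ∀ z, 0 < z → N - L ≤ z → z ≤ N → p ^ L * u N ≤ u z := by
    intro z hz h1 h2
    obtain ⟨n, hn⟩ := Int.eq_ofNat_of_zero_le (sub_nonneg.2 h2)
    have h3 := pow_mul_le_of_step hp hp2 n hz
    have h4 : z + (n : ℤ) = N := by omega
    rw [h4] at h3
    refine le_trans (mul_le_mul_of_nonneg_right ?_ huN.le) h3
    exact pow_le_pow_of_le_one hp.le hp1 (by omega)
  rcases le_or_gt (N - L) x with hxl | hxl
  · have h1 := hnear x hx hxl hxN
    have h2 := hw.mono x N hx hxN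
    have h3 : p ^ L * u N * w x ≤ u x * w N :=
      mul_le_mul h1 h2 hwx.le (hu0 x hx)
    have : 0 ≤ p ^ L * u N * w x := by positivity
    linarith
  have hupos : ∀ y, 0 < y → 0 < u y := by
    intro y hy
    rcases le_total y N with h | h
    · obtain ⟨n, hn⟩ := Int.eq_ofNat_of_zero_le (sub_nonneg.2 h)
      have h3 := pow_mul_le_of_step hp hp2 n hy
      have h4 : y + (n : ℤ) = N := by omega
      rw [h4] at h3
      exact lt_of_lt_of_le (by positivity) h3
    · obtain ⟨n, hn⟩ := Int.eq_ofNat_of_zero_le (sub_nonneg.2 h)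
      have h4 : y = N + n := by omega
      rw [h4]
      clear hn h4
      induction n with
      | zero => simpa using huN
      | succ n ih =>
        have := hp3 (N + n) (by omega)
        push_cast
        rw [← add_assoc]
        exact lt_of_lt_of_le (mul_pos hp ih) this
  have hbig : ∀ z : ℤ, z < N - L → (L : ℝ) ≤ (N : ℝ) - z := by
    intro z hz
    have : (z : ℝ) ≤ N - L := by exact_mod_cast hz.le
    linarith
  set Ψ : ℤ → ℝ := fun y => max (compFn w θ C N y) 0
  have hΨ2 : ∀ y, 0 < y → Ψ y ≤ 2 := by
    intro y hy
    rcases le_total y N with h | h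
    · exact max_le (compFn_le_two hw hθ hC.le hy h) (by norm_num)
    · exact max_le ((compFn_nonpos hw hθ hN h).trans (by norm_num)) (by norm_num)
  have hΨs : ∀ z, Summable (halfOp m Ψ z) := by
    intro z
    refine (s0.mul_right 2).of_norm_bounded fun k => ?_
    unfold halfOp
    split_ifs with h
    · rw [Real.norm_eq_abs, abs_of_nonneg (mul_nonneg (hm k) (le_max_right _ _))]
      exact mul_le_mul_of_nonneg_left (hΨ2 _ h) (hm k)
    · rw [norm_zero]; exact mul_nonneg (hm k) (by norm_num)
  have hdom := le_of_sub_super (m := m) (u := u) (Ψ := Ψ) (K := 2 / (p ^ L * u N)) (N := N)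
    (l := N - L) hm hj hmj hupos (by positivity) hus
    (fun y _ h => max_le (compFn_nonpos hw hθ hN h) le_rfl)
    (fun z hz hzl hΨz => ⟨hΨs z, by
      have hzΨ : Ψ z = compFn w θ C N z := by
        rcases max_choice (compFn w θ C N z) 0 with h | h
        · exact h
        · simp only [Ψ, h] at hΨz; exact absurd hΨz (lt_irrefl _)
      rw [hzΨ]
      refine sub_compFn hm hr hs hw hθ (by linarith) hC.le hz hN (hΨs z) ?_
      have h1 := Real.add_one_le_exp (θ * ((N : ℝ) - z))
      have h2 := mul_le_mul_of_nonneg_left (hbig z hzl) (mul_pos hα hθ).le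
      have h3 : C * β ≤ C * |β| := mul_le_mul_of_nonneg_left (le_abs_self _) hC.le
      have h4 := mul_le_mul_of_nonneg_left h1 hα.le
      calc C * β ≤ α * (θ * ((N : ℝ) - z)) := by linarith
        _ ≤ _ := by linarith⟩)
    (fun z hz h1 h2 => by
      have h3 := hnear z hz h1 h2
      refine (hΨ2 z hz).trans ?_
      rw [div_mul_eq_mul_div, le_div_iff₀ (by positivity)]
      linarith) x hx hxN
  have hlow : w x / (2 * w N) ≤ Ψ x := by
    refine le_trans (le_compFn hw hθ hx hxN ?_) (le_max_left _ _)
    have hb := hbig x hxl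
    set s := (N : ℝ) - x
    have hs0 : 0 ≤ s := le_trans (Nat.cast_nonneg L) hb
    have h1 := Real.add_one_le_exp (θ * s)
    have h2 : κ * (1 + s) ≤ Real.exp (θ * s) := by
      have a1 : κ ≤ 1 := min_le_left _ _
      have a2 : κ * s ≤ θ * s := mul_le_mul_of_nonneg_right (min_le_right _ _) hs0
      linarith
    have h3 : Real.exp (2 * θ * s) = Real.exp (θ * s) * Real.exp (θ * s) := by
      rw [← Real.exp_add]; ring_nf
    rw [h3]
    have h4 : (κ * (1 + s)) * (κ * (1 + s)) ≤ Real.exp (θ * s) * Real.exp (θ * s) :=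
      mul_le_mul h2 h2 (by positivity) (Real.exp_pos _).le
    have h5 : 2 * C ≤ κ ^ 2 * (1 + s) := by nlinarith [sq_nonneg κ]
    nlinarith [mul_le_mul_of_nonneg_right h5 (by linarith : 0 ≤ 1 + s)]
  have h9 := hlow.trans hdom
  rw [div_le_iff₀ (by positivity), div_mul_eq_mul_div, div_mul_eq_mul_div,
    le_div_iff₀ (by positivity)] at h9
  nlinarith

end Comparison

section Uniqueness

variable {m : ℤ → ℝ} {r : ℝ}

lemma halfOp_sub_mul (m u v : ℤ → ℝ) (t : ℝ) (x k : ℤ) :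
    halfOp m (fun y => u y - t * v y) x k = halfOp m u x k - t * halfOp m v x k := by
  unfold halfOp; split_ifs <;> ring

lemma halfOp_mul_sub (m u v : ℤ → ℝ) (t : ℝ) (x k : ℤ) :
    halfOp m (fun y => t * v y - u y) x k = t * halfOp m v x k - halfOp m u x k := by
  unfold halfOp; split_ifs <;> ring

lemma ratio_comparison {w u V : ℤ → ℝ} {c κ₁ κ₂ : ℝ} (hc : 0 < c) (hκ₂ : 0 < κ₂)
    {x y : ℤ} (hwx : 0 < w x) (hwy : 0 < w y) (hVx : V x ≤ κ₂ * w x) (hVy : κ₁ * w y ≤ V y)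
    {a b : ℝ} (ha : 0 ≤ a) (hb : 0 ≤ b) (hux : u x = a * V x) (huy : u y = b * V y)
    (h : c * (u y * w x) ≤ u x * w y) : c * κ₁ / κ₂ * b ≤ a := by
  rw [hux, huy] at h
  have h1 := mul_le_mul_of_nonneg_left hVy (by positivity : 0 ≤ c * b * w x)
  have h2 := mul_le_mul_of_nonneg_left hVx (by positivity : 0 ≤ a * w y)
  have h3 : (c * κ₁ * b) * (w x * w y) ≤ (κ₂ * a) * (w x * w y) := by nlinarith
  have h4 := le_of_mul_le_mul_right h3 (by positivity)
  rw [div_mul_eq_mul_div, div_le_iff₀ hκ₂]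
  linarith

lemma harmonic_ratio_const (hm : ∀ k, 0 ≤ m k) (hr : 0 < r)
    (hs : Summable fun k : ℤ => m k * Real.exp (r * |(k : ℝ)|)) {w : ℤ → ℝ}
    (hw : SubBarrier m w) (hv : 0 ≤ ∑' k : ℤ, m k * (k : ℝ)) {j : ℤ} (hj : 0 < j)
    (hmj : 0 < m j) {p : ℝ} (hp : 0 < p) (hp1 : p ≤ 1)
    (hH : ∀ u : ℤ → ℝ, (∀ x, 0 < x → 0 ≤ u x) →
      (∀ x, 0 < x → Summable (halfOp m u x) ∧ ∑' k, halfOp m u x k ≤ (∑' k, m k) * u x) →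
      ∀ x, 0 < x → p * u (x + 1) ≤ u x ∧ p * u x ≤ u (x + 1))
    {f V : ℤ → ℝ} {κ₁ κ₂ : ℝ} (hκ₁ : 0 < κ₁) (hκ₂ : 0 < κ₂)
    (hV₁ : ∀ x, 0 < x → κ₁ * w x ≤ V x) (hV₂ : ∀ x, 0 < x → V x ≤ κ₂ * w x)
    (hf0 : ∀ x, 0 < x → 0 ≤ f x)
    (hf : ∀ x, 0 < x → Summable (halfOp m f x) ∧ ∑' k, halfOp m f x k = (∑' k, m k) * f x)
    (hV : ∀ x, 0 < x → Summable (halfOp m V x) ∧ ∑' k, halfOp m V x k = (∑' k, m k) * V x) :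
    ∀ x y, 0 < x → 0 < y → f x * V y = f y * V x := by
  obtain ⟨c, hc, hcomp⟩ := barrier_comparison hm hr hs hw hv hj hmj hp hp1
  have comp : ∀ u : ℤ → ℝ, (∀ x, 0 < x → 0 ≤ u x) →
      (∀ x, 0 < x → Summable (halfOp m u x) ∧ ∑' k, halfOp m u x k ≤ (∑' k, m k) * u x) →
      ∀ x N, 0 < x → x ≤ N → c * (u N * w x) ≤ u x * w N := fun u h1 h2 =>
    hcomp u h1 (fun x hx => (hH u h1 h2 x hx).1) (fun x hx => (hH u h1 h2 x hx).2) h2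
  have hVpos : ∀ x, 0 < x → 0 < V x := fun x hx =>
    lt_of_lt_of_le (mul_pos hκ₁ (hw.pos x hx)) (hV₁ x hx)
  set R : ℕ → ℝ := fun n => f (n + 1) / V (n + 1) with hR
  have hpos : ∀ n : ℕ, (0 : ℤ) < n + 1 := fun n => by positivity
  have hR0 : ∀ n, 0 ≤ R n := fun n => div_nonneg (hf0 _ (hpos n)) (hVpos _ (hpos n)).le
  have hfR : ∀ n : ℕ, f (n + 1) = R n * V (n + 1) := fun n => by
    rw [hR]; exact (div_mul_cancel₀ _ (hVpos _ (hpos n)).ne').symm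
  set c' := c * κ₁ / κ₂ with hc'
  have hc'0 : 0 < c' := by positivity
  have hle1 : ∀ n l : ℕ, n ≤ l → c' * R l ≤ R n := fun n l hnl =>
    ratio_comparison hc hκ₂ (hw.pos _ (hpos n)) (hw.pos _ (hpos l)) (hV₂ _ (hpos n))
      (hV₁ _ (hpos l)) (hR0 n) (hR0 l) (hfR n) (hfR l)
      (comp f hf0 (fun x hx => ⟨(hf x hx).1, (hf x hx).2.le⟩) _ _ (hpos n) (by omega))
  have hba : BddAbove (Set.range R) := ⟨R 0 / c', by
    rintro _ ⟨n, rfl⟩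
    rw [le_div_iff₀ hc'0]
    have := hle1 0 n (Nat.zero_le _)
    linarith⟩
  have hbb : BddBelow (Set.range R) := ⟨0, by rintro _ ⟨n, rfl⟩; exact hR0 n⟩
  set a := ⨅ n, R n
  set b := ⨆ n, R n
  have haR : ∀ n, a ≤ R n := fun n => ciInf_le hbb n
  have hbR : ∀ n, R n ≤ b := fun n => le_ciSup hba n
  have hex : ∀ x : ℤ, 0 < x → ∃ n : ℕ, x = n + 1 := fun x hx => by
    obtain ⟨n, hn⟩ := Int.eq_ofNat_of_zero_le (by omega : 0 ≤ x - 1)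
    exact ⟨n, by omega⟩
  have hle2 : ∀ n l : ℕ, n ≤ l → c' * (R l - a) ≤ R n - a := fun n l hnl =>
    ratio_comparison (u := fun y => f y - a * V y) hc hκ₂ (hw.pos _ (hpos n))
      (hw.pos _ (hpos l)) (hV₂ _ (hpos n)) (hV₁ _ (hpos l)) (sub_nonneg.2 (haR n))
      (sub_nonneg.2 (haR l)) (by simp only [hfR n]; ring) (by simp only [hfR l]; ring)
      (comp (fun y => f y - a * V y) (fun x hx => by
        obtain ⟨k, rfl⟩ := hex x hx
        rw [hfR k, ← sub_mul]
        exact mul_nonneg (sub_nonneg.2 (haR k)) (hVpos _ hx).le)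
        (fun x hx => by
          rw [show halfOp m (fun y => f y - a * V y) x = fun k => halfOp m f x k - a *
            halfOp m V x k from funext fun k => halfOp_sub_mul m f V a x k]
          refine ⟨(hf x hx).1.sub ((hV x hx).1.mul_left a), le_of_eq ?_⟩
          rw [(hf x hx).1.tsum_sub ((hV x hx).1.mul_left a), tsum_mul_left, (hf x hx).2,
            (hV x hx).2]
          ring) (n + 1) (l + 1) (hpos n) (by omega))
  have hle3 : ∀ n l : ℕ, n ≤ l → c' * (b - R l) ≤ b - R n := fun n l hnl =>
    ratio_comparison (u := fun y => b * V y - f y) hc hκ₂ (hw.pos _ (hpos n))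
      (hw.pos _ (hpos l)) (hV₂ _ (hpos n)) (hV₁ _ (hpos l)) (sub_nonneg.2 (hbR n))
      (sub_nonneg.2 (hbR l)) (by simp only [hfR n]; ring) (by simp only [hfR l]; ring)
      (comp (fun y => b * V y - f y) (fun x hx => by
        obtain ⟨k, rfl⟩ := hex x hx
        rw [hfR k, ← sub_mul]
        exact mul_nonneg (sub_nonneg.2 (hbR k)) (hVpos _ hx).le)
        (fun x hx => by
          rw [show halfOp m (fun y => b * V y - f y) x = fun k => b * halfOp m V x k -
            halfOp m f x k from funext fun k => halfOp_mul_sub m f V b x k]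
          refine ⟨((hV x hx).1.mul_left b).sub (hf x hx).1, le_of_eq ?_⟩
          rw [((hV x hx).1.mul_left b).tsum_sub (hf x hx).1, tsum_mul_left, (hf x hx).2,
            (hV x hx).2]
          ring) (n + 1) (l + 1) (hpos n) (by omega))
  have hab : a = b := by
    by_contra hne
    have hlt : a < b := lt_of_le_of_ne ((haR 0).trans (hbR 0)) hne
    set γ := min c' 1
    have hγ : 0 < γ := by positivity
    have hγc : γ ≤ c' := min_le_left _ _
    have hγ1 : γ ≤ 1 := min_le_right _ _
    have hε : 0 < γ * (b - a) / 4 := by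
      have := sub_pos.2 hlt
      positivity
    obtain ⟨n, hn⟩ := exists_lt_of_ciInf_lt (show ⨅ n, R n < a + γ * (b - a) / 4 by
      change a < _; linarith)
    obtain ⟨l, hl⟩ := exists_lt_of_lt_ciSup (show b - γ * (b - a) / 4 < ⨆ n, R n by
      change _ < b; linarith)
    have h1 := haR n
    have h2 := hbR l
    rcases le_total n l with h | h
    · have h3 := hle2 n l h
      have h4 : γ * (R l - a) ≤ c' * (R l - a) :=
        mul_le_mul_of_nonneg_right hγc (sub_nonneg.2 (haR l))
      have h5 : γ * (b - γ * (b - a) / 4 - a) ≤ γ * (R l - a) :=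
        mul_le_mul_of_nonneg_left (by linarith) hγ.le
      have h6 : γ * (γ * (b - a) / 4) ≤ 1 * (γ * (b - a) / 4) :=
        mul_le_mul_of_nonneg_right hγ1 hε.le
      nlinarith
    · have h3 := hle3 l n h
      have h4 : γ * (b - R n) ≤ c' * (b - R n) :=
        mul_le_mul_of_nonneg_right hγc (sub_nonneg.2 (hbR n))
      have h5 : γ * (b - (a + γ * (b - a) / 4)) ≤ γ * (b - R n) :=
        mul_le_mul_of_nonneg_left (by linarith) hγ.le
      have h6 : γ * (γ * (b - a) / 4) ≤ 1 * (γ * (b - a) / 4) :=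
        mul_le_mul_of_nonneg_right hγ1 hε.le
      nlinarith
  intro x y hx hy
  obtain ⟨n, rfl⟩ := hex x hx
  obtain ⟨l, rfl⟩ := hex y hy
  have e1 : R n = a := le_antisymm ((hbR n).trans hab.ge) (haR n)
  have e2 : R l = a := le_antisymm ((hbR l).trans hab.ge) (haR l)
  rw [hfR n, hfR l, e1, e2]
  ring

/-- The part of the convolution with `m` that leaves the positive half-line. -/
noncomputable def exitOp (m u : ℤ → ℝ) (x k : ℤ) : ℝ := if x + k ≤ 0 then m k * u (x + k) else 0

lemma exists_lyapunov (hm : ∀ k, 0 ≤ m k) (hr : 0 < r)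
    (hs : Summable fun k : ℤ => m k * Real.exp (r * |(k : ℝ)|)) {j : ℤ} (hj : j ≠ 0)
    (hmj : 0 < m j) (p : Prop) (hp : p → ∑' k : ℤ, m k * (k : ℝ) = 0) :
    ∃ ψ : ℤ → ℝ, ∃ C : ℝ, 0 < C ∧
      (∀ x, 0 < x → linOrOne p x ≤ ψ x ∧ ψ x ≤ C * linOrOne p x) ∧
      ∀ x, 0 < x → Summable (halfOp m ψ x) ∧
        Summable (exitOp m (fun y => if p then |(y : ℝ)| else 0) x) ∧
        ∑' k, halfOp m ψ x k + ∑' k, exitOp m (fun y => if p then |(y : ℝ)| else 0) x k ≤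
          (∑' k, m k) * ψ x := by
  have s0 := summable_mass hm hr hs
  by_cases h : p
  swap
  · refine ⟨fun _ => 1, 1, one_pos, fun x _ => by simp [linOrOne, h], fun x hx => ?_⟩
    have hh : Summable (halfOp m (fun _ => 1) x) := s0.of_norm_bounded fun k => by
      unfold halfOp; split_ifs
      · simp [abs_of_nonneg (hm k)]
      · simpa using hm k
    have h0 : exitOp m (fun y => if p then |(y : ℝ)| else 0) x = fun _ => 0 := by
      funext k; simp [exitOp, h]
    rw [h0]
    refine ⟨hh, summable_zero, ?_⟩
    rw [tsum_zero, add_zero, mul_one]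
    refine hh.tsum_le_tsum (fun k => ?_) s0
    unfold halfOp; split_ifs
    · simp
    · exact hm k
  have hv := hp h
  simp only [h, if_true, linOrOne]
  have s1 := summable_mul_id hm hr hs
  set η := r / 2 with hη
  have hη0 : 0 < η := by positivity
  have sη : Summable fun k : ℤ => m k * Real.exp (-η * k) :=
    summable_exp hm hs (by rw [abs_neg, abs_of_pos hη0]; linarith)
  set lam := ∑' k : ℤ, m k * Real.exp (-η * k) - ∑' k, m k with hlam
  have hl : 0 < lam := by
    have := lt_tsum_exp hm s0 s1 sη (neg_ne_zero.2 hη0.ne') hj hmj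
    rw [hv] at this
    linarith
  set S := ∑' k : ℤ, m k * Real.exp (r * |(k : ℝ)|) with hS
  have hS0 : 0 ≤ S := tsum_nonneg fun k => mul_nonneg (hm k) (Real.exp_pos _).le
  set M := max 1 (S / (2 * lam))
  have hM1 : 1 ≤ M := le_max_left _ _
  have hM0 : 0 < M := by linarith
  have hM2 : S / (4 * M) ≤ lam / 2 := by
    have := le_max_right 1 (S / (2 * lam))
    rw [div_le_iff₀ (by positivity)] at this ⊢
    change S ≤ M * (2 * lam) at this
    linarith
  set K := 2 * S / (η * lam) with hK
  have hK0 : 0 ≤ K := by positivity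
  have hKS : S / η + K * (S / (4 * M)) ≤ K * lam := by
    have e : S / η = K * lam / 2 := by rw [hK]; field_simp
    have := mul_le_mul_of_nonneg_left hM2 hK0
    linarith
  set ψ : ℤ → ℝ := fun x => x + K * (M - Real.exp (-η * x)) with hψ
  have hψ1 : ∀ x : ℤ, 0 < x → (x : ℝ) ≤ ψ x := fun x hx => by
    have hx' : (0 : ℝ) < x := by exact_mod_cast hx
    have : Real.exp (-η * x) ≤ 1 := Real.exp_le_one_iff.2 (by nlinarith)
    have : 0 ≤ K * (M - Real.exp (-η * x)) := mul_nonneg hK0 (by linarith)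
    simp only [hψ]; linarith
  refine ⟨ψ, 1 + K * M, by positivity, fun x hx => ⟨hψ1 x hx, ?_⟩, fun x hx => ?_⟩
  · have hx' : (1 : ℝ) ≤ x := by exact_mod_cast hx
    have := mul_nonneg hK0 (Real.exp_pos (-η * x)).le
    have h2 : K * M * 1 ≤ K * M * x := mul_le_mul_of_nonneg_left hx' (by positivity)
    simp only [hψ]; linarith
  have hx' : (0 : ℝ) < x := by exact_mod_cast hx
  set e := Real.exp (-η * x) with he
  have he0 : 0 < e := Real.exp_pos _
  set U : ℤ → ℝ := fun k => m k * (x + K * M) + m k * k - m k * Real.exp (-η * k) * (K * e) +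
    m k * Real.exp (r * |(k : ℝ)|) * ((1 / η + K / (4 * M)) * e) with hU
  have sA := s0.mul_right (x + K * M)
  have sC := sη.mul_right (K * e)
  have sD := hs.mul_right ((1 / η + K / (4 * M)) * e)
  have sU : Summable U := ((sA.add s1).sub sC).add sD
  have hq0 : 0 ≤ 1 / η + K / (4 * M) := by positivity
  have key : ∀ k, halfOp m ψ x k + exitOp m (fun y => |(y : ℝ)|) x k ≤ U k := by
    intro k
    have ee : Real.exp (-η * k) * e = Real.exp (-η * ((x + k : ℤ) : ℝ)) := by
      rw [he, ← Real.exp_add]; push_cast; ring_nf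
    have hd := mul_nonneg (mul_nonneg (hm k) (Real.exp_pos (r * |(k : ℝ)|)).le)
      (mul_nonneg hq0 he0.le)
    unfold halfOp exitOp
    by_cases hk : 0 < x + k
    · rw [if_pos hk, if_neg (not_le.2 hk)]
      have : m k * ψ (x + k) = m k * (x + K * M) + m k * k - m k * Real.exp (-η * k) * (K * e) := by
        simp only [hψ]; rw [← ee]; push_cast; ring
      rw [this]; simp only [hU]; linarith
    · have hk' := not_lt.1 hk
      rw [if_neg hk, if_pos hk', zero_add]
      set n : ℝ := -((x + k : ℤ) : ℝ) with hn
      have hn0 : 0 ≤ n := by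
        rw [hn, neg_nonneg]; exact_mod_cast hk'
      have habs : |((x + k : ℤ) : ℝ)| = n := by
        rw [abs_of_nonpos (by linarith)]
      set t := Real.exp (η * n) with ht
      have ht0 : 0 < t := Real.exp_pos _
      have htt : t * t ≤ Real.exp (r * |(k : ℝ)|) * e := by
        rw [ht, he, ← Real.exp_add, ← Real.exp_add]
        refine Real.exp_le_exp.2 ?_
        have : -(k : ℝ) ≤ |(k : ℝ)| := neg_le_abs _
        have h1 : n = -(x : ℝ) - k := by rw [hn]; push_cast; ring
        rw [h1]
        have h2 : r = 2 * η := by rw [hη]; ring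
        rw [h2]
        nlinarith
      have h2n : 2 * n ≤ 1 / η * (t * t) := by
        rw [div_mul_eq_mul_div, le_div_iff₀ hη0, ht, ← Real.exp_add]
        have := Real.add_one_le_exp (η * n + η * n)
        linarith
      have ham : t - M ≤ 1 / (4 * M) * (t * t) := by
        rw [div_mul_eq_mul_div, le_div_iff₀ (by positivity)]
        nlinarith [sq_nonneg (t - 2 * M)]
      have h3 := mul_le_mul_of_nonneg_left ham hK0
      have h4 := mul_le_mul_of_nonneg_left htt hq0
      have e4 : K * (1 / (4 * M) * (t * t)) = K / (4 * M) * (t * t) := by ring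
      have h5 : n ≤ -n + K * M - K * t + (1 / η + K / (4 * M)) *
          (Real.exp (r * |(k : ℝ)|) * e) := by linarith
      have h6 := mul_le_mul_of_nonneg_left h5 (hm k)
      have e5 : t = Real.exp (-η * k) * e := by
        rw [ee, ht, hn]; ring_nf
      beta_reduce
      rw [habs]
      refine h6.trans (le_of_eq ?_)
      simp only [hU]
      rw [e5, hn]; push_cast; ring
  have hh0 : ∀ k, 0 ≤ halfOp m ψ x k := fun k => by
    unfold halfOp; split_ifs with hk
    · have : (0 : ℝ) < ((x + k : ℤ) : ℝ) := by exact_mod_cast hk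
      exact mul_nonneg (hm k) (this.le.trans (hψ1 _ hk))
    · exact le_rfl
  have he0' : ∀ k, 0 ≤ exitOp m (fun y => |(y : ℝ)|) x k := fun k => by
    unfold exitOp; split_ifs
    · exact mul_nonneg (hm k) (abs_nonneg _)
    · exact le_rfl
  have sh : Summable (halfOp m ψ x) := sU.of_nonneg_of_le hh0 fun k => by
    linarith [key k, he0' k]
  have se : Summable (exitOp m (fun y => |(y : ℝ)|) x) := sU.of_nonneg_of_le he0' fun k => by
    linarith [key k, hh0 k]
  refine ⟨sh, se, ?_⟩
  rw [← sh.tsum_add se]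
  refine ((sh.add se).tsum_le_tsum key sU).trans ?_
  simp only [hU]
  rw [((sA.add s1).sub sC).tsum_add sD, (sA.add s1).tsum_sub sC, sA.tsum_add s1,
    tsum_mul_right, tsum_mul_right, tsum_mul_right, hv, ← hS]
  have e6 : ∑' k : ℤ, m k * Real.exp (-η * k) = lam + ∑' k, m k := by rw [hlam]; ring
  rw [e6]
  simp only [hψ]
  have h7 := mul_le_mul_of_nonneg_right hKS he0.le
  have e7 : S * ((1 / η + K / (4 * M)) * e) = (S / η + K * (S / (4 * M))) * e := by ring
  rw [e7]
  nlinarith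

end Uniqueness

section Operators

open ENNReal

variable {d : ℕ}

/-- Jump operator along the `i`-th axis for the walk killed outside the positive orthant. -/
noncomputable def axisOp (ν : ℤ → ℝ≥0∞) (i : Fin d) :
    Module.End ℝ≥0∞ ((Fin d → ℤ) → ℝ≥0∞) where
  toFun f x := ∑' k, if x ∈ posAll ∧ x + Pi.single i k ∈ posAll then
    ν k * f (x + Pi.single i k) else 0
  map_add' f g := by
    funext x
    rw [Pi.add_apply, ← ENNReal.tsum_add]
    refine tsum_congr fun k => ?_
    split_ifs
    · rw [Pi.add_apply, mul_add]
    · simp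
  map_smul' c f := by
    funext x
    rw [RingHom.id_apply, Pi.smul_apply, smul_eq_mul, ← ENNReal.tsum_mul_left]
    refine tsum_congr fun k => ?_
    split_ifs
    · rw [Pi.smul_apply, smul_eq_mul]; ring
    · simp

lemma axisOp_apply (ν : ℤ → ℝ≥0∞) (i : Fin d) (f : (Fin d → ℤ) → ℝ≥0∞) (x : Fin d → ℤ) :
    axisOp ν i f x = ∑' k, if x ∈ posAll ∧ x + Pi.single i k ∈ posAll then
      ν k * f (x + Pi.single i k) else 0 := rfl

lemma add_single_mem_posAll {x : Fin d → ℤ} (hx : x ∈ posAll) (i : Fin d) (k : ℤ) :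
    x + Pi.single i k ∈ posAll ↔ 0 < x i + k := by
  constructor
  · intro h; simpa using h i
  · intro h j
    by_cases hj : j = i
    · subst hj; simpa using h
    · simpa [hj] using hx j

lemma axisOp_apply_mem (ν : ℤ → ℝ≥0∞) (i : Fin d) (f : (Fin d → ℤ) → ℝ≥0∞) {x : Fin d → ℤ}
    (hx : x ∈ posAll) :
    axisOp ν i f x = ∑' k, if 0 < x i + k then ν k * f (x + Pi.single i k) else 0 := by
  rw [axisOp_apply]
  simp only [hx, true_and, add_single_mem_posAll hx]

lemma axisOp_apply_notMem (ν : ℤ → ℝ≥0∞) (i : Fin d) (f : (Fin d → ℤ) → ℝ≥0∞) {x : Fin d → ℤ}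
    (hx : x ∉ posAll) : axisOp ν i f x = 0 := by
  simp [axisOp_apply, hx]

lemma axisOp_mono (ν : ℤ → ℝ≥0∞) (i : Fin d) {f g : (Fin d → ℤ) → ℝ≥0∞}
    (h : ∀ x ∈ posAll, f x ≤ g x) (x : Fin d → ℤ) : axisOp ν i f x ≤ axisOp ν i g x := by
  rw [axisOp_apply, axisOp_apply]
  refine ENNReal.tsum_le_tsum fun k => ?_
  split_ifs with hk
  · gcongr; exact h _ hk.2
  · exact le_rfl

lemma axisOp_tsum {ι : Type*} (ν : ℤ → ℝ≥0∞) (i : Fin d) (f : ι → (Fin d → ℤ) → ℝ≥0∞)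
    (x : Fin d → ℤ) :
    axisOp ν i (fun y => ∑' n, f n y) x = ∑' n, axisOp ν i (f n) x := by
  simp only [axisOp_apply]
  rw [ENNReal.tsum_comm]
  refine tsum_congr fun k => ?_
  split_ifs
  · rw [ENNReal.tsum_mul_left]
  · simp

lemma axisOp_mul_apply {i j : Fin d} (hij : i ≠ j) (ν ν' : ℤ → ℝ≥0∞)
    (f : (Fin d → ℤ) → ℝ≥0∞) (x : Fin d → ℤ) :
    axisOp ν i (axisOp ν' j f) x = ∑' k, ∑' l,
      if x ∈ posAll ∧ 0 < x i + k ∧ 0 < x j + l then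
        ν k * ν' l * f (x + Pi.single i k + Pi.single j l) else 0 := by
  by_cases hx : x ∈ posAll
  · rw [axisOp_apply_mem _ _ _ hx]
    refine tsum_congr fun k => ?_
    split_ifs with hk
    · rw [axisOp_apply_mem _ _ _ ((add_single_mem_posAll hx i k).2 hk), ← ENNReal.tsum_mul_left]
      refine tsum_congr fun l => ?_
      simp only [hx, hk, true_and, Pi.add_apply, Pi.single_eq_of_ne hij.symm, add_zero]
      split_ifs
      · ring
      · simp
    · simp [hk]
  · rw [axisOp_apply_notMem _ _ _ hx]; simp [hx]

lemma axisOp_commute {i j : Fin d} (hij : i ≠ j) (ν ν' : ℤ → ℝ≥0∞) :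
    Commute (axisOp ν i) (axisOp ν' j) := by
  refine LinearMap.ext fun f => funext fun x => ?_
  change axisOp ν i (axisOp ν' j f) x = axisOp ν' j (axisOp ν i f) x
  rw [axisOp_mul_apply hij, axisOp_mul_apply hij.symm, ENNReal.tsum_comm]
  refine tsum_congr fun l => tsum_congr fun k => ?_
  have : x + Pi.single i k + Pi.single j l = x + Pi.single j l + Pi.single i k := by abel
  rw [this, mul_comm (ν k)]
  exact if_congr (by tauto) rfl rfl

/-- Transition operator of the walk killed outside the positive orthant, with jumps along axes. -/
noncomputable def walkOp (ν : Fin d → ℤ → ℝ≥0∞) : Module.End ℝ≥0∞ ((Fin d → ℤ) → ℝ≥0∞) :=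
  ∑ i, axisOp (ν i) i

lemma walkOp_apply (ν : Fin d → ℤ → ℝ≥0∞) (f : (Fin d → ℤ) → ℝ≥0∞) (x : Fin d → ℤ) :
    walkOp ν f x = ∑ i, axisOp (ν i) i f x := by
  simp [walkOp, LinearMap.sum_apply, Finset.sum_apply]

lemma axisOp_le_walkOp (ν : Fin d → ℤ → ℝ≥0∞) (i : Fin d) (f : (Fin d → ℤ) → ℝ≥0∞)
    (x : Fin d → ℤ) : axisOp (ν i) i f x ≤ walkOp ν f x := by
  rw [walkOp_apply]
  exact Finset.single_le_sum (f := fun i => axisOp (ν i) i f x) (fun _ _ => zero_le)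
    (Finset.mem_univ i)

lemma walkOp_mono (ν : Fin d → ℤ → ℝ≥0∞) {f g : (Fin d → ℤ) → ℝ≥0∞}
    (h : ∀ x ∈ posAll, f x ≤ g x) (x : Fin d → ℤ) : walkOp ν f x ≤ walkOp ν g x := by
  rw [walkOp_apply, walkOp_apply]
  exact Finset.sum_le_sum fun i _ => axisOp_mono _ _ h x

lemma walkOp_tsum {ι : Type*} (ν : Fin d → ℤ → ℝ≥0∞) (f : ι → (Fin d → ℤ) → ℝ≥0∞)
    (x : Fin d → ℤ) : walkOp ν (fun y => ∑' n, f n y) x = ∑' n, walkOp ν (f n) x := by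
  simp only [walkOp_apply, axisOp_tsum]
  exact (Summable.tsum_finsetSum fun _ _ => ENNReal.summable).symm

lemma walkOp_apply_notMem (ν : Fin d → ℤ → ℝ≥0∞) (f : (Fin d → ℤ) → ℝ≥0∞) {x : Fin d → ℤ}
    (hx : x ∉ posAll) : walkOp ν f x = 0 := by
  simp [walkOp_apply, axisOp_apply_notMem _ _ _ hx]

lemma axisOp_commute_walkOp (ν : Fin d → ℤ → ℝ≥0∞) (i : Fin d) :
    Commute (axisOp (ν i) i) (walkOp ν) := by
  refine Commute.sum_right _ _ _ fun j _ => ?_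
  by_cases h : i = j
  · subst h; exact Commute.refl _
  · exact axisOp_commute h _ _

lemma pow_succ_apply' (T : Module.End ℝ≥0∞ ((Fin d → ℤ) → ℝ≥0∞)) (n : ℕ)
    (f : (Fin d → ℤ) → ℝ≥0∞) : (T ^ (n + 1)) f = T ((T ^ n) f) := by
  rw [pow_succ']; rfl

lemma pow_succ_apply (T : Module.End ℝ≥0∞ ((Fin d → ℤ) → ℝ≥0∞)) (n : ℕ)
    (f : (Fin d → ℤ) → ℝ≥0∞) : (T ^ (n + 1)) f = (T ^ n) (T f) := by
  rw [pow_succ]; rfl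

lemma walkOp_pow_mono (ν : Fin d → ℤ → ℝ≥0∞) (n : ℕ) {f g : (Fin d → ℤ) → ℝ≥0∞}
    (h : ∀ x ∈ posAll, f x ≤ g x) : ∀ x ∈ posAll, (walkOp ν ^ n) f x ≤ (walkOp ν ^ n) g x := by
  induction n with
  | zero => simpa using h
  | succ n ih =>
    intro x _
    rw [pow_succ_apply', pow_succ_apply']
    exact walkOp_mono ν ih x

lemma walkOp_pow_tsum {ι : Type*} (ν : Fin d → ℤ → ℝ≥0∞) (n : ℕ)
    (f : ι → (Fin d → ℤ) → ℝ≥0∞) (x : Fin d → ℤ) :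
    (walkOp ν ^ n) (fun y => ∑' l, f l y) x = ∑' l, (walkOp ν ^ n) (f l) x := by
  induction n generalizing x with
  | zero => simp
  | succ n ih =>
    have : (walkOp ν ^ n) (fun y => ∑' l, f l y) = fun y => ∑' l, (walkOp ν ^ n) (f l) y :=
      funext ih
    simp only [pow_succ_apply', this, walkOp_tsum]

lemma walkOp_pow_eq_tsum (ν : Fin d → ℤ → ℝ≥0∞) (n : ℕ) (f : (Fin d → ℤ) → ℝ≥0∞)
    (x : Fin d → ℤ) :
    (walkOp ν ^ n) f x = ∑' z, (walkOp ν ^ n) (Pi.single z 1) x * f z := by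
  have hf : f = fun y => ∑' z, (f z • (Pi.single z 1 : (Fin d → ℤ) → ℝ≥0∞)) y := by
    funext y
    rw [tsum_eq_single y]
    · simp
    · intro z hz; simp [hz.symm]
  conv_lhs => rw [hf, walkOp_pow_tsum]
  refine tsum_congr fun z => ?_
  rw [map_smul, Pi.smul_apply, smul_eq_mul, mul_comm]

lemma walkOp_pow_le_of_le (ν : Fin d → ℤ → ℝ≥0∞) {f : (Fin d → ℤ) → ℝ≥0∞} {c : ℝ≥0∞}
    (h : ∀ x ∈ posAll, walkOp ν f x ≤ c * f x) (n : ℕ) :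
    ∀ x ∈ posAll, (walkOp ν ^ n) f x ≤ c ^ n * f x := by
  induction n with
  | zero => simp
  | succ n ih =>
    intro x hx
    rw [pow_succ_apply]
    refine (walkOp_pow_mono ν n (g := c • f) (fun y hy => h y hy) x hx).trans ?_
    rw [map_smul, Pi.smul_apply, smul_eq_mul, pow_succ, mul_comm (c ^ n), mul_assoc]
    gcongr
    exact ih x hx

lemma le_walkOp_pow (ν : Fin d → ℤ → ℝ≥0∞) {f : (Fin d → ℤ) → ℝ≥0∞}
    (h : ∀ x ∈ posAll, f x ≤ walkOp ν f x) (n : ℕ) :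
    ∀ x ∈ posAll, f x ≤ (walkOp ν ^ n) f x := by
  induction n with
  | zero => simp
  | succ n ih =>
    intro x hx
    rw [pow_succ_apply]
    exact (ih x hx).trans (walkOp_pow_mono ν n h x hx)

/-- Potential of `f` for the killed walk. -/
noncomputable def potential (ν : Fin d → ℤ → ℝ≥0∞) (f : (Fin d → ℤ) → ℝ≥0∞) (x : Fin d → ℤ) :
    ℝ≥0∞ := ∑' n, (walkOp ν ^ n) f x

lemma walkOp_potential_add (ν : Fin d → ℤ → ℝ≥0∞) (f : (Fin d → ℤ) → ℝ≥0∞) (x : Fin d → ℤ) :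
    f x + walkOp ν (potential ν f) x = potential ν f x := by
  have : potential ν f = fun y => ∑' n, (walkOp ν ^ n) f y := rfl
  rw [this, walkOp_tsum]
  beta_reduce
  conv_rhs => rw [tsum_eq_zero_add' ENNReal.summable]
  simp [pow_succ_apply']

lemma potential_le (ν : Fin d → ℤ → ℝ≥0∞) {f g : (Fin d → ℤ) → ℝ≥0∞}
    (h : ∀ x ∈ posAll, walkOp ν g x + f x ≤ g x) : ∀ x ∈ posAll, potential ν f x ≤ g x := by
  intro x hx
  refine ENNReal.tsum_le_of_sum_range_le fun n => ?_
  have : ∀ n, ∀ x ∈ posAll,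
      (walkOp ν ^ n) g x + ∑ k ∈ Finset.range n, (walkOp ν ^ k) f x ≤ g x := by
    intro n
    induction n with
    | zero => simp
    | succ n ih =>
      intro x hx
      rw [Finset.sum_range_succ, pow_succ_apply, add_comm (∑ k ∈ Finset.range n, _), ← add_assoc]
      refine le_trans ?_ (ih x hx)
      gcongr
      have := walkOp_pow_mono ν n (f := walkOp ν g + f) (g := g) h x hx
      rwa [map_add, Pi.add_apply] at this
  exact le_trans le_add_self (this n x hx)

end Operators

section AxisWalk

open ENNReal

variable {d : ℕ}

/-- Mass of the jump `k` along the `i`-th axis, the atom at `0` being shared equally. -/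
noncomputable def axisMass (μ : (Fin d → ℤ) → ℝ) (i : Fin d) (k : ℤ) : ℝ :=
  if k = 0 then μ 0 / d else μ (Pi.single i k)

/-- `axisMass` as an extended nonnegative number. -/
noncomputable def axisMassE (μ : (Fin d → ℤ) → ℝ) (i : Fin d) (k : ℤ) : ℝ≥0∞ :=
  ENNReal.ofReal (axisMass μ i k)

lemma axisMass_nonneg {μ : (Fin d → ℤ) → ℝ} (hnn : ∀ z, 0 ≤ μ z) (i : Fin d) (k : ℤ) :
    0 ≤ axisMass μ i k := by
  unfold axisMass; split_ifs
  · exact div_nonneg (hnn 0) (Nat.cast_nonneg _)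
  · exact hnn _

lemma tsum_ofReal_mul_eq_sum_axis {μ : (Fin d → ℤ) → ℝ} (hd : 0 < d)
    (hax : ∀ z : Fin d → ℤ, (∃ i j : Fin d, i ≠ j ∧ z i ≠ 0 ∧ z j ≠ 0) → μ z = 0)
    (F : (Fin d → ℤ) → ℝ≥0∞) :
    ∑' z, ENNReal.ofReal (μ z) * F z =
      ∑ i, ∑' k, axisMassE μ i k * F (Pi.single i k) := by
  have hd' : (0 : ℝ) < d := by exact_mod_cast hd
  set g : Fin d → ℤ → ℝ≥0∞ := fun i k => axisMassE μ i k * F (Pi.single i k)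
  have key : ∀ z, ENNReal.ofReal (μ z) * F z =
      ∑ i, ∑' k, if z = Pi.single i k then g i k else 0 := by
    intro z
    have h1 : ∀ i, ∑' k, (if z = Pi.single i k then g i k else 0) =
        if z = Pi.single i (z i) then g i (z i) else 0 := by
      intro i
      refine tsum_eq_single (z i) fun k hk => if_neg fun h => hk ?_
      rw [h]; simp
    simp only [h1]
    by_cases hz : z = 0
    · subst hz
      simp only [Pi.zero_apply, Pi.single_zero, if_true, g, axisMassE, axisMass]
      rw [Finset.sum_const, Finset.card_univ, Fintype.card_fin, nsmul_eq_mul, ← mul_assoc]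
      congr 1
      rw [← ENNReal.ofReal_natCast, ← ENNReal.ofReal_mul hd'.le, mul_div_cancel₀ _ hd'.ne']
    · obtain ⟨i, hi⟩ := Function.ne_iff.1 hz
      simp only [Pi.zero_apply] at hi
      by_cases hz2 : ∃ j, i ≠ j ∧ z j ≠ 0
      · obtain ⟨j, hij, hj⟩ := hz2
        rw [hax z ⟨i, j, hij, hi, hj⟩, ENNReal.ofReal_zero, zero_mul]
        refine (Finset.sum_eq_zero fun l _ => if_neg fun h => ?_).symm
        by_cases hli : l = i
        · subst hli
          apply hj
          rw [h, Pi.single_eq_of_ne hij.symm]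
        · apply hi
          rw [h, Pi.single_eq_of_ne (Ne.symm hli)]
      · push Not at hz2
        have hzs : z = Pi.single i (z i) := by
          funext j
          by_cases hj : j = i
          · subst hj; simp
          · rw [Pi.single_eq_of_ne hj]; exact hz2 j (Ne.symm hj)
        rw [Finset.sum_eq_single i]
        · rw [if_pos hzs]
          simp only [g, axisMassE, axisMass, hi, if_false]
          rw [← hzs]
        · intro j _ hj
          refine if_neg fun h => hi ?_
          rw [h, Pi.single_eq_of_ne hj.symm]
        · simp
  simp only [key]
  rw [Summable.tsum_finsetSum fun _ _ => ENNReal.summable]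
  refine Finset.sum_congr rfl fun i _ => ?_
  rw [ENNReal.tsum_comm]
  refine tsum_congr fun k => ?_
  simp [g]

lemma walkOp_axisMassE {μ : (Fin d → ℤ) → ℝ} (hd : 0 < d)
    (hax : ∀ z : Fin d → ℤ, (∃ i j : Fin d, i ≠ j ∧ z i ≠ 0 ∧ z j ≠ 0) → μ z = 0)
    (f : (Fin d → ℤ) → ℝ≥0∞) (x : Fin d → ℤ) :
    walkOp (axisMassE μ) f x =
      ∑' z, if x ∈ posAll ∧ z ∈ posAll then ENNReal.ofReal (μ (z - x)) * f z else 0 := by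
  rw [← (Equiv.addLeft x).tsum_eq]
  simp only [Equiv.coe_addLeft, add_sub_cancel_left]
  have := tsum_ofReal_mul_eq_sum_axis hd hax
    (fun z => if x ∈ posAll ∧ x + z ∈ posAll then f (x + z) else 0)
  simp only [mul_ite, mul_zero] at this
  rw [this, walkOp_apply]
  rfl

lemma sum_tsum_axisMassE {μ : (Fin d → ℤ) → ℝ} (hd : 0 < d) (hnn : ∀ z, 0 ≤ μ z)
    (hsum : HasSum μ 1)
    (hax : ∀ z : Fin d → ℤ, (∃ i j : Fin d, i ≠ j ∧ z i ≠ 0 ∧ z j ≠ 0) → μ z = 0) :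
    ∑ i, ∑' k, axisMassE μ i k = 1 := by
  have := tsum_ofReal_mul_eq_sum_axis hd hax (fun _ => 1)
  simp only [mul_one] at this
  rw [← this, ← ENNReal.ofReal_tsum_of_nonneg hnn hsum.summable, hsum.tsum_eq, ENNReal.ofReal_one]

lemma walkOp_one_le {μ : (Fin d → ℤ) → ℝ} (hd : 0 < d) (hnn : ∀ z, 0 ≤ μ z)
    (hsum : HasSum μ 1)
    (hax : ∀ z : Fin d → ℤ, (∃ i j : Fin d, i ≠ j ∧ z i ≠ 0 ∧ z j ≠ 0) → μ z = 0)
    (x : Fin d → ℤ) : walkOp (axisMassE μ) (fun _ => 1) x ≤ 1 := by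
  refine le_trans ?_ (sum_tsum_axisMassE hd hnn hsum hax).le
  rw [walkOp_apply]
  refine Finset.sum_le_sum fun i _ => ENNReal.tsum_le_tsum fun k => ?_
  split_ifs <;> simp

lemma walkOp_pow_single_le {μ : (Fin d → ℤ) → ℝ} (hd : 0 < d) (hnn : ∀ z, 0 ≤ μ z)
    (hsum : HasSum μ 1)
    (hax : ∀ z : Fin d → ℤ, (∃ i j : Fin d, i ≠ j ∧ z i ≠ 0 ∧ z j ≠ 0) → μ z = 0)
    (n : ℕ) (y x : Fin d → ℤ) : (walkOp (axisMassE μ) ^ n) (Pi.single y 1) x ≤ 1 := by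
  induction n generalizing x with
  | zero =>
    simp only [pow_zero, Module.End.one_apply, Pi.single_apply]
    split_ifs <;> simp
  | succ n ih =>
    rw [pow_succ_apply']
    exact (walkOp_mono _ (fun z _ => ih z) x).trans (walkOp_one_le hd hnn hsum hax x)

lemma walkOp_pow_single_notMem {ν : Fin d → ℤ → ℝ≥0∞} {y : Fin d → ℤ} (hy : y ∈ posAll)
    (n : ℕ) {x : Fin d → ℤ} (hx : x ∉ posAll) : (walkOp ν ^ n) (Pi.single y 1) x = 0 := by
  cases n with
  | zero =>
    have : x ≠ y := fun h => hx (h ▸ hy)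
    simp [this]
  | succ n => rw [pow_succ_apply', walkOp_apply_notMem _ _ hx]

lemma kern_eq_toReal {μ : (Fin d → ℤ) → ℝ} (hd : 0 < d) (hnn : ∀ z, 0 ≤ μ z)
    (hsum : HasSum μ 1)
    (hax : ∀ z : Fin d → ℤ, (∃ i j : Fin d, i ≠ j ∧ z i ≠ 0 ∧ z j ≠ 0) → μ z = 0)
    (n : ℕ) (x : Fin d → ℤ) {y : Fin d → ℤ} (hy : y ∈ posAll) :
    kern μ posAll n x y = ((walkOp (axisMassE μ) ^ n) (Pi.single y 1) x).toReal := by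
  induction n generalizing x with
  | zero =>
    by_cases h : x = y
    · subst h; simp [kern, hy]
    · simp [kern, h]
  | succ n ih =>
    rw [pow_succ_apply', walkOp_axisMassE hd hax, ENNReal.tsum_toReal_eq]
    · rw [kern]
      refine tsum_congr fun z => ?_
      rw [ih z]
      by_cases hx : x ∈ posAll
      · by_cases hz : z ∈ posAll
        · simp [hx, hz, ENNReal.toReal_mul, ENNReal.toReal_ofReal (hnn _)]
        · simp [hz, walkOp_pow_single_notMem hy n hz]
      · simp [hx]
    · intro z
      split_ifs
      · exact ENNReal.mul_ne_top ENNReal.ofReal_ne_top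
          (ne_top_of_le_ne_top one_ne_top (walkOp_pow_single_le hd hnn hsum hax n y z))
      · simp

lemma kern_notMem (μ : (Fin d → ℤ) → ℝ) (n : ℕ) (x : Fin d → ℤ) {y : Fin d → ℤ}
    (hy : y ∉ posAll) : kern μ posAll n x y = 0 := by
  induction n generalizing x with
  | zero =>
    have : ¬ (x = y ∧ x ∈ posAll) := by rintro ⟨rfl, h⟩; exact hy h
    simp [kern, this]
  | succ n ih => simp [kern, ih]

lemma green_eq_toReal {μ : (Fin d → ℤ) → ℝ} (hd : 0 < d) (hnn : ∀ z, 0 ≤ μ z)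
    (hsum : HasSum μ 1)
    (hax : ∀ z : Fin d → ℤ, (∃ i j : Fin d, i ≠ j ∧ z i ≠ 0 ∧ z j ≠ 0) → μ z = 0)
    (x : Fin d → ℤ) {y : Fin d → ℤ} (hy : y ∈ posAll) :
    green μ posAll x y = (potential (axisMassE μ) (Pi.single y 1) x).toReal := by
  rw [potential, ENNReal.tsum_toReal_eq]
  · exact tsum_congr fun n => kern_eq_toReal hd hnn hsum hax n x hy
  · exact fun n => ne_top_of_le_ne_top one_ne_top (walkOp_pow_single_le hd hnn hsum hax n y x)

/-- One-dimensional Harnack inequality for superharmonic functions of the killed walk along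
the `i`-th axis. -/
def AxisHarnack (ν : ℤ → ℝ≥0∞) (p : ℝ≥0∞) : Prop :=
  ∀ u : ℤ → ℝ≥0∞, (∀ x, 0 < x → ∑' k, (if 0 < x + k then ν k * u (x + k) else 0) ≤ u x) →
    ∀ x, 0 < x → p * u (x + 1) ≤ u x ∧ p * u x ≤ u (x + 1)

lemma exists_pos_le_of_path {ν : ℤ → ℝ≥0∞} {n : ℕ} {c : ℕ → ℤ}
    (hc : ∀ j ≤ n, 0 < c j) (hstep : ∀ j < n, c (j + 1) = c j ∨ 0 < ν (c (j + 1) - c j)) :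
    ∃ p : ℝ≥0∞, 0 < p ∧ ∀ u : ℤ → ℝ≥0∞,
      (∀ x, 0 < x → ∑' k, (if 0 < x + k then ν k * u (x + k) else 0) ≤ u x) →
      ∀ s : ℤ, 0 ≤ s → p * u (c n + s) ≤ u (c 0 + s) := by
  induction n with
  | zero => exact ⟨1, one_pos, fun u _ s _ => by simp⟩
  | succ n ih =>
    obtain ⟨p, hp, h⟩ := ih (fun j hj => hc j (by omega)) fun j hj => hstep j (by omega)
    rcases hstep n (by omega) with he | hν
    · exact ⟨p, hp, fun u hu s hs => by rw [he]; exact h u hu s hs⟩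
    · refine ⟨p * ν (c (n + 1) - c n), ENNReal.mul_pos hp.ne' hν.ne', fun u hu s hs => ?_⟩
      refine le_trans ?_ (h u hu s hs)
      rw [mul_assoc]
      gcongr
      have h1 : 0 < c n + s := by have := hc n (by omega); omega
      have h2 : 0 < c (n + 1) + s := by have := hc (n + 1) le_rfl; omega
      refine le_trans ?_ (hu _ h1)
      refine le_trans (le_of_eq ?_) (ENNReal.le_tsum (c (n + 1) - c n))
      have h3 : c n + s + (c (n + 1) - c n) = c (n + 1) + s := by ring
      rw [h3, if_pos h2]

lemma axis_step {μ : (Fin d → ℤ) → ℝ}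
    (hax : ∀ z : Fin d → ℤ, (∃ i j : Fin d, i ≠ j ∧ z i ≠ 0 ∧ z j ≠ 0) → μ z = 0)
    {z : Fin d → ℤ} (hz : 0 < μ z) (i : Fin d) : z i = 0 ∨ 0 < axisMass μ i (z i) := by
  by_cases h : z i = 0
  · exact Or.inl h
  · right
    have : z = Pi.single i (z i) := by
      funext j
      by_cases hj : j = i
      · subst hj; simp
      · rw [Pi.single_eq_of_ne hj]
        by_contra h0
        exact hz.ne' (hax z ⟨j, i, hj, h0, h⟩)
    rw [axisMass, if_neg h, ← this]
    exact hz

lemma exists_axis_path {μ : (Fin d → ℤ) → ℝ} (hA1 : A1 μ)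
    (hax : ∀ z : Fin d → ℤ, (∃ i j : Fin d, i ≠ j ∧ z i ≠ 0 ∧ z j ≠ 0) → μ z = 0)
    (i : Fin d) {x y : ℤ} (hx : 0 < x) (hy : 0 < y) :
    ∃ (n : ℕ) (c : ℕ → ℤ), c 0 = x ∧ c n = y ∧ (∀ j ≤ n, 0 < c j) ∧
      ∀ j < n, c (j + 1) = c j ∨ 0 < axisMassE μ i (c (j + 1) - c j) := by
  obtain ⟨n, c, h0, hn, hpos, hstep⟩ := hA1 Set.univ (fun _ => x) (fun _ _ => hx)
    (fun _ => y) (fun _ _ => hy)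
  refine ⟨n, fun j => c j i, by simp [h0], by simp [hn], fun j hj => hpos j hj i trivial,
    fun j hj => ?_⟩
  rcases axis_step hax (hstep j hj) i with h | h
  · left
    rw [Pi.sub_apply, sub_eq_zero] at h
    exact h
  · right
    exact ENNReal.ofReal_pos.2 h

lemma exists_axisHarnack {μ : (Fin d → ℤ) → ℝ} (hA1 : A1 μ)
    (hax : ∀ z : Fin d → ℤ, (∃ i j : Fin d, i ≠ j ∧ z i ≠ 0 ∧ z j ≠ 0) → μ z = 0)
    (i : Fin d) : ∃ p : ℝ≥0∞, 0 < p ∧ AxisHarnack (axisMassE μ i) p := by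
  obtain ⟨n, c, h0, hn, hc, hs⟩ := exists_axis_path hA1 hax i (x := 1) (y := 2) (by norm_num)
    (by norm_num)
  obtain ⟨n', c', h0', hn', hc', hs'⟩ := exists_axis_path hA1 hax i (x := 2) (y := 1)
    (by norm_num) (by norm_num)
  obtain ⟨p, hp, h⟩ := exists_pos_le_of_path hc hs
  obtain ⟨p', hp', h'⟩ := exists_pos_le_of_path hc' hs'
  refine ⟨min p p', lt_min hp hp', fun u hu x hx => ⟨?_, ?_⟩⟩
  · have := h u hu (x - 1) (by omega)
    rw [h0, hn, show (2 : ℤ) + (x - 1) = x + 1 by ring, show (1 : ℤ) + (x - 1) = x by ring] at this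
    exact le_trans (by gcongr; exact min_le_left _ _) this
  · have := h' u hu (x - 1) (by omega)
    rw [h0', hn', show (2 : ℤ) + (x - 1) = x + 1 by ring,
      show (1 : ℤ) + (x - 1) = x by ring] at this
    exact le_trans (by gcongr; exact min_le_right _ _) this

lemma exists_pos_jump {μ : (Fin d → ℤ) → ℝ} (hA1 : A1 μ)
    (hax : ∀ z : Fin d → ℤ, (∃ i j : Fin d, i ≠ j ∧ z i ≠ 0 ∧ z j ≠ 0) → μ z = 0)
    (i : Fin d) : (∃ j : ℤ, 0 < j ∧ 0 < axisMass μ i j) ∧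
      ∃ j : ℤ, j < 0 ∧ 0 < axisMass μ i j := by
  constructor
  · obtain ⟨n, c, h0, hn, -, hs⟩ := exists_axis_path hA1 hax i (x := 1) (y := 2) (by norm_num)
      (by norm_num)
    by_contra! hcon
    have : ∀ j ≤ n, c j ≤ 1 := by
      intro j
      induction j with
      | zero => intro _; omega
      | succ j ih =>
        intro hj
        have h1 := ih (by omega)
        rcases hs j (by omega) with h | h
        · omega
        · by_contra! h2
          exact absurd (ENNReal.ofReal_pos.1 h) (not_lt.2 (hcon _ (by omega)))
    have := this n le_rfl
    omega
  · obtain ⟨n, c, h0, hn, -, hs⟩ := exists_axis_path hA1 hax i (x := 2) (y := 1) (by norm_num)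
      (by norm_num)
    by_contra! hcon
    have : ∀ j ≤ n, 2 ≤ c j := by
      intro j
      induction j with
      | zero => intro _; omega
      | succ j ih =>
        intro hj
        have h1 := ih (by omega)
        rcases hs j (by omega) with h | h
        · omega
        · by_contra! h2
          exact absurd (ENNReal.ofReal_pos.1 h) (not_lt.2 (hcon _ (by omega)))
    have := this n le_rfl
    omega

end AxisWalk

section Tilt

open ENNReal

variable {d : ℕ}

/-- Exponentially tilted mass of the jump `k` along the `i`-th axis. -/
noncomputable def tiltMass (μ : (Fin d → ℤ) → ℝ) (a : Fin d → ℝ) (i : Fin d) (k : ℤ) : ℝ :=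
  axisMass μ i k * Real.exp (a i * k)

/-- Total tilted mass along the `i`-th axis. -/
noncomputable def tiltTotal (μ : (Fin d → ℤ) → ℝ) (a : Fin d → ℝ) (i : Fin d) : ℝ :=
  ∑' k, tiltMass μ a i k

/-- Tilted mean along the `i`-th axis. -/
noncomputable def tiltMean (μ : (Fin d → ℤ) → ℝ) (a : Fin d → ℝ) (i : Fin d) : ℝ :=
  ∑' k, tiltMass μ a i k * (k : ℝ)

/-- The tilted jump distributions have exponential moments of order `r`. -/
def TiltSummable (μ : (Fin d → ℤ) → ℝ) (a : Fin d → ℝ) (r : ℝ) : Prop :=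
  ∀ i, Summable fun k : ℤ => tiltMass μ a i k * Real.exp (r * |(k : ℝ)|)

lemma tiltMass_nonneg {μ : (Fin d → ℤ) → ℝ} (hnn : ∀ z, 0 ≤ μ z) (a : Fin d → ℝ) (i : Fin d)
    (k : ℤ) : 0 ≤ tiltMass μ a i k :=
  mul_nonneg (axisMass_nonneg hnn i k) (Real.exp_pos _).le

lemma tiltMass_add (μ : (Fin d → ℤ) → ℝ) (a h : Fin d → ℝ) (i : Fin d) (k : ℤ) :
    tiltMass μ (a + h) i k = tiltMass μ a i k * Real.exp (h i * k) := by
  rw [tiltMass, tiltMass, mul_assoc, ← Real.exp_add, Pi.add_apply, add_mul]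

lemma dotZ_single (a : Fin d → ℝ) (i : Fin d) (k : ℤ) :
    dotZ a (Pi.single i k) = a i * k := by
  rw [dotZ, Finset.sum_eq_single i]
  · simp
  · intro j _ hj; simp [hj]
  · simp

lemma phiE_eq {μ : (Fin d → ℤ) → ℝ} (hd : 0 < d) (hnn : ∀ z, 0 ≤ μ z)
    (hax : ∀ z : Fin d → ℤ, (∃ i j : Fin d, i ≠ j ∧ z i ≠ 0 ∧ z j ≠ 0) → μ z = 0)
    (a : Fin d → ℝ) : phiE μ a = ∑ i, ∑' k, ENNReal.ofReal (tiltMass μ a i k) := by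
  have := tsum_ofReal_mul_eq_sum_axis hd hax (fun z => ENNReal.ofReal (Real.exp (dotZ a z)))
  simp only [dotZ_single, axisMassE, ← ENNReal.ofReal_mul (hnn _),
    ← ENNReal.ofReal_mul (axisMass_nonneg hnn _ _)] at this
  exact this

lemma phiE_eq_ofReal {μ : (Fin d → ℤ) → ℝ} (hd : 0 < d) (hnn : ∀ z, 0 ≤ μ z)
    (hax : ∀ z : Fin d → ℤ, (∃ i j : Fin d, i ≠ j ∧ z i ≠ 0 ∧ z j ≠ 0) → μ z = 0)
    {a : Fin d → ℝ} (hs : ∀ i, Summable (tiltMass μ a i)) :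
    phiE μ a = ENNReal.ofReal (∑ i, tiltTotal μ a i) := by
  simp only [tiltTotal]
  rw [phiE_eq hd hnn hax, ENNReal.ofReal_sum_of_nonneg fun i _ =>
    tsum_nonneg fun k => tiltMass_nonneg hnn a i k]
  exact Finset.sum_congr rfl fun i _ =>
    (ENNReal.ofReal_tsum_of_nonneg (tiltMass_nonneg hnn a i) (hs i)).symm

lemma summable_tiltMass_of_phiE {μ : (Fin d → ℤ) → ℝ} (hd : 0 < d) (hnn : ∀ z, 0 ≤ μ z)
    (hax : ∀ z : Fin d → ℤ, (∃ i j : Fin d, i ≠ j ∧ z i ≠ 0 ∧ z j ≠ 0) → μ z = 0)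
    {a : Fin d → ℝ} (h : phiE μ a ≠ ⊤) (i : Fin d) : Summable (tiltMass μ a i) := by
  rw [phiE_eq hd hnn hax] at h
  have h1 := (ENNReal.sum_ne_top.1 h) i (Finset.mem_univ i)
  have := ENNReal.summable_toReal h1
  simpa only [ENNReal.toReal_ofReal (tiltMass_nonneg hnn a i _)] using this

lemma exists_tiltSummable {μ : (Fin d → ℤ) → ℝ} (hd : 0 < d) (hnn : ∀ z, 0 ≤ μ z)
    (hax : ∀ z : Fin d → ℤ, (∃ i j : Fin d, i ≠ j ∧ z i ≠ 0 ∧ z j ≠ 0) → μ z = 0)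
    (hA2 : A2 μ) {a : Fin d → ℝ} (ha : a ∈ Dset μ) : ∃ r, 0 < r ∧ TiltSummable μ a r := by
  obtain ⟨U, hU, hDU, hfin⟩ := hA2
  obtain ⟨ε, hε, hball⟩ := Metric.isOpen_iff.1 hU a (hDU ha)
  have hmem : ∀ s : ℝ, |s| < ε → a + (fun _ => s) ∈ U := fun s hs => by
    refine hball ?_
    rw [Metric.mem_ball, dist_eq_norm, add_sub_cancel_left, pi_norm_lt_iff hε]
    exact fun _ => hs
  refine ⟨ε / 2, by positivity, fun i => ?_⟩
  have h1 := summable_tiltMass_of_phiE hd hnn hax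
    (hfin _ (hmem (ε / 2) (by rw [abs_of_pos (by positivity)]; linarith))) i
  have h2 := summable_tiltMass_of_phiE hd hnn hax
    (hfin _ (hmem (-(ε / 2)) (by rw [abs_neg, abs_of_pos (by positivity)]; linarith))) i
  refine (h1.add h2).of_nonneg_of_le
    (fun k => mul_nonneg (tiltMass_nonneg hnn _ _ _) (Real.exp_pos _).le) fun k => ?_
  rw [tiltMass_add, tiltMass_add, ← mul_add]
  refine mul_le_mul_of_nonneg_left ?_ (tiltMass_nonneg hnn _ _ _)
  rcases abs_cases (k : ℝ) with ⟨h, -⟩ | ⟨h, -⟩ <;> rw [h]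
  · exact le_add_of_nonneg_right (Real.exp_pos _).le
  · rw [mul_neg, ← neg_mul]
    exact le_add_of_nonneg_left (Real.exp_pos _).le

lemma TiltSummable.summable {μ : (Fin d → ℤ) → ℝ} (hnn : ∀ z, 0 ≤ μ z) {a : Fin d → ℝ} {r : ℝ}
    (hr : 0 < r) (hs : TiltSummable μ a r) (i : Fin d) : Summable (tiltMass μ a i) :=
  summable_mass (tiltMass_nonneg hnn a i) hr (hs i)

lemma TiltSummable.summable_add {μ : (Fin d → ℤ) → ℝ} (hnn : ∀ z, 0 ≤ μ z) {a : Fin d → ℝ}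
    {r : ℝ} (hs : TiltSummable μ a r) {h : Fin d → ℝ} {i : Fin d} (hh : |h i| ≤ r) :
    Summable (tiltMass μ (a + h) i) := by
  have := summable_exp (tiltMass_nonneg hnn a i) (hs i) hh
  simpa only [← tiltMass_add] using this

lemma exists_tiltTotal_le {μ : (Fin d → ℤ) → ℝ} (hnn : ∀ z, 0 ≤ μ z)
    {a : Fin d → ℝ} {r : ℝ} (hr : 0 < r) (hs : TiltSummable μ a r) :
    ∃ C : ℝ, 0 < C ∧ ∀ (h : Fin d → ℝ) (i : Fin d), |h i| ≤ r / 2 →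
      tiltTotal μ (a + h) i ≤ tiltTotal μ a i + h i * tiltMean μ a i + C * h i ^ 2 := by
  choose C hC hle using fun i => tsum_exp_le (tiltMass_nonneg hnn a i) hr (hs i)
  refine ⟨∑ i, C i + 1, by have := Finset.sum_nonneg fun i (_ : i ∈ Finset.univ) => hC i; linarith,
    fun h i hi => ?_⟩
  have h1 := hle i (h i) hi
  have h2 : C i ≤ ∑ i, C i + 1 := by
    have := Finset.single_le_sum (fun j _ => hC j) (Finset.mem_univ i)
    linarith
  have h3 := mul_le_mul_of_nonneg_right h2 (sq_nonneg (h i))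
  simp only [tiltTotal, tiltMass_add, tiltMean] at h1 ⊢
  linarith

lemma exists_phiE_le {μ : (Fin d → ℤ) → ℝ} (hd : 0 < d) (hnn : ∀ z, 0 ≤ μ z)
    (hax : ∀ z : Fin d → ℤ, (∃ i j : Fin d, i ≠ j ∧ z i ≠ 0 ∧ z j ≠ 0) → μ z = 0)
    {a : Fin d → ℝ} {r : ℝ} (hr : 0 < r) (hs : TiltSummable μ a r) :
    ∃ C : ℝ, 0 < C ∧ ∀ h : Fin d → ℝ, (∀ i, |h i| ≤ r / 2) →
      phiE μ (a + h) ≤ ENNReal.ofReal (∑ i, tiltTotal μ a i + ∑ i, h i * tiltMean μ a i +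
        C * ∑ i, h i ^ 2) := by
  obtain ⟨C, hC, hle⟩ := exists_tiltTotal_le hnn hr hs
  refine ⟨C, hC, fun h hh => ?_⟩
  rw [phiE_eq_ofReal hd hnn hax fun i => hs.summable_add hnn ((hh i).trans (by linarith))]
  refine ENNReal.ofReal_le_ofReal ?_
  rw [Finset.mul_sum, ← Finset.sum_add_distrib, ← Finset.sum_add_distrib]
  exact Finset.sum_le_sum fun i _ => hle h i (hh i)

lemma Mvec_eq {μ : (Fin d → ℤ) → ℝ}
    (hax : ∀ z : Fin d → ℤ, (∃ i j : Fin d, i ≠ j ∧ z i ≠ 0 ∧ z j ≠ 0) → μ z = 0)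
    (i : Fin d) : Mvec μ i = tiltMean μ 0 i := by
  have hinj : Function.Injective fun k : ℤ => (Pi.single i k : Fin d → ℤ) :=
    fun k k' h => by simpa using congrFun h i
  rw [Mvec, ← hinj.tsum_eq]
  · refine tsum_congr fun k => ?_
    by_cases hk : k = 0
    · simp [hk]
    · simp [tiltMass, axisMass, hk]
  · intro z hz
    rw [Function.mem_support] at hz
    have h1 : μ z ≠ 0 := left_ne_zero_of_mul hz
    have h2 : z i ≠ 0 := by exact_mod_cast right_ne_zero_of_mul hz
    refine ⟨z i, ?_⟩
    funext j
    by_cases hj : j = i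
    · subst hj; simp
    · simp only [Pi.single_eq_of_ne hj]
      by_contra h0
      exact h1 (hax z ⟨j, i, hj, Ne.symm h0, h2⟩)

lemma phiE_zero {μ : (Fin d → ℤ) → ℝ} (hnn : ∀ z, 0 ≤ μ z) (hsum : HasSum μ 1) :
    phiE μ 0 = 1 := by
  have : ∀ z : Fin d → ℤ, μ z * Real.exp (dotZ 0 z) = μ z := fun z => by simp [dotZ]
  simp only [phiE, this]
  rw [← ENNReal.ofReal_tsum_of_nonneg hnn hsum.summable, hsum.tsum_eq, ENNReal.ofReal_one]

lemma exists_tiltMean_eq {μ : (Fin d → ℤ) → ℝ} (hd : 0 < d) (hnn : ∀ z, 0 ≤ μ z)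
    (hsum : HasSum μ 1) (hA1 : A1 μ) (hA3 : A3 μ)
    (hax : ∀ z : Fin d → ℤ, (∃ i j : Fin d, i ≠ j ∧ z i ≠ 0 ∧ z j ≠ 0) → μ z = 0)
    {a : Fin d → ℝ} (haD : a ∈ Dset μ) {r : ℝ} (hr : 0 < r) (hs : TiltSummable μ a r)
    {q : Fin d → ℝ} (hq : q ≠ 0) (hmax : ∀ b ∈ Dset μ, dotR b q ≤ dotR a q) :
    ∑ i, tiltTotal μ a i = 1 ∧ ∃ l : ℝ, 0 < l ∧ ∀ i, tiltMean μ a i = l * q i := by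
  obtain ⟨C, hC, hle⟩ := exists_phiE_le hd hnn hax hr hs
  set σ := ∑ i, tiltTotal μ a i
  set v := tiltMean μ a
  have hσ : σ ≤ 1 := by
    have : phiE μ a ≤ 1 := haD
    rwa [phiE_eq_ofReal hd hnn hax (hs.summable hnn hr), ENNReal.ofReal_le_one] at this
  have hpert : ∀ w : Fin d → ℝ, (∃ t₀ > 0, ∀ t, 0 < t → t ≤ t₀ →
      σ + t * (∑ i, w i * v i) + C * t ^ 2 * ∑ i, w i ^ 2 ≤ 1) → ∑ i, w i * q i ≤ 0 := by
    rintro w ⟨t₀, ht₀, h⟩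
    set B := ∑ i, |w i| + 1
    have hB : 0 < B := by
      have := Finset.sum_nonneg fun i (_ : i ∈ Finset.univ) => abs_nonneg (w i)
      simp only [B]; linarith
    set t := min t₀ (r / 2 / B)
    have ht : 0 < t := by positivity
    have hmem : a + t • w ∈ Dset μ := by
      refine (hle (t • w) fun i => ?_).trans ?_
      · rw [Pi.smul_apply, smul_eq_mul, abs_mul, abs_of_pos ht]
        have h1 : |w i| ≤ B := by
          have := Finset.single_le_sum (fun j _ => abs_nonneg (w j)) (Finset.mem_univ i)
          simp only [B]; linarith
        calc t * |w i| ≤ r / 2 / B * B :=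
              mul_le_mul (min_le_right _ _) h1 (abs_nonneg _) (by positivity)
          _ = r / 2 := div_mul_cancel₀ _ hB.ne'
      · rw [ENNReal.ofReal_le_one]
        refine le_trans (le_of_eq ?_) (h t ht (min_le_left _ _))
        simp only [Pi.smul_apply, smul_eq_mul, mul_pow, Finset.mul_sum, mul_assoc, σ, v]
    have h2 := hmax _ hmem
    have h3 : dotR (a + t • w) q = dotR a q + t * ∑ i, w i * q i := by
      simp only [dotR, Pi.add_apply, Pi.smul_apply, smul_eq_mul, add_mul, Finset.sum_add_distrib,
        Finset.mul_sum, mul_assoc]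
    rw [h3] at h2
    nlinarith
  have hqq : 0 < ∑ i, q i * q i := by
    obtain ⟨i, hi⟩ := Function.ne_iff.1 hq
    exact Finset.sum_pos' (fun j _ => mul_self_nonneg _) ⟨i, Finset.mem_univ i, mul_self_pos.2 hi⟩
  have hσ1 : σ = 1 := by
    by_contra hne
    have hlt : 0 < 1 - σ := sub_pos.2 (lt_of_le_of_ne hσ hne)
    refine absurd (hpert q ?_) (not_le.2 hqq)
    set A := |∑ i, q i * v i| + C * ∑ i, q i ^ 2
    have hA : 0 ≤ A := add_nonneg (abs_nonneg _)
      (mul_nonneg hC.le (Finset.sum_nonneg fun i _ => sq_nonneg _))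
    refine ⟨min 1 ((1 - σ) / (A + 1)), by positivity, fun t ht ht' => ?_⟩
    have h1 : t ≤ 1 := ht'.trans (min_le_left _ _)
    have h2 : t * (A + 1) ≤ 1 - σ := by
      rw [← le_div_iff₀ (by positivity)]; exact ht'.trans (min_le_right _ _)
    have h3 := mul_le_mul_of_nonneg_left (le_abs_self (∑ i, q i * v i)) ht.le
    have h4 : C * t ^ 2 * ∑ i, q i ^ 2 ≤ t * (C * ∑ i, q i ^ 2) := by
      have : 0 ≤ C * ∑ i, q i ^ 2 :=
        mul_nonneg hC.le (Finset.sum_nonneg fun i _ => sq_nonneg _)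
      nlinarith [mul_le_mul_of_nonneg_right h1 (mul_nonneg ht.le this)]
    have h5 : t * A = t * |∑ i, q i * v i| + t * (C * ∑ i, q i ^ 2) := mul_add _ _ _
    linarith
  have hneg : ∀ w : Fin d → ℝ, ∑ i, w i * v i < 0 → ∑ i, w i * q i ≤ 0 := by
    intro w hw
    have h0 : 0 ≤ C * ∑ i, w i ^ 2 :=
      mul_nonneg hC.le (Finset.sum_nonneg fun i _ => sq_nonneg _)
    refine hpert w ⟨(-∑ i, w i * v i) / (C * ∑ i, w i ^ 2 + 1),
      div_pos (neg_pos.2 hw) (by positivity), fun t ht ht' => ?_⟩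
    rw [le_div_iff₀ (by positivity)] at ht'
    rw [hσ1]
    nlinarith
  have hv : v ≠ 0 := by
    intro hv0
    by_cases ha : a = 0
    · apply hA3
      funext i
      have h : tiltMean μ a i = 0 := congrFun hv0 i
      rw [ha] at h
      rw [Mvec_eq hax, h, Pi.zero_apply]
    · obtain ⟨i, hi⟩ := Function.ne_iff.1 ha
      have h0 := phiE_zero hnn hsum
      have hz : ∀ i k, tiltMass μ a i k * Real.exp (-a i * k) = tiltMass μ 0 i k := by
        intro i k
        rw [tiltMass, tiltMass, mul_assoc, ← Real.exp_add]
        simp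
      have hs0 := summable_tiltMass_of_phiE hd hnn hax (a := 0) (by rw [h0]; exact one_ne_top)
      rw [phiE_eq_ofReal hd hnn hax hs0] at h0
      have h1 : ∑ i, tiltTotal μ 0 i = 1 := by
        have h2 := congrArg ENNReal.toReal h0
        have hn : 0 ≤ ∑ i, tiltTotal μ 0 i := Finset.sum_nonneg fun i _ =>
          tsum_nonneg fun k => tiltMass_nonneg hnn 0 i k
        rwa [ENNReal.toReal_ofReal hn, ENNReal.toReal_one] at h2
      have h3 : ∑ i, tiltTotal μ a i < ∑ i, tiltTotal μ 0 i := by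
        refine Finset.sum_lt_sum (fun j _ => ?_) ⟨i, Finset.mem_univ i, ?_⟩
        · have := le_tsum_exp (tiltMass_nonneg hnn a j) (hs.summable hnn hr j)
            (summable_mul_id (tiltMass_nonneg hnn a j) hr (hs j)) (t := -a j)
            (by simpa only [hz] using hs0 j)
          simp only [hz] at this
          have hvj : ∑' k : ℤ, tiltMass μ a j k * (k : ℝ) = 0 := congrFun hv0 j
          rw [hvj, mul_zero, add_zero] at this
          exact this
        · obtain ⟨l, hl, hml⟩ := (exists_pos_jump hA1 hax i).1
          have := lt_tsum_exp (tiltMass_nonneg hnn a i) (hs.summable hnn hr i)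
            (summable_mul_id (tiltMass_nonneg hnn a i) hr (hs i)) (t := -a i)
            (by simpa only [hz] using hs0 i) (neg_ne_zero.2 hi) hl.ne'
            (mul_pos hml (Real.exp_pos _))
          simp only [hz] at this
          have hvj : ∑' k : ℤ, tiltMass μ a i k * (k : ℝ) = 0 := congrFun hv0 i
          rw [hvj, mul_zero, add_zero] at this
          exact this
      have h4 : ∑ i, tiltTotal μ a i = 1 := hσ1
      linarith
  have hvv : 0 < ∑ i, v i * v i := by
    obtain ⟨i, hi⟩ := Function.ne_iff.1 hv
    exact Finset.sum_pos' (fun j _ => mul_self_nonneg _) ⟨i, Finset.mem_univ i, mul_self_pos.2 hi⟩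
  set VV := ∑ i, v i * v i with hVV
  set QQ := ∑ i, q i * q i with hQQ
  set QV := ∑ i, q i * v i with hQV
  have hVQ : ∑ i, v i * q i = QV := Finset.sum_congr rfl fun i _ => mul_comm _ _
  have hcs : VV * QQ ≤ QV * QV := by
    have hε : ∀ ε : ℝ, 0 < ε → VV * QQ - QV * QV ≤ ε * QV := by
      intro ε hε
      have h1 : ∀ u : Fin d → ℝ, ∑ i, (VV * q i - (QV + ε) * v i) * u i =
          VV * ∑ i, q i * u i - (QV + ε) * ∑ i, v i * u i := by
        intro u
        rw [Finset.mul_sum, Finset.mul_sum, ← Finset.sum_sub_distrib]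
        exact Finset.sum_congr rfl fun i _ => by ring
      have := hneg (fun i => VV * q i - (QV + ε) * v i) (by
        rw [h1 v, ← hVV, ← hQV]
        nlinarith [mul_pos hε hvv])
      rw [h1 q, hVQ, ← hQQ] at this
      linarith
    by_contra! hcon
    have h2 : 0 < VV * QQ - QV * QV := sub_pos.2 hcon
    have h3 := hε ((VV * QQ - QV * QV) / (2 * (|QV| + 1))) (by positivity)
    have h4 : (VV * QQ - QV * QV) / (2 * (|QV| + 1)) * QV ≤
        (VV * QQ - QV * QV) / (2 * (|QV| + 1)) * (|QV| + 1) :=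
      mul_le_mul_of_nonneg_left ((le_abs_self _).trans (by linarith)) (by positivity)
    have h5 : (VV * QQ - QV * QV) / (2 * (|QV| + 1)) * (|QV| + 1) =
        (VV * QQ - QV * QV) / 2 := by
      field_simp
    linarith
  have hpar : ∀ i, VV * q i = QV * v i := by
    have h1 : ∑ i, (VV * q i - QV * v i) ^ 2 = VV * (VV * QQ - QV * QV) := by
      have : ∀ i, (VV * q i - QV * v i) ^ 2 = VV ^ 2 * (q i * q i) - 2 * VV * QV * (q i * v i) +
          QV ^ 2 * (v i * v i) := fun i => by ring
      simp only [this]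
      rw [Finset.sum_add_distrib, Finset.sum_sub_distrib, ← Finset.mul_sum, ← Finset.mul_sum,
        ← Finset.mul_sum, ← hVV, ← hQQ, ← hQV]
      ring
    have h2 : ∑ i, (VV * q i - QV * v i) ^ 2 ≤ 0 := by
      rw [h1]
      exact mul_nonpos_of_nonneg_of_nonpos hvv.le (by linarith)
    intro i
    have h3 := (Finset.sum_eq_zero_iff_of_nonneg fun i _ => sq_nonneg _).1
      (le_antisymm h2 (Finset.sum_nonneg fun i _ => sq_nonneg _)) i (Finset.mem_univ i)
    have h4 := pow_eq_zero_iff (two_ne_zero) |>.1 h3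
    linarith
  have hQV0 : 0 ≤ QV := by
    have := hneg (fun i => -v i) (by
      simp only [neg_mul, Finset.sum_neg_distrib]
      linarith)
    simp only [neg_mul, Finset.sum_neg_distrib, hVQ] at this
    linarith
  have hQVp : 0 < QV := by
    refine lt_of_le_of_ne hQV0 fun h => ?_
    apply hq
    funext i
    have := hpar i
    rw [← h, zero_mul] at this
    exact (mul_eq_zero.1 this).resolve_left hvv.ne'
  refine ⟨hσ1, VV / QV, div_pos hvv hQVp, fun i => ?_⟩
  rw [div_mul_eq_mul_div, hpar i, mul_div_cancel_left₀ _ hQVp.ne']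

lemma isCompact_Dset {μ : (Fin d → ℤ) → ℝ} (hd : 0 < d) (hnn : ∀ z, 0 ≤ μ z) (hA1 : A1 μ)
    (hax : ∀ z : Fin d → ℤ, (∃ i j : Fin d, i ≠ j ∧ z i ≠ 0 ∧ z j ≠ 0) → μ z = 0) :
    IsCompact (Dset μ) := by
  have hcl : IsClosed (Dset μ) := by
    have hlsc : LowerSemicontinuous (phiE μ) := by
      refine lowerSemicontinuous_tsum fun z => Continuous.lowerSemicontinuous ?_
      refine ENNReal.continuous_ofReal.comp (continuous_const.mul (Real.continuous_exp.comp ?_))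
      unfold dotZ
      fun_prop
    exact hlsc.isClosed_preimage 1
  have hterm : ∀ a ∈ Dset μ, ∀ i k, tiltMass μ a i k ≤ 1 := by
    intro a ha i k
    have h1 : phiE μ a ≤ 1 := ha
    rw [phiE_eq hd hnn hax] at h1
    have h2 := (Finset.single_le_sum (f := fun i => ∑' k, ENNReal.ofReal (tiltMass μ a i k))
      (fun _ _ => zero_le) (Finset.mem_univ i)).trans h1
    exact ENNReal.ofReal_le_one.1 ((ENNReal.le_tsum k).trans h2)
  have hlog : ∀ a ∈ Dset μ, ∀ i k, 0 < axisMass μ i k → a i * k ≤ -Real.log (axisMass μ i k) := by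
    intro a ha i k hk
    have h1 := hterm a ha i k
    rw [tiltMass, ← Real.exp_log hk, ← Real.exp_add, Real.exp_le_one_iff] at h1
    linarith
  choose j hj hmj using fun i => (exists_pos_jump hA1 hax i).1
  choose l hl hml using fun i => (exists_pos_jump hA1 hax i).2
  refine IsCompact.of_isClosed_subset
    (isCompact_univ_pi fun i => isCompact_Icc (a := Real.log (axisMass μ i (l i)) / -(l i : ℝ))
      (b := -Real.log (axisMass μ i (j i)) / (j i : ℝ))) hcl fun a ha i _ => ⟨?_, ?_⟩
  · have : (0 : ℝ) < -(l i : ℝ) := by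
      rw [neg_pos]; exact_mod_cast hl i
    rw [div_le_iff₀ this]
    linarith [hlog a ha i _ (hml i)]
  · have : (0 : ℝ) < (j i : ℝ) := by exact_mod_cast hj i
    rw [le_div_iff₀ this]
    exact hlog a ha i _ (hmj i)

lemma exists_max_Dset {μ : (Fin d → ℤ) → ℝ} (hd : 0 < d) (hnn : ∀ z, 0 ≤ μ z)
    (hsum : HasSum μ 1) (hA1 : A1 μ)
    (hax : ∀ z : Fin d → ℤ, (∃ i j : Fin d, i ≠ j ∧ z i ≠ 0 ∧ z j ≠ 0) → μ z = 0)
    (q : Fin d → ℝ) : ∃ a ∈ Dset μ, ∀ b ∈ Dset μ, dotR b q ≤ dotR a q := by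
  have hc : Continuous fun a : Fin d → ℝ => dotR a q := by
    unfold dotR; fun_prop
  obtain ⟨a, ha, hmax⟩ := (isCompact_Dset hd hnn hA1 hax).exists_isMaxOn
    ⟨0, (phiE_zero hnn hsum).le⟩ hc.continuousOn
  exact ⟨a, ha, fun b hb => hmax hb⟩

end Tilt

section Products

open ENNReal

variable {d : ℕ}

/-- Mean number of exits below `1` from `x`, counted only if `p` fails. -/
noncomputable def outPos (m : ℤ → ℝ) (p : Prop) (x : ℤ) : ℝ :=
  ∑' k, exitOp m (fun _ => if p then 0 else 1) x k

/-- Mean undershoot below `1` from `x`, counted only if `p` holds. -/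
noncomputable def outNeg (m : ℤ → ℝ) (p : Prop) (x : ℤ) : ℝ :=
  ∑' k, exitOp m (fun y => if p then |(y : ℝ)| else 0) x k

lemma exitOp_nonneg {m u : ℤ → ℝ} (hm : ∀ k, 0 ≤ m k) (hu : ∀ y, 0 ≤ u y) (x k : ℤ) :
    0 ≤ exitOp m u x k := by
  unfold exitOp; split_ifs
  · exact mul_nonneg (hm _) (hu _)
  · exact le_rfl

lemma halfOp_nonneg {m u : ℤ → ℝ} (hm : ∀ k, 0 ≤ m k) (hu : ∀ y, 0 < y → 0 ≤ u y) (x k : ℤ) :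
    0 ≤ halfOp m u x k := by
  unfold halfOp; split_ifs with h
  · exact mul_nonneg (hm _) (hu _ h)
  · exact le_rfl

lemma outPos_nonneg {m : ℤ → ℝ} (hm : ∀ k, 0 ≤ m k) (p : Prop) (x : ℤ) : 0 ≤ outPos m p x :=
  tsum_nonneg fun k => exitOp_nonneg hm (fun _ => by split_ifs <;> norm_num) x k

lemma outNeg_nonneg {m : ℤ → ℝ} (hm : ∀ k, 0 ≤ m k) (p : Prop) (x : ℤ) : 0 ≤ outNeg m p x :=
  tsum_nonneg fun k => exitOp_nonneg hm (fun _ => by split_ifs <;> positivity) x k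

lemma linOrOne_balance {m : ℤ → ℝ} {r : ℝ} (hm : ∀ k, 0 ≤ m k) (hr : 0 < r)
    (hs : Summable fun k : ℤ => m k * Real.exp (r * |(k : ℝ)|)) (p : Prop)
    (hp : p → ∑' k : ℤ, m k * (k : ℝ) = 0) (x : ℤ) :
    Summable (halfOp m (linOrOne p) x) ∧
      Summable (exitOp m (fun _ => if p then 0 else 1) x) ∧
      Summable (exitOp m (fun y => if p then |(y : ℝ)| else 0) x) ∧
      ∑' k, halfOp m (linOrOne p) x k + outPos m p x =
        (∑' k, m k) * linOrOne p x + outNeg m p x := by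
  have s0 := summable_mass hm hr hs
  have s1 := summable_mul_id hm hr hs
  by_cases h : p
  · have e1 : ∀ k : ℤ, m k * ((x : ℝ) + k) = x * m k + m k * k := fun k => by ring
    have st : Summable fun k : ℤ => m k * ((x : ℝ) + k) := by
      simp only [e1]; exact (s0.mul_left _).add s1
    have t1 : ∑' k : ℤ, m k * ((x : ℝ) + k) = (∑' k, m k) * x := by
      simp only [e1]
      rw [(s0.mul_left _).tsum_add s1, hp h, add_zero, tsum_mul_left, mul_comm]
    have sh : Summable (halfOp m (linOrOne p) x) := by
      refine st.norm.of_norm_bounded fun k => ?_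
      unfold halfOp linOrOne; split_ifs
      · push_cast; exact le_rfl
      · simpa using mul_nonneg (abs_nonneg (m k)) (abs_nonneg ((x : ℝ) + k))
    have se : Summable (exitOp m (fun y => if p then |(y : ℝ)| else 0) x) := by
      refine st.norm.of_norm_bounded fun k => ?_
      unfold exitOp; split_ifs
      · push_cast; simp
      · simpa using mul_nonneg (abs_nonneg (m k)) (abs_nonneg ((x : ℝ) + k))
    have e0 : exitOp m (fun _ => if p then 0 else 1) x = fun _ => (0 : ℝ) := by
      funext k; simp [exitOp, h]
    refine ⟨sh, by rw [e0]; exact summable_zero, se, ?_⟩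
    rw [outPos, e0, tsum_zero, add_zero, outNeg, linOrOne, if_pos h, ← t1, ← st.tsum_add se]
    refine tsum_congr fun k => ?_
    unfold halfOp exitOp linOrOne
    by_cases hk : 0 < x + k
    · simp [hk, h, not_le.2 hk]
    · have hk' : x + k ≤ 0 := not_lt.1 hk
      have hk2 : ((x + k : ℤ) : ℝ) ≤ 0 := by exact_mod_cast hk'
      simp only [hk, hk', if_true, if_false, h]
      rw [abs_of_nonpos hk2]; push_cast; ring
  · have sh : Summable (halfOp m (linOrOne p) x) := by
      refine s0.norm.of_norm_bounded fun k => ?_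
      unfold halfOp linOrOne; split_ifs <;> simp
    have se : Summable (exitOp m (fun _ => if p then 0 else 1) x) := by
      refine s0.norm.of_norm_bounded fun k => ?_
      unfold exitOp; split_ifs <;> simp
    have e0 : exitOp m (fun y => if p then |(y : ℝ)| else 0) x = fun _ => (0 : ℝ) := by
      funext k; simp [exitOp, h]
    refine ⟨sh, se, by rw [e0]; exact summable_zero, ?_⟩
    rw [outNeg, e0, tsum_zero, add_zero, outPos, show linOrOne p x = 1 from if_neg h, mul_one,
      ← sh.tsum_add se]
    refine tsum_congr fun k => ?_
    unfold halfOp exitOp linOrOne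
    by_cases hk : 0 < x + k
    · simp [hk, h, not_le.2 hk]
    · simp [hk, h, not_lt.1 hk]

/-- Product function `exp (a · x) ∏ gᵢ(xᵢ)` on the positive orthant. -/
noncomputable def prodFn (a : Fin d → ℝ) (g : Fin d → ℤ → ℝ) (x : Fin d → ℤ) : ℝ≥0∞ :=
  if x ∈ posAll then ENNReal.ofReal (Real.exp (dotZ a x) * ∏ i, g i (x i)) else 0

/-- Product function with the `i`-th factor replaced by `s`. -/
noncomputable def prodFnWith (a : Fin d → ℝ) (g : Fin d → ℤ → ℝ) (i : Fin d) (s : ℤ → ℝ)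
    (x : Fin d → ℤ) : ℝ≥0∞ :=
  if x ∈ posAll then
    ENNReal.ofReal (Real.exp (dotZ a x) * (∏ j ∈ Finset.univ.erase i, g j (x j)) * s (x i)) else 0

lemma dotZ_add (a : Fin d → ℝ) (x y : Fin d → ℤ) : dotZ a (x + y) = dotZ a x + dotZ a y := by
  simp [dotZ, mul_add, Finset.sum_add_distrib]

lemma prodFn_eq_with (a : Fin d → ℝ) (g : Fin d → ℤ → ℝ) (i : Fin d) :
    prodFn a g = prodFnWith a g i (g i) := by
  funext x
  unfold prodFn prodFnWith
  rw [mul_assoc, Finset.prod_erase_mul _ _ (Finset.mem_univ i)]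

lemma prod_erase_add_single (g : Fin d → ℤ → ℝ) (i : Fin d) (x : Fin d → ℤ) (k : ℤ) :
    ∏ j ∈ Finset.univ.erase i, g j ((x + Pi.single i k : Fin d → ℤ) j) =
      ∏ j ∈ Finset.univ.erase i, g j (x j) := by
  refine Finset.prod_congr rfl fun j hj => ?_
  rw [Pi.add_apply, Pi.single_eq_of_ne (Finset.ne_of_mem_erase hj), add_zero]

lemma axisOp_prodFn {μ : (Fin d → ℤ) → ℝ} (hnn : ∀ z, 0 ≤ μ z) (a : Fin d → ℝ)
    {g : Fin d → ℤ → ℝ} (hg : ∀ i t, 0 < t → 0 ≤ g i t) (i : Fin d)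
    (hs : ∀ t, 0 < t → Summable (halfOp (tiltMass μ a i) (g i) t)) (x : Fin d → ℤ) :
    axisOp (axisMassE μ i) i (prodFn a g) x =
      prodFnWith a g i (fun t => ∑' k, halfOp (tiltMass μ a i) (g i) t k) x := by
  by_cases hx : x ∈ posAll
  swap
  · rw [axisOp_apply_notMem _ _ _ hx, prodFnWith, if_neg hx]
  have hP : 0 ≤ Real.exp (dotZ a x) * ∏ j ∈ Finset.univ.erase i, g j (x j) :=
    mul_nonneg (Real.exp_pos _).le (Finset.prod_nonneg fun j _ => hg j _ (hx j))
  rw [axisOp_apply_mem _ _ _ hx, prodFnWith, if_pos hx, ENNReal.ofReal_mul hP,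
    ENNReal.ofReal_tsum_of_nonneg (halfOp_nonneg (tiltMass_nonneg hnn a i) (hg i) _)
      (hs _ (hx i)), ← ENNReal.tsum_mul_left]
  refine tsum_congr fun k => ?_
  unfold halfOp
  split_ifs with hk
  · rw [prodFn_eq_with a g i, prodFnWith, if_pos ((add_single_mem_posAll hx i k).2 hk), axisMassE,
      ← ENNReal.ofReal_mul (axisMass_nonneg hnn i k), ← ENNReal.ofReal_mul hP,
      prod_erase_add_single, dotZ_add, dotZ_single, Real.exp_add, tiltMass, Pi.add_apply,
      Pi.single_eq_same]
    congr 1; ring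
  · simp

lemma prodFnWith_mono {a : Fin d → ℝ} {g : Fin d → ℤ → ℝ} (hg : ∀ i t, 0 < t → 0 ≤ g i t)
    (i : Fin d) {s s' : ℤ → ℝ} (h : ∀ t, 0 < t → s t ≤ s' t) (x : Fin d → ℤ) :
    prodFnWith a g i s x ≤ prodFnWith a g i s' x := by
  unfold prodFnWith
  split_ifs with hx
  · refine ENNReal.ofReal_le_ofReal (mul_le_mul_of_nonneg_left (h _ (hx i)) ?_)
    exact mul_nonneg (Real.exp_pos _).le (Finset.prod_nonneg fun j _ => hg j _ (hx j))
  · exact le_rfl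

lemma prodFnWith_congr {a : Fin d → ℝ} {g : Fin d → ℤ → ℝ} (i : Fin d) {s s' : ℤ → ℝ}
    (h : ∀ t, 0 < t → s t = s' t) (x : Fin d → ℤ) :
    prodFnWith a g i s x = prodFnWith a g i s' x := by
  unfold prodFnWith
  split_ifs with hx
  · rw [h _ (hx i)]
  · rfl

lemma prodFnWith_add {a : Fin d → ℝ} {g : Fin d → ℤ → ℝ} (hg : ∀ i t, 0 < t → 0 ≤ g i t)
    (i : Fin d) {s s' : ℤ → ℝ} (h : ∀ t, 0 < t → 0 ≤ s t) (h' : ∀ t, 0 < t → 0 ≤ s' t)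
    (x : Fin d → ℤ) :
    prodFnWith a g i (fun t => s t + s' t) x = prodFnWith a g i s x + prodFnWith a g i s' x := by
  unfold prodFnWith
  split_ifs with hx
  · have hP : 0 ≤ Real.exp (dotZ a x) * ∏ j ∈ Finset.univ.erase i, g j (x j) :=
      mul_nonneg (Real.exp_pos _).le (Finset.prod_nonneg fun j _ => hg j _ (hx j))
    rw [mul_add, ENNReal.ofReal_add (mul_nonneg hP (h _ (hx i))) (mul_nonneg hP (h' _ (hx i)))]
  · simp

lemma prodFnWith_mul {a : Fin d → ℝ} {g : Fin d → ℤ → ℝ} (i : Fin d) {c : ℝ} (hc : 0 ≤ c)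
    (x : Fin d → ℤ) :
    prodFnWith a g i (fun t => c * g i t) x = ENNReal.ofReal c * prodFn a g x := by
  rw [prodFn_eq_with a g i]
  unfold prodFnWith
  split_ifs with hx
  · rw [← ENNReal.ofReal_mul hc]; congr 1; ring
  · simp

lemma prodFnWith_mono_left {a : Fin d → ℝ} {g g' : Fin d → ℤ → ℝ}
    (hg : ∀ i t, 0 < t → 0 ≤ g i t) (hgg : ∀ i t, 0 < t → g i t ≤ g' i t) (i : Fin d)
    {s : ℤ → ℝ} (h : ∀ t, 0 < t → 0 ≤ s t) (x : Fin d → ℤ) :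
    prodFnWith a g i s x ≤ prodFnWith a g' i s x := by
  unfold prodFnWith
  split_ifs with hx
  · refine ENNReal.ofReal_le_ofReal (mul_le_mul_of_nonneg_right
      (mul_le_mul_of_nonneg_left ?_ (Real.exp_pos _).le) (h _ (hx i)))
    exact Finset.prod_le_prod (fun j _ => hg j _ (hx j)) fun j _ => hgg j _ (hx j)
  · exact le_rfl

lemma prodFn_mono {a : Fin d → ℝ} {g g' : Fin d → ℤ → ℝ}
    (hg : ∀ i t, 0 < t → 0 ≤ g i t) (hgg : ∀ i t, 0 < t → g i t ≤ g' i t) (x : Fin d → ℤ) :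
    prodFn a g x ≤ prodFn a g' x := by
  unfold prodFn
  split_ifs with hx
  · refine ENNReal.ofReal_le_ofReal (mul_le_mul_of_nonneg_left ?_ (Real.exp_pos _).le)
    exact Finset.prod_le_prod (fun j _ => hg j _ (hx j)) fun j _ => hgg j _ (hx j)
  · exact le_rfl

lemma prodFn_ne_top (a : Fin d → ℝ) (g : Fin d → ℤ → ℝ) (x : Fin d → ℤ) : prodFn a g x ≠ ⊤ := by
  unfold prodFn; split_ifs <;> simp

lemma prodFnWith_ne_top (a : Fin d → ℝ) (g : Fin d → ℤ → ℝ) (i : Fin d) (s : ℤ → ℝ)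
    (x : Fin d → ℤ) : prodFnWith a g i s x ≠ ⊤ := by
  unfold prodFnWith; split_ifs <;> simp

lemma prodFn_pos (a : Fin d → ℝ) {g : Fin d → ℤ → ℝ} (hg : ∀ i t, 0 < t → 0 < g i t)
    {x : Fin d → ℤ} (hx : x ∈ posAll) : 0 < prodFn a g x := by
  rw [prodFn, if_pos hx, ENNReal.ofReal_pos]
  exact mul_pos (Real.exp_pos _) (Finset.prod_pos fun i _ => hg i _ (hx i))

/-- Product of one-dimensional subharmonic barriers. -/
lemma exists_prodFn_sub {μ : (Fin d → ℤ) → ℝ} (hnn : ∀ z, 0 ≤ μ z) {a : Fin d → ℝ} {r : ℝ}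
    (hr : 0 < r) (hs : TiltSummable μ a r) (hc : ∑ i, tiltTotal μ a i = 1)
    (P : Fin d → Prop) (hP : ∀ i, P i → tiltMean μ a i = 0)
    (hnP : ∀ i, ¬ P i → 0 < tiltMean μ a i) :
    ∃ w : Fin d → ℤ → ℝ, ∃ κ : ℝ, 0 < κ ∧
      (∀ i, SubBarrier (tiltMass μ a i) (w i)) ∧
      (∀ i t, 0 < t → w i t ≤ linOrOne (P i) t ∧ linOrOne (P i) t ≤ κ * w i t) ∧
      ∀ x, prodFn a w x ≤ walkOp (axisMassE μ) (prodFn a w) x := by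
  choose w hw hle κ hκ hge using fun i => exists_subBarrier (tiltMass_nonneg hnn a i) hr (hs i)
    (P i) (hP i) (hnP i)
  have hwnn : ∀ i t, 0 < t → 0 ≤ w i t := fun i t ht => ((hw i).pos t ht).le
  refine ⟨w, ∑ i, κ i + 1, ?_, hw, fun i t ht => ⟨hle i t ht, (hge i t ht).trans ?_⟩, fun x => ?_⟩
  · have := Finset.sum_nonneg fun i (_ : i ∈ Finset.univ) => (hκ i).le
    linarith
  · refine mul_le_mul_of_nonneg_right ?_ (hwnn i t ht)
    have := Finset.single_le_sum (fun j _ => (hκ j).le) (Finset.mem_univ i)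
    linarith
  · have h0 : ∀ i, 0 ≤ tiltTotal μ a i := fun i => tsum_nonneg fun k => tiltMass_nonneg hnn a i k
    have h1 : ∀ i, ENNReal.ofReal (tiltTotal μ a i) * prodFn a w x ≤
        axisOp (axisMassE μ i) i (prodFn a w) x := by
      intro i
      rw [axisOp_prodFn hnn a hwnn i (hw i).summ, ← prodFnWith_mul i (h0 i)]
      exact prodFnWith_mono hwnn i (fun t ht => (hw i).sub t ht) x
    rw [walkOp_apply]
    refine le_trans (le_of_eq ?_) (Finset.sum_le_sum fun i _ => h1 i)
    rw [← Finset.sum_mul, ← ENNReal.ofReal_sum_of_nonneg fun i _ => h0 i, hc, ENNReal.ofReal_one,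
      one_mul]

/-- Product of one-dimensional Lyapunov functions. -/
lemma exists_prodFn_super {μ : (Fin d → ℤ) → ℝ} (hnn : ∀ z, 0 ≤ μ z) (hA1 : A1 μ)
    (hax : ∀ z : Fin d → ℤ, (∃ i j : Fin d, i ≠ j ∧ z i ≠ 0 ∧ z j ≠ 0) → μ z = 0)
    {a : Fin d → ℝ} {r : ℝ}
    (hr : 0 < r) (hs : TiltSummable μ a r) (hc : ∑ i, tiltTotal μ a i = 1)
    (P : Fin d → Prop) (hP : ∀ i, P i → tiltMean μ a i = 0) :
    ∃ ψ : Fin d → ℤ → ℝ, ∃ C : ℝ, 0 < C ∧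
      (∀ i t, 0 < t → linOrOne (P i) t ≤ ψ i t ∧ ψ i t ≤ C * linOrOne (P i) t) ∧
      (∀ i x, axisOp (axisMassE μ i) i (prodFn a ψ) x ≤ prodFn a ψ x) ∧
      ∀ x, walkOp (axisMassE μ) (prodFn a ψ) x +
        ∑ i, prodFnWith a (fun i => linOrOne (P i)) i (outNeg (tiltMass μ a i) (P i)) x ≤
          prodFn a ψ x := by
  choose ψ C hC hψ hsup using fun i => exists_lyapunov (tiltMass_nonneg hnn a i) hr (hs i)
    (exists_pos_jump hA1 hax i).1.choose_spec.1.ne'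
    (mul_pos (exists_pos_jump hA1 hax i).1.choose_spec.2 (Real.exp_pos _)) (P i) (hP i)
  have hl : ∀ i t, 0 < t → 0 ≤ linOrOne (P i) t := fun i t ht => (linOrOne_pos (P i) ht).le
  have hnnψ : ∀ i t, 0 < t → 0 ≤ ψ i t := fun i t ht => (hl i t ht).trans (hψ i t ht).1
  have h0 : ∀ i, 0 ≤ tiltTotal μ a i := fun i => tsum_nonneg fun k => tiltMass_nonneg hnn a i k
  have h1 : ∀ i x, axisOp (axisMassE μ i) i (prodFn a ψ) x +
      prodFnWith a (fun i => linOrOne (P i)) i (outNeg (tiltMass μ a i) (P i)) x ≤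
        ENNReal.ofReal (tiltTotal μ a i) * prodFn a ψ x := by
    intro i x
    rw [axisOp_prodFn hnn a hnnψ i fun t ht => (hsup i t ht).1, ← prodFnWith_mul i (h0 i)]
    refine (add_le_add_right (prodFnWith_mono_left hl (fun j t ht => (hψ j t ht).1) i
      (fun t _ => outNeg_nonneg (tiltMass_nonneg hnn a i) _ t) x) _).trans ?_
    rw [← prodFnWith_add hnnψ i
      (fun t _ => tsum_nonneg fun k => halfOp_nonneg (tiltMass_nonneg hnn a i) (hnnψ i) t k)
      (fun t _ => outNeg_nonneg (tiltMass_nonneg hnn a i) _ t)]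
    exact prodFnWith_mono hnnψ i (fun t ht => (hsup i t ht).2.2) x
  refine ⟨ψ, ∑ i, C i + 1, ?_, fun i t ht => ⟨(hψ i t ht).1, (hψ i t ht).2.trans ?_⟩,
    fun i x => ?_, fun x => ?_⟩
  · have := Finset.sum_nonneg fun i (_ : i ∈ Finset.univ) => (hC i).le
    linarith
  · refine mul_le_mul_of_nonneg_right ?_ (hl i t ht)
    have := Finset.single_le_sum (fun j _ => (hC j).le) (Finset.mem_univ i)
    linarith
  · refine (le_self_add.trans (h1 i x)).trans ?_
    refine (mul_le_mul_left ?_ _).trans (one_mul _).le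
    rw [ENNReal.ofReal_le_one, ← hc]
    exact Finset.single_le_sum (fun j _ => h0 j) (Finset.mem_univ i)
  · rw [walkOp_apply, ← Finset.sum_add_distrib]
    refine (Finset.sum_le_sum fun i _ => h1 i x).trans (le_of_eq ?_)
    rw [← Finset.sum_mul, ← ENNReal.ofReal_sum_of_nonneg fun i _ => h0 i, hc, ENNReal.ofReal_one,
      one_mul]

/-- Balance equation for the product of the one-dimensional linear or constant functions. -/
lemma axisOp_prodFn_linOrOne {μ : (Fin d → ℤ) → ℝ} (hnn : ∀ z, 0 ≤ μ z) {a : Fin d → ℝ} {r : ℝ}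
    (hr : 0 < r) (hs : TiltSummable μ a r)
    (P : Fin d → Prop) (hP : ∀ i, P i → tiltMean μ a i = 0) (i : Fin d) (x : Fin d → ℤ) :
    axisOp (axisMassE μ i) i (prodFn a fun i => linOrOne (P i)) x +
      prodFnWith a (fun i => linOrOne (P i)) i (outPos (tiltMass μ a i) (P i)) x =
    ENNReal.ofReal (tiltTotal μ a i) * prodFn a (fun i => linOrOne (P i)) x +
      prodFnWith a (fun i => linOrOne (P i)) i (outNeg (tiltMass μ a i) (P i)) x := by
  have hl : ∀ i t, 0 < t → 0 ≤ linOrOne (P i) t := fun i t ht => (linOrOne_pos (P i) ht).le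
  have hb := fun t => linOrOne_balance (tiltMass_nonneg hnn a i) hr (hs i) (P i) (hP i) t
  have h0 : 0 ≤ tiltTotal μ a i := tsum_nonneg fun k => tiltMass_nonneg hnn a i k
  rw [axisOp_prodFn hnn a hl i fun t _ => (hb t).1,
    ← prodFnWith_mul (g := fun i => linOrOne (P i)) i h0,
    ← prodFnWith_add hl i
      (fun t _ => tsum_nonneg fun k => halfOp_nonneg (tiltMass_nonneg hnn a i) (hl i) t k)
      (fun t _ => outPos_nonneg (tiltMass_nonneg hnn a i) _ t),
    ← prodFnWith_add hl i (fun t ht => mul_nonneg h0 (hl i t ht))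
      (fun t _ => outNeg_nonneg (tiltMass_nonneg hnn a i) _ t)]
  exact prodFnWith_congr i (fun t _ => (hb t).2.2.2) x

end Products

section ExitFunction

open ENNReal

variable {d : ℕ}

lemma tendsto_tsum_of_dominated {β ι : Type*} {l : Filter ι} {f : ι → β → ℝ≥0∞}
    {g D : β → ℝ≥0∞} (hD : ∑' k, D k ≠ ⊤) (h : ∀ k, Tendsto (f · k) l (𝓝 (g k)))
    (hb : ∀ᶠ n in l, ∀ k, f n k ≤ D k) :
    Tendsto (fun n => ∑' k, f n k) l (𝓝 (∑' k, g k)) := by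
  rcases l.eq_or_neBot with rfl | _
  · exact tendsto_bot
  have hDk : ∀ k, D k ≠ ⊤ := ENNReal.ne_top_of_tsum_ne_top hD
  have hgD : ∀ k, g k ≤ D k := fun k => le_of_tendsto (h k) (hb.mono fun n hn => hn k)
  have hgk : ∀ k, g k ≠ ⊤ := fun k => ne_top_of_le_ne_top (hDk k) (hgD k)
  have key : Tendsto (fun n => ∑' k, (f n k).toReal) l (𝓝 (∑' k, (g k).toReal)) := by
    refine tendsto_tsum_of_dominated_convergence (bound := fun k => (D k).toReal)
      (ENNReal.summable_toReal hD) (fun k => (ENNReal.tendsto_toReal (hgk k)).comp (h k))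
      (hb.mono fun n hn k => ?_)
    rw [Real.norm_of_nonneg ENNReal.toReal_nonneg]
    exact ENNReal.toReal_mono (hDk k) (hn k)
  have hG : ∑' k, g k ≠ ⊤ := ne_top_of_le_ne_top hD (ENNReal.tsum_le_tsum hgD)
  have h2 := ENNReal.tendsto_ofReal key
  rw [← ENNReal.tsum_toReal_eq hgk, ENNReal.ofReal_toReal hG] at h2
  refine h2.congr' (hb.mono fun n hn => ?_)
  rw [← ENNReal.tsum_toReal_eq fun k => ne_top_of_le_ne_top (hDk k) (hn k),
    ENNReal.ofReal_toReal (ne_top_of_le_ne_top hD (ENNReal.tsum_le_tsum hn))]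

lemma tendsto_axisOp {ι : Type*} {l : Filter ι} (ν : ℤ → ℝ≥0∞) (hν : ∀ k, ν k ≠ ⊤) (i : Fin d)
    {f : ι → (Fin d → ℤ) → ℝ≥0∞} {g D : (Fin d → ℤ) → ℝ≥0∞} {x : Fin d → ℤ}
    (hD : axisOp ν i D x ≠ ⊤) (h : ∀ z ∈ posAll, Tendsto (f · z) l (𝓝 (g z)))
    (hb : ∀ᶠ n in l, ∀ k, x + Pi.single i k ∈ posAll →
      f n (x + Pi.single i k) ≤ D (x + Pi.single i k)) :
    Tendsto (fun n => axisOp ν i (f n) x) l (𝓝 (axisOp ν i g x)) := by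
  simp only [axisOp_apply] at hD ⊢
  refine tendsto_tsum_of_dominated hD (fun k => ?_) (hb.mono fun n hn k => ?_)
  · split_ifs with hk
    · exact ENNReal.Tendsto.const_mul (h _ hk.2) (Or.inr (hν k))
    · exact tendsto_const_nhds
  · split_ifs with hk
    · gcongr; exact hn k hk.2
    · exact le_rfl

lemma hasSum_toReal_sub {β : Type*} {f g : β → ℝ≥0∞} (hf : ∑' k, f k ≠ ⊤) (hg : ∑' k, g k ≠ ⊤) :
    HasSum (fun k => (f k).toReal - (g k).toReal) ((∑' k, f k).toReal - (∑' k, g k).toReal) :=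
  (ENNReal.hasSum_toReal hf).sub (ENNReal.hasSum_toReal hg) |> fun h => by
    rwa [← ENNReal.tsum_toReal_eq (ENNReal.ne_top_of_tsum_ne_top hf),
      ← ENNReal.tsum_toReal_eq (ENNReal.ne_top_of_tsum_ne_top hg)] at h

lemma tsum_axisMassE_exit {μ : (Fin d → ℤ) → ℝ} (hnn : ∀ z, 0 ≤ μ z) {a : Fin d → ℝ}
    {g : Fin d → ℤ → ℝ} (hg : ∀ i t, 0 < t → 0 ≤ g i t) (i : Fin d) {s : ℤ → ℝ}
    (hs0 : ∀ t, 0 ≤ s t) {z : Fin d → ℤ} (hz : z ∈ posAll)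
    (hs : Summable (exitOp (tiltMass μ a i) s (z i))) {G : (Fin d → ℤ) → ℝ}
    (hG : ∀ k, z i + k ≤ 0 → ENNReal.ofReal (G (z + Pi.single i k)) =
      ENNReal.ofReal (Real.exp (dotZ a (z + Pi.single i k)) *
        (∏ j ∈ Finset.univ.erase i, g j (z j)) * s (z i + k))) :
    ∑' k, axisMassE μ i k *
        (if z + Pi.single i k ∉ posAll then ENNReal.ofReal (G (z + Pi.single i k)) else 0) =
      prodFnWith a g i (fun t => ∑' k, exitOp (tiltMass μ a i) s t k) z := by
  have hP : 0 ≤ Real.exp (dotZ a z) * ∏ j ∈ Finset.univ.erase i, g j (z j) :=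
    mul_nonneg (Real.exp_pos _).le (Finset.prod_nonneg fun j _ => hg j _ (hz j))
  rw [prodFnWith, if_pos hz, ENNReal.ofReal_mul hP,
    ENNReal.ofReal_tsum_of_nonneg (exitOp_nonneg (tiltMass_nonneg hnn a i) hs0 _) hs,
    ← ENNReal.tsum_mul_left]
  refine tsum_congr fun k => ?_
  unfold exitOp
  simp only [add_single_mem_posAll hz, not_lt]
  split_ifs with hk
  · rw [hG k hk, axisMassE, ← ENNReal.ofReal_mul (axisMass_nonneg hnn i k), ← ENNReal.ofReal_mul hP,
      dotZ_add, dotZ_single, Real.exp_add, tiltMass]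
    congr 1; ring
  · simp

lemma tsum_exit_eq {μ : (Fin d → ℤ) → ℝ} (hd : 0 < d) (hnn : ∀ z, 0 ≤ μ z)
    (hax : ∀ z : Fin d → ℤ, (∃ i j : Fin d, i ≠ j ∧ z i ≠ 0 ∧ z j ≠ 0) → μ z = 0)
    {a : Fin d → ℝ} {r : ℝ} (hr : 0 < r) (hs : TiltSummable μ a r)
    (P : Fin d → Prop) (hP : ∀ i, P i → tiltMean μ a i = 0) {z : Fin d → ℤ} (hz : z ∈ posAll) :
    ∑' y, (if y ∉ posAll then μ (y - z) else 0) *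
        (Real.exp (dotZ a y) * ∏ i, linOrOne (P i) (y i)) =
      (∑ i, prodFnWith a (fun i => linOrOne (P i)) i (outPos (tiltMass μ a i) (P i)) z).toReal -
      (∑ i, prodFnWith a (fun i => linOrOne (P i)) i (outNeg (tiltMass μ a i) (P i)) z).toReal := by
  set G : (Fin d → ℤ) → ℝ := fun y => Real.exp (dotZ a y) * ∏ i, linOrOne (P i) (y i)
  have hl : ∀ i t, 0 < t → 0 ≤ linOrOne (P i) t := fun i t ht => (linOrOne_pos (P i) ht).le
  have hb := fun i t => linOrOne_balance (tiltMass_nonneg hnn a i) hr (hs i) (P i) (hP i) t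
  have hGs : ∀ i k, G (z + Pi.single i k) = Real.exp (dotZ a (z + Pi.single i k)) *
      (∏ j ∈ Finset.univ.erase i, linOrOne (P j) (z j)) * linOrOne (P i) (z i + k) := by
    intro i k
    simp only [G]
    rw [← Finset.prod_erase_mul _ _ (Finset.mem_univ i), mul_assoc,
      prod_erase_add_single (fun i => linOrOne (P i)) i z k, Pi.add_apply, Pi.single_eq_same]
  have hE : ∀ i k, 0 ≤ Real.exp (dotZ a (z + Pi.single i k)) *
      (∏ j ∈ Finset.univ.erase i, linOrOne (P j) (z j)) := fun i k =>
    mul_nonneg (Real.exp_pos _).le (Finset.prod_nonneg fun j _ => hl j _ (hz j))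
  have h1 : ∑' w, ENNReal.ofReal (μ w) * (if z + w ∉ posAll then ENNReal.ofReal (G (z + w)) else 0)
      = ∑ i, prodFnWith a (fun i => linOrOne (P i)) i (outPos (tiltMass μ a i) (P i)) z := by
    rw [tsum_ofReal_mul_eq_sum_axis hd hax
      (fun w => if z + w ∉ posAll then ENNReal.ofReal (G (z + w)) else 0)]
    refine Finset.sum_congr rfl fun i _ => ?_
    refine tsum_axisMassE_exit hnn hl i (fun t => by split_ifs <;> norm_num) hz
      (hb i (z i)).2.1 fun k hk => ?_
    rw [hGs]
    by_cases h : P i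
    · have : ((z i + k : ℤ) : ℝ) ≤ 0 := by exact_mod_cast hk
      simp only [linOrOne, h, if_true, mul_zero, ENNReal.ofReal_zero]
      exact ENNReal.ofReal_of_nonpos (mul_nonpos_of_nonneg_of_nonpos (hE i k) this)
    · simp [linOrOne, h]
  have h2 : ∑' w, ENNReal.ofReal (μ w) *
      (if z + w ∉ posAll then ENNReal.ofReal (-G (z + w)) else 0)
      = ∑ i, prodFnWith a (fun i => linOrOne (P i)) i (outNeg (tiltMass μ a i) (P i)) z := by
    rw [tsum_ofReal_mul_eq_sum_axis hd hax
      (fun w => if z + w ∉ posAll then ENNReal.ofReal (-G (z + w)) else 0)]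
    refine Finset.sum_congr rfl fun i _ => ?_
    refine tsum_axisMassE_exit (G := fun y => -G y) hnn hl i
      (fun t => by split_ifs <;> positivity) hz (hb i (z i)).2.2.1 fun k hk => ?_
    rw [hGs]
    by_cases h : P i
    · have : ((z i + k : ℤ) : ℝ) ≤ 0 := by exact_mod_cast hk
      simp only [linOrOne, h, if_true, abs_of_nonpos this]
      rw [mul_neg]
    · simp only [linOrOne, h, if_false, mul_one, mul_zero, ENNReal.ofReal_zero]
      exact ENNReal.ofReal_of_nonpos (neg_nonpos.2 (by simpa only [linOrOne] using hE i k))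
  have f1 : ∑' w, ENNReal.ofReal (μ w) *
      (if z + w ∉ posAll then ENNReal.ofReal (G (z + w)) else 0) ≠ ⊤ := by
    rw [h1]; exact ENNReal.sum_ne_top.2 fun i _ => prodFnWith_ne_top _ _ _ _ _
  have f2 : ∑' w, ENNReal.ofReal (μ w) *
      (if z + w ∉ posAll then ENNReal.ofReal (-G (z + w)) else 0) ≠ ⊤ := by
    rw [h2]; exact ENNReal.sum_ne_top.2 fun i _ => prodFnWith_ne_top _ _ _ _ _
  have h3 := (hasSum_toReal_sub f1 f2).tsum_eq
  rw [h1, h2] at h3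
  rw [← h3, ← (Equiv.addLeft z).tsum_eq]
  refine tsum_congr fun w => ?_
  simp only [Equiv.coe_addLeft, add_sub_cancel_left]
  split_ifs with hw
  · simp
  · change μ w * G (z + w) = _
    rw [ENNReal.toReal_mul, ENNReal.toReal_mul, ENNReal.toReal_ofReal (hnn w), ← mul_sub]
    congr 1
    rcases le_total 0 (G (z + w)) with h | h
    · rw [ENNReal.toReal_ofReal h, ENNReal.ofReal_of_nonpos (neg_nonpos.2 h), ENNReal.toReal_zero,
        sub_zero]
    · rw [ENNReal.toReal_ofReal (neg_nonneg.2 h), ENNReal.ofReal_of_nonpos h, ENNReal.toReal_zero,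
        zero_sub, neg_neg]

/-- The exit expectation as a difference of two potentials. -/
lemma exitExp_eq {μ : (Fin d → ℤ) → ℝ} (hd : 0 < d) (hnn : ∀ z, 0 ≤ μ z) (hsum : HasSum μ 1)
    (hax : ∀ z : Fin d → ℤ, (∃ i j : Fin d, i ≠ j ∧ z i ≠ 0 ∧ z j ≠ 0) → μ z = 0)
    {g : (Fin d → ℤ) → ℝ} {Bp Bm : (Fin d → ℤ) → ℝ≥0∞}
    (hg : ∀ z ∈ posAll, ∑' y, (if y ∉ posAll then μ (y - z) else 0) * g y =
      (Bp z).toReal - (Bm z).toReal)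
    (hp0 : ∀ z ∉ posAll, Bp z = 0) (hm0 : ∀ z ∉ posAll, Bm z = 0) {x : Fin d → ℤ}
    (hp : potential (axisMassE μ) Bp x ≠ ⊤) (hm : potential (axisMassE μ) Bm x ≠ ⊤) :
    exitExp μ posAll Set.univ g x =
      (potential (axisMassE μ) Bp x).toReal - (potential (axisMassE μ) Bm x).toReal := by
  rw [exitExp]
  have h1 := (hasSum_toReal_sub hp hm).tsum_eq
  rw [potential, potential, ← h1]
  refine tsum_congr fun n => ?_
  have hpn := ENNReal.ne_top_of_tsum_ne_top hp n
  have hmn := ENNReal.ne_top_of_tsum_ne_top hm n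
  rw [walkOp_pow_eq_tsum] at hpn hmn
  rw [walkOp_pow_eq_tsum, walkOp_pow_eq_tsum _ _ Bm, ← (hasSum_toReal_sub hpn hmn).tsum_eq]
  refine tsum_congr fun z => ?_
  by_cases hz : z ∈ posAll
  · rw [kern_eq_toReal hd hnn hsum hax n x hz, ENNReal.toReal_mul, ENNReal.toReal_mul,
      ← mul_sub, ← hg z hz]
    congr 1
    exact tsum_congr fun y => by simp
  · rw [kern_notMem μ n x hz, hp0 z hz, hm0 z hz]; simp

lemma pow_add_sum_eq {ν : Fin d → ℤ → ℝ≥0∞} {f b b' : (Fin d → ℤ) → ℝ≥0∞}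
    (hfb : walkOp ν f + b = f + b') (n : ℕ) (x : Fin d → ℤ)
    : (walkOp ν ^ n) f x + ∑ k ∈ Finset.range n, (walkOp ν ^ k) b x =
      f x + ∑ k ∈ Finset.range n, (walkOp ν ^ k) b' x := by
  induction n with
  | zero => simp
  | succ n ih =>
    have h := congrFun (congrArg (walkOp ν ^ n) hfb) x
    rw [map_add, map_add, Pi.add_apply, Pi.add_apply, ← pow_succ_apply] at h
    rw [Finset.sum_range_succ, Finset.sum_range_succ, ← add_assoc (f x), ← ih,
      add_comm (∑ k ∈ Finset.range n, _), ← add_assoc, h]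
    ring

/-- The exit function `hq6` is an axis-harmonic function comparable to products of barriers. -/
lemma exists_axisHarmonic {μ : (Fin d → ℤ) → ℝ} (hd : 0 < d) (hnn : ∀ z, 0 ≤ μ z)
    (hsum : HasSum μ 1) (hA1 : A1 μ)
    (hax : ∀ z : Fin d → ℤ, (∃ i j : Fin d, i ≠ j ∧ z i ≠ 0 ∧ z j ≠ 0) → μ z = 0)
    {a q : Fin d → ℝ} {r : ℝ} (hr : 0 < r) (hs : TiltSummable μ a r)
    (hc : ∑ i, tiltTotal μ a i = 1) (hP : ∀ i, q i = 0 → tiltMean μ a i = 0)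
    (hnP : ∀ i, q i ≠ 0 → 0 < tiltMean μ a i) :
    ∃ (H : (Fin d → ℤ) → ℝ≥0∞) (w : Fin d → ℤ → ℝ) (C : ℝ), 0 < C ∧
      (∀ i, SubBarrier (tiltMass μ a i) (w i)) ∧
      (∀ x ∈ posAll, H x ≠ ⊤ ∧ hq6 μ q a x = (H x).toReal) ∧
      (∀ x ∈ posAll, prodFn a w x ≤ H x ∧ H x ≤ prodFn a (fun i t => C * w i t) x) ∧
      ∀ i, ∀ x ∈ posAll, axisOp (axisMassE μ i) i H x = ENNReal.ofReal (tiltTotal μ a i) * H x := by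
  set P : Fin d → Prop := fun i => q i = 0
  obtain ⟨w, κ, hκ, hw, hwl, hWsub⟩ := exists_prodFn_sub hnn hr hs hc P hP hnP
  obtain ⟨ψ, C, hC, hψ, hFi, hFsup⟩ := exists_prodFn_super hnn hA1 hax hr hs hc P hP
  set pol : Fin d → ℤ → ℝ := fun i => linOrOne (P i)
  set F0 := prodFn a pol
  set W := prodFn a w
  set F := prodFn a ψ
  set bp : Fin d → (Fin d → ℤ) → ℝ≥0∞ := fun i =>
    prodFnWith a pol i (outPos (tiltMass μ a i) (P i))
  set bm : Fin d → (Fin d → ℤ) → ℝ≥0∞ := fun i =>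
    prodFnWith a pol i (outNeg (tiltMass μ a i) (P i))
  set Bp : (Fin d → ℤ) → ℝ≥0∞ := fun x => ∑ i, bp i x
  set Bm : (Fin d → ℤ) → ℝ≥0∞ := fun x => ∑ i, bm i x
  set ν := axisMassE μ
  have hl : ∀ i t, 0 < t → 0 ≤ pol i t := fun i t ht => (linOrOne_pos (P i) ht).le
  have hwn : ∀ i t, 0 < t → 0 ≤ w i t := fun i t ht => ((hw i).pos t ht).le
  have h0 : ∀ i, 0 ≤ tiltTotal μ a i := fun i => tsum_nonneg fun k => tiltMass_nonneg hnn a i k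
  have hWF0 : ∀ x, W x ≤ F0 x := prodFn_mono hwn fun i t ht => (hwl i t ht).1
  have hF0F : ∀ x, F0 x ≤ F x := prodFn_mono hl fun i t ht => (hψ i t ht).1
  have hbal : ∀ i, axisOp (ν i) i F0 + bp i = ENNReal.ofReal (tiltTotal μ a i) • F0 + bm i :=
    fun i => funext fun x => axisOp_prodFn_linOrOne hnn hr hs P hP i x
  have hbalQ : walkOp ν F0 + Bp = F0 + Bm := by
    funext x
    simp only [Pi.add_apply, walkOp_apply, Bp, Bm]
    rw [← Finset.sum_add_distrib]
    have := fun i => congrFun (hbal i) x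
    simp only [Pi.add_apply, Pi.smul_apply, smul_eq_mul] at this
    simp only [this, Finset.sum_add_distrib]
    rw [← Finset.sum_mul, ← ENNReal.ofReal_sum_of_nonneg fun i _ => h0 i, hc, ENNReal.ofReal_one,
      one_mul]
  have hEm : ∀ x ∈ posAll, potential ν Bm x ≤ F x := potential_le ν fun x _ => hFsup x
  have hFsup' : ∀ x ∈ posAll, walkOp ν F x ≤ 1 * F x := fun x _ => by
    rw [one_mul]; exact le_self_add.trans (hFsup x)
  have hQnF : ∀ n, ∀ x ∈ posAll, (walkOp ν ^ n) F0 x ≤ F x := fun n x hx =>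
    ((walkOp_pow_mono ν n (fun y _ => hF0F y) x hx).trans
      (walkOp_pow_le_of_le ν hFsup' n x hx)).trans (by simp)
  have hWQ : ∀ n, ∀ x ∈ posAll, W x ≤ (walkOp ν ^ n) F0 x := fun n x hx =>
    (le_walkOp_pow ν (fun y _ => hWsub y) n x hx).trans
      (walkOp_pow_mono ν n (fun y _ => hWF0 y) x hx)
  have hFtop : ∀ x, F x ≠ ⊤ := prodFn_ne_top _ _
  have hEmtop : ∀ x ∈ posAll, potential ν Bm x ≠ ⊤ := fun x hx =>
    ne_top_of_le_ne_top (hFtop x) (hEm x hx)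
  have hEp : ∀ x ∈ posAll, potential ν Bp x ≤ F0 x + potential ν Bm x := fun x hx => by
    refine ENNReal.tsum_le_of_sum_range_le fun n => ?_
    refine (le_add_self.trans (pow_add_sum_eq hbalQ n x).le).trans ?_
    gcongr
    exact ENNReal.sum_le_tsum _
  have hEptop : ∀ x ∈ posAll, potential ν Bp x ≠ ⊤ := fun x hx =>
    ne_top_of_le_ne_top (ENNReal.add_ne_top.2 ⟨prodFn_ne_top _ _ _, hEmtop x hx⟩) (hEp x hx)
  set H : (Fin d → ℤ) → ℝ≥0∞ := fun x => F0 x + potential ν Bm x - potential ν Bp x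
  have hlim : ∀ x ∈ posAll, Tendsto (fun n => (walkOp ν ^ n) F0 x) atTop (𝓝 (H x)) := by
    intro x hx
    have h1 : ∀ n, (walkOp ν ^ n) F0 x = F0 x + ∑ k ∈ Finset.range n, (walkOp ν ^ k) Bm x -
        ∑ k ∈ Finset.range n, (walkOp ν ^ k) Bp x := fun n =>
      ENNReal.eq_sub_of_add_eq (ne_top_of_le_ne_top (hEptop x hx) (ENNReal.sum_le_tsum _))
        (pow_add_sum_eq hbalQ n x)
    simp only [h1]
    exact ENNReal.Tendsto.sub (tendsto_const_nhds.add (ENNReal.tendsto_nat_tsum _))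
      (ENNReal.tendsto_nat_tsum _) (Or.inr (hEptop x hx))
  have hWH : ∀ x ∈ posAll, W x ≤ H x := fun x hx =>
    ge_of_tendsto (hlim x hx) (Eventually.of_forall fun n => hWQ n x hx)
  have hHF : ∀ x ∈ posAll, H x ≤ F x := fun x hx =>
    le_of_tendsto (hlim x hx) (Eventually.of_forall fun n => hQnF n x hx)
  refine ⟨H, w, C * κ, by positivity, hw,
    fun x hx => ⟨ne_top_of_le_ne_top (hFtop x) (hHF x hx), ?_⟩,
    fun x hx => ⟨hWH x hx, (hHF x hx).trans ?_⟩, fun i x hx => ?_⟩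
  · have hex := exitExp_eq hd hnn hsum hax (Bp := Bp) (Bm := Bm)
      (fun z hz => tsum_exit_eq hd hnn hax hr hs P hP hz)
      (fun z hz => Finset.sum_eq_zero fun i _ => if_neg hz)
      (fun z hz => Finset.sum_eq_zero fun i _ => if_neg hz) (hEptop x hx) (hEmtop x hx)
    have hF0r : (F0 x).toReal = Real.exp (dotZ a x) * ∏ i, linOrOne (P i) (x i) := by
      simp only [F0, prodFn, if_pos hx]
      exact ENNReal.toReal_ofReal
        (mul_nonneg (Real.exp_pos _).le (Finset.prod_nonneg fun i _ => hl i _ (hx i)))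
    rw [ENNReal.toReal_sub_of_le (hEp x hx)
      (ENNReal.add_ne_top.2 ⟨prodFn_ne_top _ _ _, hEmtop x hx⟩),
      ENNReal.toReal_add (prodFn_ne_top _ _ _) (hEmtop x hx), hF0r, add_sub_assoc,
      ← neg_sub (ENNReal.toReal _),
      ← sub_eq_add_neg, ← hex]
    rfl
  · refine prodFn_mono (fun i t ht => (hl i t ht).trans (hψ i t ht).1) (fun i t ht => ?_) x
    refine (hψ i t ht).2.trans ?_
    rw [mul_assoc]
    exact mul_le_mul_of_nonneg_left (hwl i t ht).2 hC.le
  · have hDtop : axisOp (ν i) i F x ≠ ⊤ := ne_top_of_le_ne_top (hFtop x) (hFi i x)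
    have l1 := tendsto_axisOp (ν i) (fun k => ENNReal.ofReal_ne_top) i hDtop hlim
      (Eventually.of_forall fun n k hk => hQnF n _ hk)
    have hle : ∀ {b : Fin d → (Fin d → ℤ) → ℝ≥0∞}, potential ν (fun x => ∑ i, b i x) x ≠ ⊤ →
        Tendsto (fun n => (walkOp ν ^ n) (b i) x) atTop (𝓝 0) := by
      intro b hb
      refine ENNReal.tendsto_atTop_zero_of_tsum_ne_top (ne_top_of_le_ne_top hb ?_)
      exact ENNReal.tsum_le_tsum fun n => walkOp_pow_mono ν n (fun y _ =>
        Finset.single_le_sum (f := fun i => b i y) (fun _ _ => zero_le) (Finset.mem_univ i)) x hx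
    have l2 := l1.add (hle (hEptop x hx))
    have l3 := (ENNReal.Tendsto.const_mul (hlim x hx)
      (Or.inr (ENNReal.ofReal_ne_top (r := tiltTotal μ a i)))).add (hle (hEmtop x hx))
    rw [add_zero] at l2 l3
    refine tendsto_nhds_unique l2 (l3.congr fun n => ?_)
    have h1 := congrFun (congrArg (walkOp ν ^ n) (hbal i)) x
    rw [map_add, map_add, map_smul] at h1
    have h2 : (walkOp ν ^ n) (axisOp (ν i) i F0) = axisOp (ν i) i ((walkOp ν ^ n) F0) :=
      (LinearMap.congr_fun ((axisOp_commute_walkOp ν i).pow_right n).eq F0).symm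
    rw [h2] at h1
    exact h1.symm

end ExitFunction

section Harnack

open ENNReal

variable {d : ℕ}

/-- Superharmonic functions of the killed walk. -/
def IsSuperharmonic (ν : Fin d → ℤ → ℝ≥0∞) (u : (Fin d → ℤ) → ℝ≥0∞) : Prop :=
  ∀ x ∈ posAll, walkOp ν u x ≤ u x

/-- `ℓ¹`-distance on the lattice. -/
def zdist (x y : Fin d → ℤ) : ℕ := ∑ i, (y i - x i).natAbs

lemma exists_axisHarnack_all {μ : (Fin d → ℤ) → ℝ} (hA1 : A1 μ)
    (hax : ∀ z : Fin d → ℤ, (∃ i j : Fin d, i ≠ j ∧ z i ≠ 0 ∧ z j ≠ 0) → μ z = 0) :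
    ∃ p : ℝ, 0 < p ∧ p ≤ 1 ∧ ∀ i, AxisHarnack (axisMassE μ i) (ENNReal.ofReal p) := by
  choose p hp h using exists_axisHarnack hA1 hax
  have hm : ∃ s : ℝ≥0∞, 0 < s ∧ s ≤ 1 ∧ ∀ i, s ≤ p i := by
    refine ⟨Finset.univ.inf p ⊓ 1, ?_, inf_le_right,
      fun i => inf_le_left.trans (Finset.inf_le (Finset.mem_univ i))⟩
    rw [lt_inf_iff]
    exact ⟨(Finset.lt_inf_iff (by simp)).2 fun i _ => hp i, one_pos⟩
  obtain ⟨s, hs, hs1, hsp⟩ := hm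
  have hst : s ≠ ⊤ := ne_top_of_le_ne_top one_ne_top hs1
  refine ⟨s.toReal, ENNReal.toReal_pos hs.ne' hst, ?_, fun i u hu x hx => ?_⟩
  · exact ENNReal.toReal_mono one_ne_top hs1
  · rw [ENNReal.ofReal_toReal hst]
    exact ⟨le_trans (by gcongr; exact hsp i) (h i u hu x hx).1,
      le_trans (by gcongr; exact hsp i) (h i u hu x hx).2⟩

lemma IsSuperharmonic.step {ν : Fin d → ℤ → ℝ≥0∞} {p : ℝ≥0∞} {u : (Fin d → ℤ) → ℝ≥0∞}
    (hu : IsSuperharmonic ν u) {i : Fin d} (hp : AxisHarnack (ν i) p) {x : Fin d → ℤ}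
    (hx : x ∈ posAll) :
    p * u (x + Pi.single i 1) ≤ u x ∧ p * u x ≤ u (x + Pi.single i 1) := by
  have hpt : ∀ t : ℤ, 0 < t → x + Pi.single i (t - x i) ∈ posAll := fun t ht => by
    rw [add_single_mem_posAll hx]; omega
  have := hp (fun t => u (x + Pi.single i (t - x i))) (fun t ht => by
    refine le_trans (le_of_eq ?_) ((axisOp_le_walkOp ν i u _).trans (hu _ (hpt t ht)))
    rw [axisOp_apply_mem _ _ _ (hpt t ht)]
    refine tsum_congr fun k => ?_
    have e1 : (x + Pi.single i (t - x i) : Fin d → ℤ) i = t := by simp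
    have e2 : x + Pi.single i (t - x i) + Pi.single i k = x + Pi.single i (t + k - x i) := by
      rw [add_assoc, ← Pi.single_add]; congr 2; ring
    rw [e1, e2]) (x i) (hx i)
  simpa using this

lemma IsSuperharmonic.harnack {ν : Fin d → ℤ → ℝ≥0∞} {p : ℝ≥0∞} {u : (Fin d → ℤ) → ℝ≥0∞}
    (hu : IsSuperharmonic ν u) (hp1 : p ≤ 1) (hp : ∀ i, AxisHarnack (ν i) p) {x y : Fin d → ℤ}
    (hx : x ∈ posAll) (hy : y ∈ posAll) : p ^ zdist x y * u y ≤ u x := by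
  suffices H : ∀ n x, x ∈ posAll → zdist x y ≤ n → p ^ n * u y ≤ u x from H _ x hx le_rfl
  intro n
  induction n with
  | zero =>
    intro x hx h
    have : x = y := by
      funext i
      have h1 := Finset.sum_eq_zero_iff.1 (Nat.le_zero.1 h) i (Finset.mem_univ i)
      omega
    simp [this]
  | succ n ih =>
    intro x hx h
    by_cases hxy : x = y
    · subst hxy
      exact (mul_le_mul_left (pow_le_one₀ (zero_le) hp1) _).trans (one_mul _).le
    obtain ⟨i, hi⟩ := Function.ne_iff.1 hxy
    have hdec : ∀ x' : Fin d → ℤ, (∀ j, j ≠ i → x' j = x j) →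
        (y i - x' i).natAbs < (y i - x i).natAbs → zdist x' y ≤ n := by
      intro x' h1 h2
      have : zdist x' y < zdist x y := by
        refine Finset.sum_lt_sum (fun j _ => ?_) ⟨i, Finset.mem_univ i, h2⟩
        by_cases hj : j = i
        · subst hj; exact h2.le
        · rw [h1 j hj]
      omega
    rcases lt_or_gt_of_ne hi with hlt | hgt
    · have hx' : x + Pi.single i 1 ∈ posAll :=
        (add_single_mem_posAll hx i 1).2 (by have := hx i; omega)
      have h1 := ih _ hx' (hdec _ (fun j hj => by simp [hj]) (by simp; omega))
      rw [pow_succ', mul_assoc]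
      exact (mul_le_mul_right h1 _).trans (hu.step (hp i) hx).1
    · have hx' : x + Pi.single i (-1) ∈ posAll :=
        (add_single_mem_posAll hx i (-1)).2 (by have := hy i; omega)
      have h1 := ih _ hx' (hdec _ (fun j hj => by simp [hj]) (by simp; omega))
      rw [pow_succ', mul_assoc]
      refine (mul_le_mul_right h1 _).trans ((hu.step (hp i) hx').2.trans (le_of_eq ?_))
      rw [add_assoc, ← Pi.single_add]; simp

lemma IsSuperharmonic.pow_le {ν : Fin d → ℤ → ℝ≥0∞} {u : (Fin d → ℤ) → ℝ≥0∞}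
    (hu : IsSuperharmonic ν u) (n : ℕ) {x : Fin d → ℤ} (hx : x ∈ posAll) :
    (walkOp ν ^ n) u x ≤ u x := by
  have := walkOp_pow_le_of_le ν (f := u) (c := 1)
    (fun y hy => by rw [one_mul]; exact hu y hy) n x hx
  simpa using this

/-- The exponential function `exp (b · x)`. -/
noncomputable def expFn (b : Fin d → ℝ) (x : Fin d → ℤ) : ℝ≥0∞ :=
  ENNReal.ofReal (Real.exp (dotZ b x))

lemma walkOp_expFn {μ : (Fin d → ℤ) → ℝ} (hd : 0 < d) (hnn : ∀ z, 0 ≤ μ z)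
    (hax : ∀ z : Fin d → ℤ, (∃ i j : Fin d, i ≠ j ∧ z i ≠ 0 ∧ z j ≠ 0) → μ z = 0)
    (b : Fin d → ℝ) (x : Fin d → ℤ) :
    walkOp (axisMassE μ) (expFn b) x ≤ phiE μ b * expFn b x := by
  rw [walkOp_axisMassE hd hax, ← (Equiv.addLeft x).tsum_eq, phiE, ← ENNReal.tsum_mul_right]
  refine ENNReal.tsum_le_tsum fun z => ?_
  simp only [Equiv.coe_addLeft, add_sub_cancel_left]
  split_ifs
  · rw [expFn, expFn, ← ENNReal.ofReal_mul (hnn z),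
      ← ENNReal.ofReal_mul (mul_nonneg (hnn z) (Real.exp_pos _).le), dotZ_add, Real.exp_add]
    refine (congrArg _ ?_).le; ring
  · exact zero_le

lemma prodFn_le_expFn {a : Fin d → ℝ} {g : Fin d → ℤ → ℝ} {P : Fin d → Prop}
    (hg : ∀ i t, 0 < t → 0 ≤ g i t) (hgl : ∀ i t, 0 < t → g i t ≤ linOrOne (P i) t)
    {κ : ℝ} (hκ : 0 < κ) (hκ1 : κ ≤ 1) (x : Fin d → ℤ) :
    prodFn a g x ≤ ENNReal.ofReal (κ⁻¹ ^ d) * expFn (a + fun _ => κ) x := by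
  unfold prodFn
  split_ifs with hx
  swap
  · exact zero_le
  rw [expFn, ← ENNReal.ofReal_mul (by positivity)]
  refine ENNReal.ofReal_le_ofReal ?_
  have h1 : ∏ i, g i (x i) ≤ ∏ i, κ⁻¹ * Real.exp (κ * x i) := by
    refine Finset.prod_le_prod (fun i _ => hg i _ (hx i)) fun i _ => (hgl i _ (hx i)).trans ?_
    have hxi : (0 : ℝ) < x i := by exact_mod_cast hx i
    rw [inv_mul_eq_div, le_div_iff₀ hκ]
    have h2 := Real.add_one_le_exp (κ * (x i : ℝ))
    unfold linOrOne; split_ifs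
    · linarith
    · have := mul_pos hκ hxi; linarith
  rw [Finset.prod_mul_distrib, Finset.prod_const, Finset.card_univ, Fintype.card_fin,
    ← Real.exp_sum] at h1
  have h3 : dotZ (a + fun _ => κ) x = dotZ a x + ∑ i, κ * (x i : ℝ) := by
    simp [dotZ, add_mul, Finset.sum_add_distrib]
  rw [h3, Real.exp_add]
  refine (mul_le_mul_of_nonneg_left h1 (Real.exp_pos _).le).trans (le_of_eq ?_)
  ring

/-- Large deviation estimate for the walk weighted by a function of subexponential relative
growth. -/
lemma tendsto_pow_far {μ : (Fin d → ℤ) → ℝ} (hd : 0 < d) (hnn : ∀ z, 0 ≤ μ z)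
    (hax : ∀ z : Fin d → ℤ, (∃ i j : Fin d, i ≠ j ∧ z i ≠ 0 ∧ z j ≠ 0) → μ z = 0)
    {a : Fin d → ℝ} {r : ℝ} (hr : 0 < r) (hs : TiltSummable μ a r)
    (hc : ∑ i, tiltTotal μ a i = 1) {W : (Fin d → ℤ) → ℝ≥0∞}
    (hW : ∀ κ : ℝ, 0 < κ → κ ≤ 1 → ∃ K : ℝ, 0 ≤ K ∧
      ∀ x, W x ≤ ENNReal.ofReal K * expFn (a + fun _ => κ) x)
    {ε : ℝ} (hε : 0 < ε) {x : Fin d → ℤ} (hx : x ∈ posAll) :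
    Tendsto (fun n : ℕ => (walkOp (axisMassE μ) ^ n) (fun z =>
      if ∀ i, |(z i : ℝ) - n * tiltMean μ a i| ≤ ε * n then 0 else W z) x) atTop (𝓝 0) := by
  obtain ⟨C, hC, hφ⟩ := exists_phiE_le hd hnn hax hr hs
  set v := tiltMean μ a
  set C' := |∑ i, v i| + 2 * C * (d + 1)
  have hC' : 0 < C' := by positivity
  obtain ⟨η, hη, hη1, hηr, hηε⟩ : ∃ η : ℝ, 0 < η ∧ η ≤ 1 ∧ η ≤ r / 4 ∧ C' * η ≤ ε / 2 := by
    refine ⟨min 1 (min (r / 4) (ε / 2 / C')), by positivity, min_le_left _ _,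
      (min_le_right _ _).trans (min_le_left _ _), ?_⟩
    rw [mul_comm, ← le_div_iff₀ hC']
    exact (min_le_right _ _).trans (min_le_right _ _)
  have hη2 : η ^ 2 ≤ η := by nlinarith
  obtain ⟨K, hK, hWK⟩ := hW (η ^ 2) (by positivity) (hη2.trans hη1)
  set h : Fin d → ℝ → Fin d → ℝ := fun i s => (fun _ => η ^ 2) + Pi.single i (s * η)
  have hφ' : ∀ i, ∀ s : ℝ, |s| = 1 →
      phiE μ (a + h i s) ≤ ENNReal.ofReal (Real.exp (s * η * v i + C' * η ^ 2)) := by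
    intro i s hs1
    have hs2 : s ^ 2 = 1 := by rw [← sq_abs, hs1, one_pow]
    have hj : ∀ j, |(Pi.single i (s * η) : Fin d → ℝ) j| ≤ η := by
      intro j
      by_cases hj : j = i
      · subst hj; rw [Pi.single_eq_same, abs_mul, hs1, one_mul, abs_of_pos hη]
      · rw [Pi.single_eq_of_ne hj, abs_zero]; exact hη.le
    refine (hφ (h i s) fun j => ?_).trans (ENNReal.ofReal_le_ofReal ?_)
    · simp only [h, Pi.add_apply]
      refine (abs_add_le _ _).trans ?_
      rw [abs_of_pos (by positivity : 0 < η ^ 2)]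
      linarith [hj j]
    · rw [hc]
      have e1 : ∑ j, h i s j * v j = η ^ 2 * ∑ j, v j + s * η * v i := by
        simp only [h, Pi.add_apply, add_mul, Finset.sum_add_distrib, ← Finset.mul_sum]
        congr 1
        rw [Finset.sum_eq_single i]
        · simp
        · intro j _ hj; simp [hj]
        · simp
      have e2 : ∑ j, h i s j ^ 2 ≤ 2 * (d + 1) * η ^ 2 := by
        have e3 : ∀ j, h i s j ^ 2 ≤ 2 * η ^ 2 + 2 * (Pi.single i (s * η) : Fin d → ℝ) j ^ 2 := by
          intro j
          simp only [h, Pi.add_apply]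
          have : (η ^ 2) ^ 2 ≤ η ^ 2 := by nlinarith [sq_nonneg η]
          nlinarith [sq_nonneg (η ^ 2 - (Pi.single i (s * η) : Fin d → ℝ) j)]
        refine (Finset.sum_le_sum fun j _ => e3 j).trans (le_of_eq ?_)
        rw [Finset.sum_add_distrib, ← Finset.mul_sum, Finset.sum_const, Finset.card_univ,
          Fintype.card_fin, Finset.sum_eq_single i]
        · simp only [Pi.single_eq_same, nsmul_eq_mul, mul_pow, hs2]; ring
        · intro j _ hj; simp [hj]
        · simp
      rw [e1]
      refine le_trans ?_ (Real.add_one_le_exp _)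
      have e4 := mul_le_mul_of_nonneg_left (le_abs_self (∑ j, v j)) (sq_nonneg η)
      have e5 := mul_le_mul_of_nonneg_left e2 hC.le
      simp only [C']
      nlinarith
  have hpow : ∀ (n : ℕ) i, ∀ s : ℝ, |s| = 1 → (walkOp (axisMassE μ) ^ n) (expFn (a + h i s)) x ≤
      ENNReal.ofReal (Real.exp (n * (s * η * v i + C' * η ^ 2))) * expFn (a + h i s) x := by
    intro n i s hs1
    refine (walkOp_pow_le_of_le _ (fun y _ => walkOp_expFn hd hnn hax (a + h i s) y) n x
      hx).trans ?_
    gcongr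
    rw [Real.exp_nat_mul, ENNReal.ofReal_pow (Real.exp_pos _).le]
    gcongr
    exact hφ' i s hs1
  set G : ℕ → Fin d → ℝ → (Fin d → ℤ) → ℝ≥0∞ := fun n i s =>
    ENNReal.ofReal (K * Real.exp (-(n * (s * η * v i + η * ε)))) • expFn (a + h i s)
  have hbad : ∀ n : ℕ, ∀ z, (if ∀ i, |(z i : ℝ) - n * v i| ≤ ε * n then 0 else W z) ≤
      (∑ i, (G n i 1 + G n i (-1))) z := by
    intro n z
    split_ifs with hz
    · exact zero_le
    push Not at hz
    obtain ⟨i, hi⟩ := hz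
    have hsel : ∃ s : ℝ, (s = 1 ∨ s = -1) ∧ ε * n ≤ s * (z i - n * v i) := by
      rcases abs_cases ((z i : ℝ) - n * v i) with ⟨h1, -⟩ | ⟨h1, -⟩
      · exact ⟨1, Or.inl rfl, by rw [one_mul, ← h1]; exact hi.le⟩
      · exact ⟨-1, Or.inr rfl, by rw [neg_one_mul, ← h1]; exact hi.le⟩
    obtain ⟨s, hs1, hsz⟩ := hsel
    have hG : W z ≤ G n i s z := by
      refine (hWK z).trans ?_
      simp only [G, Pi.smul_apply, smul_eq_mul, expFn]
      rw [← ENNReal.ofReal_mul hK, ← ENNReal.ofReal_mul (mul_nonneg hK (Real.exp_pos _).le),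
        mul_assoc, ← Real.exp_add]
      refine ENNReal.ofReal_le_ofReal (mul_le_mul_of_nonneg_left (Real.exp_le_exp.2 ?_) hK)
      have e1 : dotZ (a + h i s) z = dotZ (a + fun _ => η ^ 2) z + s * η * z i := by
        simp only [h, dotZ, Pi.add_apply, ← add_assoc]
        simp only [add_mul _ _ (_ : ℝ), Finset.sum_add_distrib]
        congr 1
        rw [Finset.sum_eq_single i]
        · simp
        · intro j _ hj; simp [hj]
        · simp
      rw [e1]
      nlinarith [mul_le_mul_of_nonneg_left hsz hη.le]
    refine hG.trans ?_
    rw [Finset.sum_apply]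
    refine le_trans ?_ (Finset.single_le_sum (f := fun i => (G n i 1 + G n i (-1)) z)
      (fun _ _ => zero_le) (Finset.mem_univ i))
    rw [Pi.add_apply]
    rcases hs1 with rfl | rfl
    · exact le_self_add
    · exact le_add_self
  have hG : ∀ n i, ∀ s : ℝ, |s| = 1 → (walkOp (axisMassE μ) ^ n) (G n i s) x ≤
      ENNReal.ofReal (K * Real.exp (-(η * ε / 2)) ^ n) * expFn (a + h i s) x := by
    intro n i s hs1
    simp only [G]
    rw [map_smul, Pi.smul_apply, smul_eq_mul]
    refine (mul_le_mul_right (hpow n i s hs1) _).trans ?_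
    rw [← mul_assoc, ← ENNReal.ofReal_mul (mul_nonneg hK (Real.exp_pos _).le), mul_assoc K,
      ← Real.exp_add, ← Real.exp_nat_mul]
    gcongr
    have : (n : ℝ) * (C' * η * η) ≤ n * (ε / 2 * η) := by gcongr
    nlinarith
  have hlim : Tendsto (fun n : ℕ => ∑ i,
      (ENNReal.ofReal (K * Real.exp (-(η * ε / 2)) ^ n) * expFn (a + h i 1) x +
      ENNReal.ofReal (K * Real.exp (-(η * ε / 2)) ^ n) * expFn (a + h i (-1)) x))
      atTop (𝓝 0) := by
    have h1 : Tendsto (fun n : ℕ => K * Real.exp (-(η * ε / 2)) ^ n) atTop (𝓝 0) := by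
      have := (tendsto_pow_atTop_nhds_zero_of_lt_one (Real.exp_pos (-(η * ε / 2))).le
        (Real.exp_lt_one_iff.2 (by have := mul_pos hη hε; linarith))).const_mul K
      simpa using this
    have h2 := ENNReal.tendsto_ofReal h1
    rw [ENNReal.ofReal_zero] at h2
    have h3 : ∀ b : Fin d → ℝ, Tendsto (fun n : ℕ =>
        ENNReal.ofReal (K * Real.exp (-(η * ε / 2)) ^ n) * expFn b x) atTop (𝓝 0) := fun b => by
      have := ENNReal.Tendsto.mul_const h2
        (Or.inr (ENNReal.ofReal_ne_top (r := Real.exp (dotZ b x))))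
      rwa [zero_mul] at this
    have h4 := tendsto_finsetSum Finset.univ fun (i : Fin d) _ =>
      (h3 (a + h i 1)).add (h3 (a + h i (-1)))
    simpa using h4
  refine tendsto_of_tendsto_of_tendsto_of_le_of_le tendsto_const_nhds hlim
    (fun n => zero_le) fun n => ?_
  refine (walkOp_pow_mono _ n (fun z _ => hbad n z) x hx).trans ?_
  rw [map_sum, Finset.sum_apply]
  refine Finset.sum_le_sum fun i _ => ?_
  rw [map_add, Pi.add_apply]
  exact add_le_add (hG n i 1 (by simp)) (hG n i (-1) (by simp))

end Harnack

section LowerBound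

open ENNReal

variable {d : ℕ}

lemma abs_sub_le_zdist (z y : Fin d → ℤ) (i : Fin d) : |(z i : ℝ) - y i| ≤ zdist z y := by
  have h : (y i - z i).natAbs ≤ zdist z y :=
    Finset.single_le_sum (f := fun i => (y i - z i).natAbs) (fun _ _ => Nat.zero_le _)
      (Finset.mem_univ i)
  have h2 : |(z i : ℝ) - y i| = ((y i - z i).natAbs : ℝ) := by
    rw [abs_sub_comm, Nat.cast_natAbs]; push_cast; rfl
  rw [h2]; exact_mod_cast h

lemma zdist_le {z y : Fin d → ℤ} {c : ℝ} (h : ∀ i, |(z i : ℝ) - y i| ≤ c) :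
    (zdist z y : ℝ) ≤ d * c := by
  have h2 : ∀ i, ((y i - z i).natAbs : ℝ) ≤ c := fun i => by
    refine le_trans (le_of_eq ?_) (h i)
    rw [abs_sub_comm, Nat.cast_natAbs]; push_cast; rfl
  unfold zdist
  push_cast
  refine (Finset.sum_le_sum fun i _ => h2 i).trans (le_of_eq ?_)
  simp

lemma dotZ_le_add_zdist (b : Fin d → ℝ) (z y : Fin d → ℤ) :
    dotZ b z ≤ dotZ b y + (∑ i, |b i|) * zdist z y := by
  simp only [dotZ]
  rw [Finset.sum_mul, ← Finset.sum_add_distrib]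
  refine Finset.sum_le_sum fun i _ => ?_
  have h1 := (le_abs_self (b i * ((z i : ℝ) - y i))).trans (abs_mul _ _).le
  have h2 := mul_le_mul_of_nonneg_left (abs_sub_le_zdist z y i) (abs_nonneg (b i))
  linarith

lemma IsSuperharmonic.le_mul_exp_zdist {ν : Fin d → ℤ → ℝ≥0∞} {p : ℝ} {u : (Fin d → ℤ) → ℝ≥0∞}
    (hu : IsSuperharmonic ν u) (hp0 : 0 < p) (hp1 : p ≤ 1)
    (hp : ∀ i, AxisHarnack (ν i) (ENNReal.ofReal p)) {x y : Fin d → ℤ}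
    (hx : x ∈ posAll) (hy : y ∈ posAll) :
    u y ≤ ENNReal.ofReal (Real.exp (-Real.log p * zdist x y)) * u x := by
  have h := hu.harnack (ENNReal.ofReal_le_one.2 hp1) hp hx hy
  have h2 := mul_le_mul_right h (ENNReal.ofReal (Real.exp (-Real.log p * zdist x y)))
  have e : Real.exp (-Real.log p * zdist x y) * p ^ zdist x y = 1 := by
    rw [mul_comm (-Real.log p), Real.exp_nat_mul, Real.exp_neg, Real.exp_log hp0, ← mul_pow,
      inv_mul_cancel₀ hp0.ne', one_pow]
  rwa [← mul_assoc, ← ENNReal.ofReal_pow hp0.le, ← ENNReal.ofReal_mul (Real.exp_pos _).le, e,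
    ENNReal.ofReal_one, one_mul] at h2

/-- A superharmonic function grows at most like `exp (a(q) · y)` in the direction `q`. -/
lemma IsSuperharmonic.exists_growth {μ : (Fin d → ℤ) → ℝ} (hd : 0 < d) (hnn : ∀ z, 0 ≤ μ z)
    (hsum : HasSum μ 1) (hA1 : A1 μ) (hA2 : A2 μ) (hA3 : A3 μ)
    (hax : ∀ z : Fin d → ℤ, (∃ i j : Fin d, i ≠ j ∧ z i ≠ 0 ∧ z j ≠ 0) → μ z = 0)
    {q : Fin d → ℝ} (hq0 : ∀ i, 0 ≤ q i) (hq1 : rnorm q = 1) {a : Fin d → ℝ} (ha : a ∈ Dset μ)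
    (hmax : ∀ b ∈ Dset μ, dotR b q ≤ dotR a q) {ε : ℝ} (hε : 0 < ε) {x : Fin d → ℤ}
    (hx : x ∈ posAll) :
    ∃ C R δ : ℝ, 0 < δ ∧ 0 ≤ C ∧ ∀ u, IsSuperharmonic (axisMassE μ) u → ∀ y ∈ posAll,
      R ≤ znorm y → (∀ i, |(y i : ℝ) - znorm y * q i| ≤ δ * znorm y) →
      u y ≤ ENNReal.ofReal (C * Real.exp (dotZ a y + ε * znorm y)) * u x := by
  have hqne : q ≠ 0 := by
    rintro rfl
    simp [rnorm] at hq1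
  obtain ⟨r, hr, hs⟩ := exists_tiltSummable hd hnn hax hA2 ha
  obtain ⟨hc, l, hl, hv⟩ := exists_tiltMean_eq hd hnn hsum hA1 hA3 hax ha hr hs hqne hmax
  obtain ⟨p, hp0, hp1, hp⟩ := exists_axisHarnack_all hA1 hax
  obtain ⟨w, _, -, hw, hwl, hwQ⟩ := exists_prodFn_sub hnn hr hs hc (fun i => q i = 0)
    (fun i hi => by rw [hv, hi, mul_zero])
    (fun i hi => by rw [hv]; exact mul_pos hl ((hq0 i).lt_of_ne' hi))
  have hw0 : ∀ i t, 0 < t → 0 ≤ w i t := fun i t ht => ((hw i).pos t ht).le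
  set W := prodFn a w
  set ρ := -Real.log p
  have hρ : 0 ≤ ρ := neg_nonneg.2 (Real.log_nonpos hp0.le hp1)
  set B := ∑ i, |a i| + d + ρ
  have hA : 0 ≤ ∑ i, |a i| := Finset.sum_nonneg fun _ _ => abs_nonneg _
  have hd' : (1 : ℝ) ≤ d := by exact_mod_cast hd
  have hB : 0 < B := by simp only [B]; linarith
  obtain ⟨κ, hκ, hκ1, hκε⟩ : ∃ κ : ℝ, 0 < κ ∧ κ ≤ 1 ∧ κ ≤ ε / 2 :=
    ⟨min 1 (ε / 2), by positivity, min_le_left _ _, min_le_right _ _⟩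
  set θ := ε / (4 * d * B)
  have hθ : 0 < θ := by positivity
  have hfar := tendsto_pow_far hd hnn hax hr hs hc (W := W) (fun κ hκ hκ1 =>
    ⟨κ⁻¹ ^ d, by positivity,
      prodFn_le_expFn hw0 (fun i t ht => (hwl i t ht).1) hκ hκ1⟩) (mul_pos hl hθ) hx
  have hW0 : 0 < W x := prodFn_pos a (fun i t ht => (hw i).pos t ht) hx
  have hWt : W x ≠ ⊤ := prodFn_ne_top _ _ _
  obtain ⟨n₀, hn₀⟩ := eventually_atTop.1
    (hfar.eventually_lt_const (ENNReal.half_pos hW0.ne'))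
  set K := κ⁻¹ ^ d * Real.exp (B * (d * l))
  have hK : 0 ≤ K := by positivity
  refine ⟨2 * K / (W x).toReal, n₀ * l, θ, hθ, by positivity, fun u hu y hy hRy hyq => ?_⟩
  set N := znorm y
  have hN : 0 ≤ N := Finset.sum_nonneg fun _ _ => abs_nonneg _
  set n := ⌊N / l⌋₊
  have hnn₀ : n₀ ≤ n := Nat.le_floor ((le_div_iff₀ hl).2 hRy)
  have hn1 : (n : ℝ) * l ≤ N := by
    have := Nat.floor_le (div_nonneg hN hl.le)
    rwa [le_div_iff₀ hl] at this
  have hn2 : N ≤ n * l + l := by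
    have := (Nat.lt_floor_add_one (N / l)).le
    rw [div_le_iff₀ hl] at this
    linarith
  have hq1' : ∀ i, q i ≤ 1 := fun i => by
    rw [← hq1, rnorm, ← abs_of_nonneg (hq0 i)]
    exact Finset.single_le_sum (f := fun i => |q i|) (fun _ _ => abs_nonneg _) (Finset.mem_univ i)
  set E := K * Real.exp (dotZ a y + ε * N)
  set good : (Fin d → ℤ) → Prop := fun z =>
    ∀ i, |(z i : ℝ) - n * tiltMean μ a i| ≤ l * θ * n
  have hgood : ∀ z ∈ posAll, good z → W z * u y ≤ ENNReal.ofReal E * u z := by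
    intro z hz hg
    have hzd : (zdist z y : ℝ) ≤ d * (2 * θ * N + l) := by
      refine zdist_le fun i => ?_
      have h1 := hg i
      rw [hv] at h1
      have h2 := hyq i
      have h3 : |(n : ℝ) * (l * q i) - N * q i| ≤ l := by
        rw [← mul_assoc, ← sub_mul, abs_mul, abs_of_nonneg (hq0 i)]
        have : |(n : ℝ) * l - N| ≤ l := abs_le.2 ⟨by linarith, by linarith⟩
        exact (mul_le_mul this (hq1' i) (hq0 i) hl.le).trans (mul_one l).le
      have h4 : l * θ * n ≤ θ * N := by nlinarith
      have h5 : (z i : ℝ) - y i = (z i - n * (l * q i)) + (n * (l * q i) - N * q i) -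
        (y i - N * q i) := by ring
      rw [h5]
      refine (abs_sub _ _).trans ?_
      have h6 := abs_add_le ((z i : ℝ) - n * (l * q i)) (n * (l * q i) - N * q i)
      linarith
    have h1 : W z ≤ ENNReal.ofReal (κ⁻¹ ^ d) * expFn (a + fun _ => κ) z :=
      prodFn_le_expFn hw0 (fun i t ht => (hwl i t ht).1) hκ hκ1 z
    have h2 := hu.le_mul_exp_zdist hp0 hp1 hp hz hy
    refine (mul_le_mul' h1 h2).trans ?_
    rw [← mul_assoc, expFn]
    refine mul_le_mul_left ?_ _
    rw [← ENNReal.ofReal_mul (by positivity), ← ENNReal.ofReal_mul (by positivity), mul_assoc,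
      ← Real.exp_add]
    refine ENNReal.ofReal_le_ofReal ?_
    simp only [E, K]
    rw [mul_assoc, ← Real.exp_add]
    refine mul_le_mul_of_nonneg_left (Real.exp_le_exp.2 ?_) (by positivity)
    have e1 : dotZ (a + fun _ => κ) z = dotZ a z + dotZ (fun _ => κ) z := by
      simp [dotZ, add_mul, Finset.sum_add_distrib]
    have e2 : dotZ (fun _ => κ) y = κ * N := by
      simp only [dotZ, N, znorm, Finset.mul_sum]
      refine Finset.sum_congr rfl fun i _ => ?_
      rw [abs_of_pos (by exact_mod_cast hy i)]
    have e3 := dotZ_le_add_zdist a z y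
    have e4 := dotZ_le_add_zdist (fun _ => κ) z y
    rw [e2] at e4
    have e5 : (∑ _i : Fin d, |κ|) ≤ d := by
      rw [Finset.sum_const, Finset.card_univ, Fintype.card_fin, nsmul_eq_mul, abs_of_pos hκ]
      nlinarith
    have e6 := mul_le_mul_of_nonneg_right e5 (Nat.cast_nonneg (α := ℝ) (zdist z y))
    have e7 := mul_le_mul_of_nonneg_left hzd hB.le
    have e8 : B * (d * (2 * θ * N + l)) = ε / 2 * N + B * (d * l) := by
      simp only [θ]; field_simp; ring
    have e9 := mul_le_mul_of_nonneg_right hκε hN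
    rw [e1]
    rw [e8] at e7
    simp only [B] at e7 ⊢
    linarith
  have hsplit : W x ≤ (walkOp (axisMassE μ) ^ n) (fun z => if good z then W z else 0) x +
      W x / 2 := by
    refine (le_walkOp_pow _ (fun z _ => hwQ z) n x hx).trans ?_
    have : W = (fun z => if good z then W z else 0) + fun z => if good z then 0 else W z := by
      funext z
      simp only [Pi.add_apply]
      split_ifs <;> simp
    conv_lhs => rw [this]
    rw [map_add, Pi.add_apply]
    exact add_le_add le_rfl (hn₀ n hnn₀).le
  have hhalf : W x / 2 ≤ (walkOp (axisMassE μ) ^ n) (fun z => if good z then W z else 0) x := by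
    have h2 : W x / 2 ≠ ⊤ := (ENNReal.div_lt_top hWt (by norm_num)).ne
    rw [← ENNReal.add_le_add_iff_right h2, ENNReal.add_halves]
    exact hsplit
  have hmain : W x / 2 * u y ≤ ENNReal.ofReal E * u x := by
    refine (mul_le_mul_left hhalf _).trans ?_
    have h1 : (walkOp (axisMassE μ) ^ n) (u y • fun z => if good z then W z else 0) x ≤
        (walkOp (axisMassE μ) ^ n) (ENNReal.ofReal E • u) x := by
      refine walkOp_pow_mono _ n (fun z hz => ?_) x hx
      simp only [Pi.smul_apply, smul_eq_mul]
      split_ifs with hg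
      · rw [mul_comm]; exact hgood z hz hg
      · simp
    rw [map_smul, map_smul, Pi.smul_apply, Pi.smul_apply, smul_eq_mul, smul_eq_mul] at h1
    rw [mul_comm]
    exact h1.trans (mul_le_mul_right (hu.pow_le n hx) _)
  have hWr : 0 < (W x).toReal := ENNReal.toReal_pos hW0.ne' hWt
  have hfac : ENNReal.ofReal (2 / (W x).toReal) * (W x / 2) = 1 := by
    rw [← ENNReal.ofReal_toReal hWt, ENNReal.toReal_ofReal hWr.le,
      show (2 : ℝ≥0∞) = ENNReal.ofReal 2 by simp, ← ENNReal.ofReal_div_of_pos (by norm_num),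
      ← ENNReal.ofReal_mul (by positivity)]
    rw [show 2 / (W x).toReal * ((W x).toReal / 2) = 1 by field_simp, ENNReal.ofReal_one]
  calc u y = ENNReal.ofReal (2 / (W x).toReal) * (W x / 2 * u y) := by
        rw [← mul_assoc, hfac, one_mul]
    _ ≤ ENNReal.ofReal (2 / (W x).toReal) * (ENNReal.ofReal E * u x) := mul_le_mul_right hmain _
    _ = _ := by
        rw [← mul_assoc, ← ENNReal.ofReal_mul (by positivity)]
        congr 2
        simp only [E]; ring

end LowerBound

section Domination

open ENNReal

variable {d : ℕ}

lemma dotZ_add_right (b : Fin d → ℝ) (x y : Fin d → ℤ) : dotZ b (x + y) = dotZ b x + dotZ b y := by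
  simp [dotZ, mul_add, Finset.sum_add_distrib]

lemma tsum_axisMassE_mul_exp_ne_top {μ : (Fin d → ℤ) → ℝ} (hnn : ∀ z, 0 ≤ μ z)
    {a : Fin d → ℝ} {i : Fin d} (hs : Summable (tiltMass μ a i)) {C : ℝ} (hC : 0 ≤ C) :
    ∑' k : ℤ, axisMassE μ i k * ENNReal.ofReal (C * Real.exp (a i * k)) ≠ ⊤ := by
  have h : ∀ k : ℤ, axisMassE μ i k * ENNReal.ofReal (C * Real.exp (a i * k)) =
      ENNReal.ofReal (C * tiltMass μ a i k) := fun k => by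
    rw [axisMassE, ← ENNReal.ofReal_mul (axisMass_nonneg hnn i k), tiltMass]
    congr 1; ring
  simp only [h]
  rw [← ENNReal.ofReal_tsum_of_nonneg (fun k => mul_nonneg hC (tiltMass_nonneg hnn a i k))
    (hs.mul_left C)]
  exact ofReal_ne_top

/-- Superharmonic functions are dominated, along each axis, by a function which is integrable with
respect to the jumps along this axis. -/
lemma exists_axis_domination {μ : (Fin d → ℤ) → ℝ} (hd : 0 < d) (hnn : ∀ z, 0 ≤ μ z)
    (hsum : HasSum μ 1) (hA1 : A1 μ) (hA2 : A2 μ) (hA3 : A3 μ)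
    (hax : ∀ z : Fin d → ℤ, (∃ i j : Fin d, i ≠ j ∧ z i ≠ 0 ∧ z j ≠ 0) → μ z = 0)
    (i : Fin d) {x : Fin d → ℤ} (hx : x ∈ posAll) :
    ∃ D : (Fin d → ℤ) → ℝ≥0∞, axisOp (axisMassE μ i) i D x ≠ ⊤ ∧
      ∀ u, IsSuperharmonic (axisMassE μ) u → ∀ k, x + Pi.single i k ∈ posAll →
        u (x + Pi.single i k) ≤ D (x + Pi.single i k) * u x := by
  set e : Fin d → ℝ := Pi.single i 1
  have he0 : ∀ j, 0 ≤ e j := fun j => by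
    by_cases h : j = i
    · subst h; simp [e]
    · simp [e, h]
  have he1 : rnorm e = 1 := by
    rw [rnorm, Finset.sum_eq_single i]
    · simp [e]
    · intro j _ hj; simp [e, hj]
    · simp
  obtain ⟨a, ha, hmax⟩ := exists_max_Dset hd hnn hsum hA1 hax e
  obtain ⟨r, hr, hs⟩ := exists_tiltSummable hd hnn hax hA2 ha
  obtain ⟨p, hp0, hp1, hp⟩ := exists_axisHarnack_all hA1 hax
  obtain ⟨C, R, δ, hδ, hC, hgr⟩ := IsSuperharmonic.exists_growth hd hnn hsum hA1 hA2 hA3 hax he0 he1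
    ha hmax hr hx
  set κ := a i + r
  set N := znorm x
  have hxN : ∀ j, |(x j : ℝ)| ≤ N := fun j =>
    Finset.single_le_sum (f := fun j => |(x j : ℝ)|) (fun _ _ => abs_nonneg _) (Finset.mem_univ j)
  have hN : 0 ≤ N := (abs_nonneg _).trans (hxN i)
  set k₀ := |R| + N / δ + N
  have hk₀ : 0 ≤ k₀ := by positivity
  set ρ := -Real.log p
  have hρ : 0 ≤ ρ := neg_nonneg.2 (Real.log_nonpos hp0.le hp1)
  set C' := C * Real.exp (dotZ a x + r * N) + Real.exp ((ρ + |κ|) * k₀)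
  have hC' : 0 ≤ C' := by positivity
  have hsκ : Summable (tiltMass μ (a + Pi.single i r) i) :=
    hs.summable_add hnn (by rw [Pi.single_eq_same, abs_of_pos hr])
  have hκ : (a + Pi.single i r : Fin d → ℝ) i = κ := by simp [κ]
  refine ⟨fun z => ENNReal.ofReal (C' * Real.exp (κ * ((z i - x i : ℤ) : ℝ))), ?_,
    fun u hu k hk => ?_⟩
  · have := tsum_axisMassE_mul_exp_ne_top hnn hsκ hC'
    rw [hκ] at this
    refine ne_top_of_le_ne_top this ?_
    rw [axisOp_apply_mem _ _ _ hx]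
    refine ENNReal.tsum_le_tsum fun k => ?_
    split_ifs
    · simp
    · exact zero_le
  have hxk : 0 < x i + k := (add_single_mem_posAll hx i k).1 hk
  have hki : (x + Pi.single i k : Fin d → ℤ) i - x i = k := by simp
  simp only [hki]
  by_cases hkk : |(k : ℝ)| ≤ k₀
  · have hz : (zdist x (x + Pi.single i k) : ℝ) = |(k : ℝ)| := by
      rw [zdist, Finset.sum_eq_single i]
      · simp
      · intro j _ hj; simp [hj]
      · simp
    have h1 := hu.le_mul_exp_zdist hp0 hp1 hp hx hk
    refine h1.trans (mul_le_mul_left (ENNReal.ofReal_le_ofReal ?_) _)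
    rw [hz]
    refine le_trans ?_ (mul_le_mul_of_nonneg_right
      (le_add_of_nonneg_left (by positivity) : Real.exp ((ρ + |κ|) * k₀) ≤ C') (Real.exp_pos _).le)
    rw [← Real.exp_add]
    refine Real.exp_le_exp.2 ?_
    have h2 := mul_le_mul_of_nonneg_left hkk hρ
    have h3 := mul_le_mul_of_nonneg_left hkk (abs_nonneg κ)
    have h4 := neg_abs_le (κ * k)
    rw [abs_mul] at h4
    linarith
  · push Not at hkk
    have hxi : |(x i : ℝ)| ≤ N := hxN i
    have hkpos : k₀ < k := by
      rcases abs_cases (k : ℝ) with ⟨h, -⟩ | ⟨h, -⟩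
      · rwa [h] at hkk
      · exfalso
        have h1 : (0 : ℝ) < x i + k := by exact_mod_cast hxk
        have h2 : N ≤ k₀ := by
          have : 0 ≤ |R| + N / δ := by positivity
          simp only [k₀]; linarith
        have := le_abs_self (x i : ℝ)
        linarith
    have hk0 : (0 : ℝ) < k := hk₀.trans_lt hkpos
    have hzn : znorm (x + Pi.single i k) = N + k := by
      have h1 : ∀ j, |((x + Pi.single i k : Fin d → ℤ) j : ℝ)| =
          |(x j : ℝ)| + (Pi.single i (k : ℝ) : Fin d → ℝ) j := by
        intro j
        rw [abs_of_pos (by exact_mod_cast hk j), abs_of_pos (by exact_mod_cast hx j)]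
        by_cases hj : j = i
        · subst hj; simp
        · simp [hj]
      rw [znorm, Finset.sum_congr rfl fun j _ => h1 j, Finset.sum_add_distrib]
      simp [N, znorm]
    have hNδ : N ≤ δ * k₀ := by
      have h1 : N / δ ≤ k₀ := by
        have := abs_nonneg R
        simp only [k₀]; linarith
      rwa [div_le_iff₀ hδ, mul_comm] at h1
    have h1 := hgr u hu _ hk (by
      rw [hzn]
      have := le_abs_self R
      have h2 : 0 ≤ N / δ := by positivity
      have h3 : |R| ≤ k₀ := by simp only [k₀]; linarith
      linarith) (fun j => by
      rw [hzn]
      have h2 : δ * k₀ ≤ δ * (N + k) := by gcongr; linarith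
      refine le_trans ?_ (hNδ.trans h2)
      by_cases hj : j = i
      · subst hj
        have h3 : 0 < (x j : ℝ) := by exact_mod_cast hx j
        rw [abs_of_pos h3] at hxi
        simp only [e, Pi.add_apply, Pi.single_eq_same, mul_one]
        push_cast
        rw [abs_le]; constructor <;> linarith
      · simpa [e, hj] using hxN j)
    refine h1.trans (mul_le_mul_left (ENNReal.ofReal_le_ofReal ?_) _)
    rw [hzn, dotZ_add_right, dotZ_single]
    refine le_trans (le_of_eq ?_) (mul_le_mul_of_nonneg_right
      (le_add_of_nonneg_right (Real.exp_pos _).le : C * Real.exp (dotZ a x + r * N) ≤ C')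
      (Real.exp_pos _).le)
    rw [mul_assoc, ← Real.exp_add]
    congr 2
    simp only [κ]; ring

end Domination

section Concentration

open ENNReal

variable {d : ℕ}

lemma add_smul_pow_apply {X Y : Module.End ℝ≥0∞ ((Fin d → ℤ) → ℝ≥0∞)} (h : Commute X Y)
    (c c' : ℝ≥0∞) (n : ℕ) (f : (Fin d → ℤ) → ℝ≥0∞) (x : Fin d → ℤ) :
    ((c • X + c' • Y) ^ n) f x = ∑ k ∈ Finset.range (n + 1),
      (n.choose k : ℝ≥0∞) * (c ^ k * c' ^ (n - k)) * (X ^ k * Y ^ (n - k)) f x := by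
  have hc : Commute (c • X) (c' • Y) := (h.smul_left c).smul_right c'
  rw [hc.add_pow', Finset.Nat.sum_antidiagonal_eq_sum_range_succ
    (fun k l => n.choose k • ((c • X) ^ k * (c' • Y) ^ l)), LinearMap.sum_apply, Finset.sum_apply]
  refine Finset.sum_congr rfl fun k _ => ?_
  rw [smul_pow, smul_pow, smul_mul_smul_comm, LinearMap.smul_apply, LinearMap.smul_apply,
    Pi.smul_apply, Pi.smul_apply, nsmul_eq_mul, smul_eq_mul, mul_assoc (n.choose k : ℝ≥0∞)]

lemma smul_apply_pow_le {X Y : Module.End ℝ≥0∞ ((Fin d → ℤ) → ℝ≥0∞)} (h : Commute X Y)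
    {s γ : ℝ} (hs : 0 ≤ s) (hγ : 0 ≤ γ) (n : ℕ) (f : (Fin d → ℤ) → ℝ≥0∞) (x : Fin d → ℤ) :
    ENNReal.ofReal s * X (((X + Y) ^ n) f) x ≤
      ((ENNReal.ofReal (Real.exp (s - s * γ)) • X +
        ENNReal.ofReal (Real.exp (-(s * γ))) • Y) ^ (n + 1)) f x +
      ENNReal.ofReal (s * γ) * ((X + Y) ^ (n + 1)) f x := by
  have hXY : ∀ m g z, ((X + Y) ^ m) g z = ∑ k ∈ Finset.range (m + 1),
      (m.choose k : ℝ≥0∞) * (X ^ k * Y ^ (m - k)) g z := fun m g z => by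
    simpa using add_smul_pow_apply h 1 1 m g z
  have hleft : X (((X + Y) ^ n) f) x = ∑ k ∈ Finset.range (n + 1),
      (n.choose k : ℝ≥0∞) * (X ^ (k + 1) * Y ^ (n - k)) f x := by
    have e : X (((X + Y) ^ n) f) = ((X + Y) ^ n) (X f) := by
      have : Commute X ((X + Y) ^ n) := ((Commute.refl X).add_right h).pow_right n
      exact DFunLike.congr_fun this.eq f
    rw [e, hXY]
    refine Finset.sum_congr rfl fun k _ => ?_
    have : X ^ (k + 1) * Y ^ (n - k) = X ^ k * Y ^ (n - k) * X := by
      rw [pow_succ, mul_assoc, mul_assoc, (h.pow_right (n - k)).eq]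
    rw [this]; rfl
  rw [hleft, hXY (n + 1), add_smul_pow_apply h, Finset.mul_sum, Finset.mul_sum,
    ← Finset.sum_add_distrib, Finset.sum_range_succ' _ (n + 1)]
  refine le_add_right (Finset.sum_le_sum fun k hk => ?_)
  have hkn : k ≤ n := Nat.lt_succ_iff.1 (Finset.mem_range.1 hk)
  rw [Nat.add_sub_add_right, ← mul_assoc (ENNReal.ofReal s), ← mul_assoc (ENNReal.ofReal (s * γ)),
    ← add_mul]
  refine mul_le_mul_left ?_ _
  rw [← ENNReal.ofReal_pow (Real.exp_pos _).le, ← ENNReal.ofReal_pow (Real.exp_pos _).le,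
    ← ENNReal.ofReal_mul (by positivity), ← ENNReal.ofReal_natCast, ← ENNReal.ofReal_natCast,
    ← ENNReal.ofReal_mul hs, ← ENNReal.ofReal_mul (Nat.cast_nonneg _),
    ← ENNReal.ofReal_mul (mul_nonneg hs hγ),
    ← ENNReal.ofReal_add (by positivity) (by positivity)]
  refine ENNReal.ofReal_le_ofReal ?_
  rw [← Real.exp_nat_mul, ← Real.exp_nat_mul, ← Real.exp_add]
  set E := Real.exp (((k + 1 : ℕ) : ℝ) * (s - s * γ) + ((n - k : ℕ) : ℝ) * -(s * γ))
  have hE : s * (k + 1) - s * γ * (n + 1) ≤ E := by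
    refine le_trans (le_of_eq ?_) ((le_add_of_nonneg_right zero_le_one).trans
      (Real.add_one_le_exp _))
    rw [Nat.cast_sub hkn]; push_cast; ring
  have hE0 : 0 < E := Real.exp_pos _
  have hch : ((n : ℝ) + 1) * n.choose k = (n + 1).choose (k + 1) * (k + 1) := by
    exact_mod_cast Nat.add_one_mul_choose_eq n k
  have hn : (0 : ℝ) < n + 1 := by positivity
  have h1 : s * (k + 1) ≤ (n + 1) * (E + s * γ) := by
    have : 0 ≤ n * E := by positivity
    linarith
  have h2 := mul_le_mul_of_nonneg_left h1 (Nat.cast_nonneg (α := ℝ) ((n + 1).choose (k + 1)))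
  refine le_of_mul_le_mul_left ?_ hn
  have h3 := congrArg (s * ·) hch
  linarith

lemma axisOp_smul (c : ℝ≥0∞) (ν : ℤ → ℝ≥0∞) (i : Fin d) :
    axisOp (fun k => c * ν k) i = c • axisOp ν i := by
  refine LinearMap.ext fun f => funext fun x => ?_
  rw [LinearMap.smul_apply, Pi.smul_apply, smul_eq_mul]
  by_cases hx : x ∈ posAll
  · rw [axisOp_apply_mem _ _ _ hx, axisOp_apply_mem _ _ _ hx, ← ENNReal.tsum_mul_left]
    refine tsum_congr fun k => ?_
    split_ifs
    · rw [mul_assoc]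
    · rw [mul_zero]
  · rw [axisOp_apply_notMem _ _ _ hx, axisOp_apply_notMem _ _ _ hx, mul_zero]

/-- The Green function is concentrated on trajectories which use the `i`-th axis with frequency at
most `γ`, up to the Green function of the tilted walk. -/
lemma axisOp_potential_le (ν : Fin d → ℤ → ℝ≥0∞) (i : Fin d) {s γ : ℝ} (hs : 0 ≤ s) (hγ : 0 ≤ γ)
    (f : (Fin d → ℤ) → ℝ≥0∞) (x : Fin d → ℤ) :
    ENNReal.ofReal s * axisOp (ν i) i (potential ν f) x ≤
      potential (fun j k => ENNReal.ofReal (Real.exp ((if j = i then s else 0) - s * γ)) * ν j k)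
        f x
      + ENNReal.ofReal (s * γ) * potential ν f x := by
  set X := axisOp (ν i) i
  set Y := ∑ j ∈ Finset.univ.erase i, axisOp (ν j) j
  have hXY : Commute X Y := Commute.sum_right _ _ _ fun j hj =>
    axisOp_commute (Finset.ne_of_mem_erase hj).symm _ _
  have hQ : walkOp ν = X + Y := (Finset.add_sum_erase _ _ (Finset.mem_univ i)).symm
  set ν' : Fin d → ℤ → ℝ≥0∞ :=
    fun j k => ENNReal.ofReal (Real.exp ((if j = i then s else 0) - s * γ)) * ν j k
  have hQ' : walkOp ν' = ENNReal.ofReal (Real.exp (s - s * γ)) • X +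
      ENNReal.ofReal (Real.exp (-(s * γ))) • Y := by
    rw [walkOp, ← Finset.add_sum_erase _ _ (Finset.mem_univ i), Finset.smul_sum]
    simp only [ν', axisOp_smul, if_true]
    congr 1
    refine Finset.sum_congr rfl fun j hj => ?_
    rw [if_neg (Finset.ne_of_mem_erase hj), zero_sub]
  have hpot : potential ν f = fun y => ∑' n, (walkOp ν ^ n) f y := rfl
  have h1 : X (potential ν f) x = ∑' n, X ((walkOp ν ^ n) f) x := by
    rw [hpot]; exact axisOp_tsum _ _ _ _
  rw [h1, ← ENNReal.tsum_mul_left]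
  have hsh : ∀ η : Fin d → ℤ → ℝ≥0∞, ∑' n, (walkOp η ^ (n + 1)) f x ≤ potential η f x :=
    fun η => ENNReal.tsum_comp_le_tsum_of_injective (add_left_injective 1)
      (fun n => (walkOp η ^ n) f x)
  calc ∑' n, ENNReal.ofReal s * X ((walkOp ν ^ n) f) x
      ≤ ∑' n, ((walkOp ν' ^ (n + 1)) f x +
          ENNReal.ofReal (s * γ) * (walkOp ν ^ (n + 1)) f x) := by
        refine ENNReal.tsum_le_tsum fun n => ?_
        rw [hQ, hQ']
        exact smul_apply_pow_le hXY hs hγ n f x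
    _ ≤ _ := by
        rw [ENNReal.tsum_add, ENNReal.tsum_mul_left]
        exact add_le_add (hsh ν') (mul_le_mul_right (hsh ν) _)

lemma axisOp_expFn_le {μ : (Fin d → ℤ) → ℝ} (hnn : ∀ z, 0 ≤ μ z) {b : Fin d → ℝ} {i : Fin d}
    (hs : Summable (tiltMass μ b i)) (x : Fin d → ℤ) :
    axisOp (axisMassE μ i) i (expFn b) x ≤ ENNReal.ofReal (tiltTotal μ b i) * expFn b x := by
  by_cases hx : x ∈ posAll
  swap
  · rw [axisOp_apply_notMem _ _ _ hx]; exact zero_le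
  rw [axisOp_apply_mem _ _ _ hx, tiltTotal,
    ENNReal.ofReal_tsum_of_nonneg (tiltMass_nonneg hnn b i) hs, ← ENNReal.tsum_mul_right]
  refine ENNReal.tsum_le_tsum fun k => ?_
  split_ifs
  · rw [expFn, expFn, axisMassE, ← ENNReal.ofReal_mul (axisMass_nonneg hnn i k),
      ← ENNReal.ofReal_mul (tiltMass_nonneg hnn b i k), dotZ_add_right, dotZ_single, Real.exp_add,
      tiltMass]
    refine (congrArg _ ?_).le; ring
  · exact zero_le

lemma potential_single_le {ν : Fin d → ℤ → ℝ≥0∞} {b : Fin d → ℝ} {θ : ℝ} (hθ0 : 0 ≤ θ)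
    (hθ : θ < 1) (h : ∀ x ∈ posAll, walkOp ν (expFn b) x ≤ ENNReal.ofReal θ * expFn b x)
    (y : Fin d → ℤ) {x : Fin d → ℤ} (hx : x ∈ posAll) :
    potential ν (Pi.single y 1) x ≤
      ENNReal.ofReal ((1 - θ)⁻¹ * Real.exp (dotZ b x - dotZ b y)) := by
  have hθ' : 0 < 1 - θ := by linarith
  set c := (1 - θ)⁻¹ * Real.exp (-dotZ b y)
  have hc : 0 ≤ c := by positivity
  have hval : ∀ z, (ENNReal.ofReal c • expFn b) z =
      ENNReal.ofReal ((1 - θ)⁻¹ * Real.exp (dotZ b z - dotZ b y)) := fun z => by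
    rw [Pi.smul_apply, smul_eq_mul, expFn, ← ENNReal.ofReal_mul hc]
    simp only [c]
    rw [mul_assoc, ← Real.exp_add, neg_add_eq_sub]
  rw [← hval]
  refine potential_le ν (fun z hz => ?_) x hx
  rw [map_smul, Pi.smul_apply, smul_eq_mul]
  refine (add_le_add_left (mul_le_mul_right (h z hz) _) _).trans ?_
  rw [mul_left_comm, ← smul_eq_mul (ENNReal.ofReal c), ← Pi.smul_apply, hval,
    ← ENNReal.ofReal_mul hθ0]
  by_cases hzy : z = y
  · subst hzy
    rw [Pi.single_eq_same, sub_self, Real.exp_zero, mul_one, ← ENNReal.ofReal_one,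
      ← ENNReal.ofReal_add (by positivity) zero_le_one]
    refine ENNReal.ofReal_le_ofReal (le_of_eq ?_)
    field_simp; ring
  · rw [Pi.single_eq_of_ne hzy, add_zero]
    refine ENNReal.ofReal_le_ofReal ?_
    exact mul_le_of_le_one_left (by positivity) hθ.le

end Concentration

section GreenAsymptotics

open ENNReal

variable {d : ℕ}

lemma isSuperharmonic_potential (ν : Fin d → ℤ → ℝ≥0∞) (f : (Fin d → ℤ) → ℝ≥0∞) :
    IsSuperharmonic ν (potential ν f) := fun x _ => by
  conv_rhs => rw [← walkOp_potential_add]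
  exact le_add_self

lemma one_le_potential_single (ν : Fin d → ℤ → ℝ≥0∞) (y : Fin d → ℤ) :
    1 ≤ potential ν (Pi.single y 1) y := by
  rw [← walkOp_potential_add, Pi.single_eq_same]
  exact le_self_add

lemma potential_single_pos {μ : (Fin d → ℤ) → ℝ} (hA1 : A1 μ)
    (hax : ∀ z : Fin d → ℤ, (∃ i j : Fin d, i ≠ j ∧ z i ≠ 0 ∧ z j ≠ 0) → μ z = 0)
    {x y : Fin d → ℤ} (hx : x ∈ posAll) (hy : y ∈ posAll) :
    0 < potential (axisMassE μ) (Pi.single y 1) x := by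
  obtain ⟨p, hp0, hp1, hp⟩ := exists_axisHarnack_all hA1 hax
  have h := (isSuperharmonic_potential (axisMassE μ) (Pi.single y 1)).harnack
    (ENNReal.ofReal_le_one.2 hp1) hp hx hy
  refine lt_of_lt_of_le ?_ h
  exact ENNReal.mul_pos (pow_ne_zero _ (ENNReal.ofReal_pos.2 hp0).ne')
    (one_pos.trans_le (one_le_potential_single _ y)).ne'

lemma sum_sq_pos {q : Fin d → ℝ} (hq1 : rnorm q = 1) : 0 < ∑ i, q i ^ 2 := by
  refine (Finset.sum_nonneg fun i _ => sq_nonneg (q i)).lt_of_ne' fun h => ?_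
  have h0 : ∀ i, q i = 0 := fun i => by
    have := (Finset.sum_eq_zero_iff_of_nonneg fun i _ => sq_nonneg (q i)).1 h i (Finset.mem_univ i)
    exact pow_eq_zero_iff (two_ne_zero) |>.1 this
  simp [rnorm, h0] at hq1

lemma le_one_of_rnorm {q : Fin d → ℝ} (hq0 : ∀ i, 0 ≤ q i) (hq1 : rnorm q = 1) (i : Fin d) :
    q i ≤ 1 := by
  rw [← hq1, rnorm, ← abs_of_nonneg (hq0 i)]
  exact Finset.single_le_sum (f := fun i => |q i|) (fun _ _ => abs_nonneg _) (Finset.mem_univ i)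

lemma potential_single_ne_top {μ : (Fin d → ℤ) → ℝ} (hnn : ∀ z, 0 ≤ μ z)
    {a : Fin d → ℝ} {r : ℝ} (hr : 0 < r) (hs : TiltSummable μ a r)
    (hc : ∑ i, tiltTotal μ a i = 1) {l : ℝ} (hl : 0 < l) {q : Fin d → ℝ}
    (hv : ∀ i, tiltMean μ a i = l * q i) (hq0 : ∀ i, 0 ≤ q i) (hq1 : rnorm q = 1)
    (y : Fin d → ℤ) {x : Fin d → ℤ} (hx : x ∈ posAll) :
    potential (axisMassE μ) (Pi.single y 1) x ≠ ⊤ := by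
  obtain ⟨C, hC, hle⟩ := exists_tiltTotal_le hnn hr hs
  obtain ⟨t, ht, htr, htl⟩ : ∃ t : ℝ, 0 < t ∧ t ≤ r / 2 ∧ t * C ≤ l / 2 := by
    refine ⟨min (r / 2) (l / 2 / C), by positivity, min_le_left _ _, ?_⟩
    rw [← le_div_iff₀ hC]
    exact min_le_right _ _
  set h : Fin d → ℝ := fun i => -(t * q i)
  have hh : ∀ i, |h i| ≤ r / 2 := fun i => by
    rw [abs_neg, abs_of_nonneg (mul_nonneg ht.le (hq0 i))]
    exact (mul_le_of_le_one_right ht.le (le_one_of_rnorm hq0 hq1 i)).trans htr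
  have hsum : ∀ i, Summable (tiltMass μ (a + h) i) := fun i =>
    hs.summable_add hnn ((hh i).trans (by linarith))
  set θ := ∑ i, tiltTotal μ (a + h) i
  have hT0 : ∀ i, 0 ≤ tiltTotal μ (a + h) i := fun i =>
    tsum_nonneg fun k => tiltMass_nonneg hnn _ i k
  have hθ : θ < 1 := by
    have h1 : θ ≤ ∑ i, (tiltTotal μ a i + -(t * l / 2) * q i ^ 2) := by
      refine Finset.sum_le_sum fun i _ => (hle h i (hh i)).trans ?_
      rw [hv]
      simp only [h]
      have := mul_le_mul_of_nonneg_right htl (mul_nonneg ht.le (sq_nonneg (q i)))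
      nlinarith
    rw [Finset.sum_add_distrib, hc, ← Finset.mul_sum] at h1
    have := mul_pos (mul_pos ht hl) (sum_sq_pos hq1)
    linarith
  refine ne_top_of_le_ne_top ofReal_ne_top
    (potential_single_le (b := a + h) (Finset.sum_nonneg fun i _ => hT0 i) hθ (fun z _ => ?_) y hx)
  rw [walkOp_apply, ENNReal.ofReal_sum_of_nonneg fun i _ => hT0 i, Finset.sum_mul]
  exact Finset.sum_le_sum fun i _ => axisOp_expFn_le hnn (hsum i) z

lemma exists_exp_tilt_lt_one {c ε : ℝ} (hc0 : 0 ≤ c) (hc1 : c ≤ 1) (hε : 0 < ε) :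
    ∃ s : ℝ, 0 < s ∧ Real.exp (-(s * (c + ε))) * (1 - c + Real.exp s * c) < 1 := by
  obtain ⟨s, hs, hs1, hsε⟩ : ∃ s : ℝ, 0 < s ∧ s ≤ 1 ∧ s ≤ ε / 2 :=
    ⟨min 1 (ε / 2), by positivity, min_le_left _ _, min_le_right _ _⟩
  refine ⟨s, hs, ?_⟩
  have h1 : Real.exp s ≤ 1 + s + s ^ 2 := by
    have := le_abs_self (Real.exp s - 1 - s)
    have := Real.abs_exp_sub_one_sub_id_le (x := s) (by rwa [abs_of_pos hs])
    linarith
  have h2 : 1 - c + Real.exp s * c ≤ Real.exp (c * (s + s ^ 2)) := by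
    have := Real.add_one_le_exp (c * (s + s ^ 2))
    nlinarith
  refine (mul_le_mul_of_nonneg_left h2 (Real.exp_pos _).le).trans_lt ?_
  rw [← Real.exp_add, Real.exp_lt_one_iff]
  have h3 : c * s ^ 2 ≤ s ^ 2 := mul_le_of_le_one_left (sq_nonneg s) hc1
  have h4 := mul_pos hs hε
  nlinarith

/-- In the direction `q`, the Green function is asymptotically an eigenfunction of the jump
operators along each axis. -/
lemma exists_axisOp_green_le {μ : (Fin d → ℤ) → ℝ} (hd : 0 < d) (hnn : ∀ z, 0 ≤ μ z)
    (hsum : HasSum μ 1) (hA1 : A1 μ) (hA2 : A2 μ) (hA3 : A3 μ)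
    (hax : ∀ z : Fin d → ℤ, (∃ i j : Fin d, i ≠ j ∧ z i ≠ 0 ∧ z j ≠ 0) → μ z = 0)
    {q : Fin d → ℝ} (hq0 : ∀ i, 0 ≤ q i) (hq1 : rnorm q = 1) {a : Fin d → ℝ} (ha : a ∈ Dset μ)
    (hmax : ∀ b ∈ Dset μ, dotR b q ≤ dotR a q) {r : ℝ} (hr : 0 < r) (hs : TiltSummable μ a r)
    (hc : ∑ i, tiltTotal μ a i = 1)
    {ι : Type*} {L : Filter ι} {y : ι → Fin d → ℤ} (hy : ∀ n, y n ∈ posAll)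
    (hN : Tendsto (fun n => znorm (y n)) L atTop)
    (hyq : Tendsto (fun n i => (y n i : ℝ) / znorm (y n)) L (𝓝 q))
    (i : Fin d) {ε : ℝ} (hε : 0 < ε) {x x₀ : Fin d → ℤ} (hx : x ∈ posAll) (hx₀ : x₀ ∈ posAll) :
    ∃ E : ι → ℝ≥0∞, Tendsto E L (𝓝 0) ∧ ∀ᶠ n in L,
      axisOp (axisMassE μ i) i (potential (axisMassE μ) (Pi.single (y n) 1)) x ≤
        E n * potential (axisMassE μ) (Pi.single (y n) 1) x₀ +
        ENNReal.ofReal (tiltTotal μ a i + ε) * potential (axisMassE μ) (Pi.single (y n) 1) x := by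
  have hT0 : ∀ (b : Fin d → ℝ) i, 0 ≤ tiltTotal μ b i := fun b i =>
    tsum_nonneg fun k => tiltMass_nonneg hnn _ i k
  have hci : tiltTotal μ a i ≤ 1 := by
    rw [← hc]
    exact Finset.single_le_sum (fun j _ => hT0 a j) (Finset.mem_univ i)
  obtain ⟨s, hs0, hsθ⟩ := exists_exp_tilt_lt_one (hT0 a i) hci hε
  set γ := tiltTotal μ a i + ε
  have hγ : 0 ≤ γ := by have := hT0 a i; simp only [γ]; linarith
  set f : Fin d → ℝ := fun j => Real.exp ((if j = i then s else 0) - s * γ)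
  have hf : ∀ j, 0 ≤ f j := fun j => (Real.exp_pos _).le
  have hf0 : ∑ j, f j * tiltTotal μ a j < 1 := by
    refine lt_of_eq_of_lt ?_ hsθ
    have h1 : ∀ j, f j * tiltTotal μ a j = Real.exp (-(s * γ)) *
        (tiltTotal μ a j + if j = i then (Real.exp s - 1) * tiltTotal μ a i else 0) := by
      intro j
      simp only [f]
      split_ifs with hj
      · subst hj
        rw [sub_eq_neg_add, Real.exp_add]; ring
      · rw [zero_sub, add_zero]
    rw [Finset.sum_congr rfl fun j _ => h1 j, ← Finset.mul_sum, Finset.sum_add_distrib, hc]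
    simp only [Finset.sum_ite_eq', Finset.mem_univ, if_true]
    ring
  obtain ⟨C, hC, hle⟩ := exists_tiltTotal_le hnn hr hs
  set θ₀ := ∑ j, f j * tiltTotal μ a j
  set M := ∑ j, f j * |q j * tiltMean μ a j + C * q j ^ 2|
  have hM : 0 ≤ M := Finset.sum_nonneg fun j _ => mul_nonneg (hf j) (abs_nonneg _)
  have h1θ : 0 < 1 - θ₀ := sub_pos.2 hf0
  obtain ⟨η, hη, hη1, hηr, hηM⟩ : ∃ η : ℝ, 0 < η ∧ η ≤ 1 ∧ η ≤ r / 2 ∧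
      η * (2 * (M + 1)) ≤ 1 - θ₀ := by
    refine ⟨min 1 (min (r / 2) ((1 - θ₀) / (2 * (M + 1)))), by positivity, min_le_left _ _,
      (min_le_right _ _).trans (min_le_left _ _), ?_⟩
    rw [← le_div_iff₀ (by positivity)]
    exact (min_le_right _ _).trans (min_le_right _ _)
  set h : Fin d → ℝ := fun j => η * q j
  have hh : ∀ j, |h j| ≤ r / 2 := fun j => by
    rw [abs_of_nonneg (mul_nonneg hη.le (hq0 j))]
    exact (mul_le_of_le_one_right hη.le (le_one_of_rnorm hq0 hq1 j)).trans hηr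
  set θ := ∑ j, f j * tiltTotal μ (a + h) j
  have hθ0 : 0 ≤ θ := Finset.sum_nonneg fun j _ => mul_nonneg (hf j) (hT0 _ j)
  have hθ1 : θ < 1 := by
    have h1 : θ ≤ ∑ j, (f j * tiltTotal μ a j +
        η * (f j * |q j * tiltMean μ a j + C * q j ^ 2|)) := by
      refine Finset.sum_le_sum fun j _ => ?_
      have h2 : tiltTotal μ (a + h) j ≤ tiltTotal μ a j +
          η * |q j * tiltMean μ a j + C * q j ^ 2| := by
        refine (hle h j (hh j)).trans ?_
        have h3 := mul_le_mul_of_nonneg_left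
          (le_abs_self (q j * tiltMean μ a j + C * q j ^ 2)) hη.le
        have h4 : η ^ 2 ≤ η := by nlinarith
        have h5 := mul_le_mul_of_nonneg_right h4 (mul_nonneg hC.le (sq_nonneg (q j)))
        simp only [h]
        linarith
      have := mul_le_mul_of_nonneg_left h2 (hf j)
      linarith
    rw [Finset.sum_add_distrib, ← Finset.mul_sum] at h1
    have : 0 ≤ η * M := by positivity
    linarith
  have hG' : ∀ n, potential (fun j k => ENNReal.ofReal (f j) * axisMassE μ j k)
      (Pi.single (y n) 1) x ≤ ENNReal.ofReal
        ((1 - θ)⁻¹ * Real.exp (dotZ (a + h) x - dotZ (a + h) (y n))) := by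
    intro n
    refine potential_single_le hθ0 hθ1 (fun z _ => ?_) (y n) hx
    rw [walkOp_apply, ENNReal.ofReal_sum_of_nonneg fun j _ => mul_nonneg (hf j) (hT0 _ j),
      Finset.sum_mul]
    refine Finset.sum_le_sum fun j _ => ?_
    rw [axisOp_smul, LinearMap.smul_apply, Pi.smul_apply, smul_eq_mul, ENNReal.ofReal_mul (hf j),
      mul_assoc]
    refine mul_le_mul_right (axisOp_expFn_le hnn (hs.summable_add hnn ?_) z) _
    exact (hh j).trans (by linarith)
  set σ := ∑ j, q j ^ 2
  have hσ : 0 < σ := sum_sq_pos hq1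
  obtain ⟨C₁, R, δ, hδ, hC₁, hgr⟩ := IsSuperharmonic.exists_growth hd hnn hsum hA1 hA2 hA3 hax hq0
    hq1 ha hmax (ε := η * σ / 4) (by positivity) hx₀
  have h1θ' : 0 < 1 - θ := sub_pos.2 hθ1
  set K := (1 - θ)⁻¹ * Real.exp (dotZ (a + h) x) * C₁
  have hK : 0 ≤ K := by positivity
  refine ⟨fun n => ENNReal.ofReal (s⁻¹ * (K * Real.exp (-(η * σ / 4 * znorm (y n))))), ?_, ?_⟩
  · have h1 : Tendsto (fun n => Real.exp (-(η * σ / 4 * znorm (y n)))) L (𝓝 0) :=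
      Real.tendsto_exp_neg_atTop_nhds_zero.comp
        (hN.const_mul_atTop (by positivity : 0 < η * σ / 4))
    have h2 := ENNReal.tendsto_ofReal ((h1.const_mul K).const_mul s⁻¹)
    simpa using h2
  have hclose : ∀ᶠ n in L, ∀ j, |(y n j : ℝ) / znorm (y n) - q j| < min δ (σ / 2) := by
    refine eventually_all.2 fun j => ?_
    have h1 := ((tendsto_pi_nhds.1 hyq j).sub_const (q j)).abs
    rw [sub_self, abs_zero] at h1
    exact h1.eventually_lt_const (by positivity)
  filter_upwards [hclose, hN.eventually_ge_atTop R, hN.eventually_gt_atTop 0] with n hn hRn hN0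
  set N := znorm (y n)
  set G := potential (axisMassE μ) (Pi.single (y n) 1)
  have hclose' : ∀ j, |(y n j : ℝ) - N * q j| ≤ min δ (σ / 2) * N := fun j => by
    have h1 : (y n j : ℝ) - N * q j = ((y n j : ℝ) / N - q j) * N := by field_simp
    rw [h1, abs_mul, abs_of_pos hN0]
    exact mul_le_mul_of_nonneg_right (hn j).le hN0.le
  have hG1 : 1 ≤ ENNReal.ofReal (C₁ * Real.exp (dotZ a (y n) + η * σ / 4 * N)) * G x₀ :=
    (one_le_potential_single _ _).trans (hgr G (isSuperharmonic_potential _ _) (y n) (hy n) hRn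
      fun j => (hclose' j).trans (mul_le_mul_of_nonneg_right (min_le_left _ _) hN0.le))
  have hqy : σ / 2 * N ≤ ∑ j, q j * (y n j : ℝ) := by
    have h1 : ∀ j, N * q j ^ 2 - σ / 2 * N * |q j| ≤ q j * (y n j : ℝ) := fun j => by
      have h2 := (abs_le.1 ((hclose' j).trans
        (mul_le_mul_of_nonneg_right (min_le_right _ _) hN0.le))).1
      have h3 := mul_le_mul_of_nonneg_left h2 (hq0 j)
      rw [abs_of_nonneg (hq0 j)]
      nlinarith
    have h2 := Finset.sum_le_sum fun j (_ : j ∈ Finset.univ) => h1 j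
    have h3 : ∑ j, |q j| = 1 := hq1
    rw [Finset.sum_sub_distrib, ← Finset.mul_sum, ← Finset.mul_sum, h3] at h2
    linarith
  have hkey : potential (fun j k => ENNReal.ofReal (f j) * axisMassE μ j k)
      (Pi.single (y n) 1) x ≤
      ENNReal.ofReal (K * Real.exp (-(η * σ / 4 * N))) * G x₀ := by
    refine (hG' n).trans ?_
    refine (mul_le_mul_right hG1 _).trans' (mul_one _).ge |>.trans ?_
    rw [← mul_assoc, ← ENNReal.ofReal_mul (by positivity)]
    refine mul_le_mul_left (ENNReal.ofReal_le_ofReal ?_) _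
    have h1 : dotZ (a + h) (y n) = dotZ a (y n) + η * ∑ j, q j * (y n j : ℝ) := by
      simp only [dotZ, h, Pi.add_apply, add_mul, Finset.sum_add_distrib, Finset.mul_sum, mul_assoc]
    have h2 := mul_le_mul_of_nonneg_left hqy hη.le
    calc (1 - θ)⁻¹ * Real.exp (dotZ (a + h) x - dotZ (a + h) (y n)) *
          (C₁ * Real.exp (dotZ a (y n) + η * σ / 4 * N))
        = (1 - θ)⁻¹ * C₁ * Real.exp (dotZ (a + h) x - dotZ (a + h) (y n) +
            (dotZ a (y n) + η * σ / 4 * N)) := by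
          rw [Real.exp_add (dotZ (a + h) x - dotZ (a + h) (y n))]; ring
      _ ≤ (1 - θ)⁻¹ * C₁ * Real.exp (dotZ (a + h) x + -(η * σ / 4 * N)) := by
          refine mul_le_mul_of_nonneg_left (Real.exp_le_exp.2 ?_) (by positivity)
          rw [h1]
          linarith
      _ = _ := by rw [Real.exp_add]; simp only [K]; ring
  have hmain := (axisOp_potential_le (axisMassE μ) i hs0.le hγ (Pi.single (y n) 1) x).trans
    (add_le_add_left hkey _)
  have h3 := mul_le_mul_right hmain (ENNReal.ofReal s⁻¹)
  rw [← mul_assoc, ← ENNReal.ofReal_mul (by positivity), inv_mul_cancel₀ hs0.ne',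
    ENNReal.ofReal_one, one_mul, mul_add, ← mul_assoc, ← mul_assoc,
    ← ENNReal.ofReal_mul (by positivity), ← ENNReal.ofReal_mul (by positivity),
    inv_mul_cancel_left₀ hs0.ne'] at h3
  exact h3

end GreenAsymptotics

section LineUniqueness

open ENNReal

variable {d : ℕ}

lemma update_mem_posAll {x : Fin d → ℤ} (hx : x ∈ posAll) (i : Fin d) {t : ℤ} (ht : 0 < t) :
    Function.update x i t ∈ posAll := fun j => by
  by_cases h : j = i
  · subst h; simpa using ht
  · simpa [h] using hx j

lemma update_add_single (x : Fin d → ℤ) (i : Fin d) (t k : ℤ) :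
    Function.update x i t + Pi.single i k = Function.update x i (t + k) := by
  ext j
  by_cases h : j = i
  · subst h; simp
  · simp [h]

lemma dotZ_update (a : Fin d → ℝ) (x : Fin d → ℤ) (i : Fin d) (t : ℤ) :
    dotZ a (Function.update x i t) = a i * t + ∑ j ∈ Finset.univ.erase i, a j * (x j : ℝ) := by
  unfold dotZ
  rw [← Finset.add_sum_erase _ _ (Finset.mem_univ i), Function.update_self]
  congr 1
  refine Finset.sum_congr rfl fun j hj => ?_
  rw [Function.update_of_ne (Finset.ne_of_mem_erase hj)]

lemma prod_update (g : Fin d → ℤ → ℝ) (x : Fin d → ℤ) (i : Fin d) (t : ℤ) :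
    ∏ j, g j (Function.update x i t j) = g i t * ∏ j ∈ Finset.univ.erase i, g j (x j) := by
  rw [← Finset.mul_prod_erase _ _ (Finset.mem_univ i), Function.update_self]
  congr 1
  refine Finset.prod_congr rfl fun j hj => ?_
  rw [Function.update_of_ne (Finset.ne_of_mem_erase hj)]

/-- The restriction of `φ` to the line through `x` in direction `i`, tilted by `a`. -/
noncomputable def tiltLine (a : Fin d → ℝ) (i : Fin d) (x : Fin d → ℤ)
    (φ : (Fin d → ℤ) → ℝ≥0∞) (t : ℤ) : ℝ :=
  Real.exp (-(a i * t)) * (φ (Function.update x i t)).toReal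

lemma tiltLine_nonneg (a : Fin d → ℝ) (i : Fin d) (x : Fin d → ℤ) (φ : (Fin d → ℤ) → ℝ≥0∞)
    (t : ℤ) : 0 ≤ tiltLine a i x φ t := mul_nonneg (Real.exp_pos _).le toReal_nonneg

lemma tiltLine_harmonic {μ : (Fin d → ℤ) → ℝ} (hnn : ∀ z, 0 ≤ μ z) {a : Fin d → ℝ} {i : Fin d}
    {x : Fin d → ℤ} (hx : x ∈ posAll) {φ : (Fin d → ℤ) → ℝ≥0∞} (hφ : ∀ z ∈ posAll, φ z ≠ ⊤)
    (h : ∀ z ∈ posAll, axisOp (axisMassE μ i) i φ z = ENNReal.ofReal (tiltTotal μ a i) * φ z)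
    {t : ℤ} (ht : 0 < t) :
    Summable (halfOp (tiltMass μ a i) (tiltLine a i x φ) t) ∧
      ∑' k, halfOp (tiltMass μ a i) (tiltLine a i x φ) t k =
        (∑' k, tiltMass μ a i k) * tiltLine a i x φ t := by
  have hmem := update_mem_posAll hx i ht
  have h1 := h _ hmem
  rw [axisOp_apply_mem _ _ _ hmem] at h1
  simp only [Function.update_self, update_add_single] at h1
  have hfin : ∑' k, (if 0 < t + k then axisMassE μ i k * φ (Function.update x i (t + k)) else 0)
      ≠ ⊤ := by
    rw [h1]
    exact ENNReal.mul_ne_top ENNReal.ofReal_ne_top (hφ _ hmem)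
  have hsum := (ENNReal.hasSum_toReal hfin).mul_left (Real.exp (-(a i * t)))
  have hT0 : 0 ≤ tiltTotal μ a i := tsum_nonneg fun k => tiltMass_nonneg hnn _ i k
  have hterm : ∀ k, Real.exp (-(a i * t)) *
      (if 0 < t + k then axisMassE μ i k * φ (Function.update x i (t + k)) else 0).toReal =
      halfOp (tiltMass μ a i) (tiltLine a i x φ) t k := fun k => by
    unfold halfOp
    split_ifs with hk
    · rw [ENNReal.toReal_mul, axisMassE, ENNReal.toReal_ofReal (axisMass_nonneg hnn i k), tiltMass,
        tiltLine]
      have : Real.exp (-(a i * t)) = Real.exp (a i * k) * Real.exp (-(a i * (t + k : ℤ))) := by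
        rw [← Real.exp_add]; push_cast; ring_nf
      rw [this]; ring
    · simp
  simp only [hterm] at hsum
  rw [← ENNReal.tsum_toReal_eq fun k => ENNReal.ne_top_of_tsum_ne_top hfin k, h1,
    ENNReal.toReal_mul, ENNReal.toReal_ofReal hT0] at hsum
  refine ⟨hsum.summable, hsum.tsum_eq.trans ?_⟩
  rw [tiltLine, ← tiltTotal]; ring

lemma tilted_harnack {μ : (Fin d → ℤ) → ℝ} (hnn : ∀ z, 0 ≤ μ z) {a : Fin d → ℝ} {i : Fin d}
    (hT : tiltTotal μ a i ≤ 1) {p : ℝ} (hp : 0 < p)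
    (hH : AxisHarnack (axisMassE μ i) (ENNReal.ofReal p)) (u : ℤ → ℝ)
    (hu : ∀ x, 0 < x → 0 ≤ u x)
    (hs : ∀ x, 0 < x → Summable (halfOp (tiltMass μ a i) u x) ∧
      ∑' k, halfOp (tiltMass μ a i) u x k ≤ (∑' k, tiltMass μ a i k) * u x) {x : ℤ} (hx : 0 < x) :
    p * Real.exp (-|a i|) * u (x + 1) ≤ u x ∧ p * Real.exp (-|a i|) * u x ≤ u (x + 1) := by
  have key := hH (fun t => ENNReal.ofReal (Real.exp (a i * t) * u t)) (fun x hx => by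
    have hterm : ∀ k, (if 0 < x + k then axisMassE μ i k *
        ENNReal.ofReal (Real.exp (a i * (x + k : ℤ)) * u (x + k)) else 0) =
        ENNReal.ofReal (Real.exp (a i * x) * halfOp (tiltMass μ a i) u x k) := fun k => by
      unfold halfOp
      split_ifs with hk
      · rw [axisMassE, ← ENNReal.ofReal_mul (axisMass_nonneg hnn i k), tiltMass]
        congr 1
        push_cast
        rw [mul_add, Real.exp_add]; ring
      · simp
    simp only [hterm]
    rw [← ENNReal.ofReal_tsum_of_nonneg
      (fun k => mul_nonneg (Real.exp_pos _).le
        (halfOp_nonneg (tiltMass_nonneg hnn a i) hu x k)) ((hs x hx).1.mul_left _), tsum_mul_left]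
    refine ENNReal.ofReal_le_ofReal (mul_le_mul_of_nonneg_left ?_ (Real.exp_pos _).le)
    exact (hs x hx).2.trans (mul_le_of_le_one_left (hu x hx) hT)) x hx
  have hx1 : 0 < x + 1 := by omega
  rw [← ENNReal.ofReal_mul hp.le, ← ENNReal.ofReal_mul hp.le,
    ENNReal.ofReal_le_ofReal_iff (mul_nonneg (Real.exp_pos _).le (hu x hx)),
    ENNReal.ofReal_le_ofReal_iff (mul_nonneg (Real.exp_pos _).le (hu _ hx1))] at key
  obtain ⟨k1, k2⟩ := key
  have e1 : Real.exp (a i * (x + 1 : ℤ)) = Real.exp (a i * x) * Real.exp (a i) := by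
    rw [← Real.exp_add]; push_cast; ring_nf
  rw [e1] at k1 k2
  have hE := Real.exp_pos (a i * x)
  have k1' : p * Real.exp (a i) * u (x + 1) ≤ u x := by
    refine le_of_mul_le_mul_left ?_ hE
    linarith
  have k2' : p * u x ≤ Real.exp (a i) * u (x + 1) := by
    refine le_of_mul_le_mul_left ?_ hE
    linarith
  constructor
  · refine le_trans ?_ k1'
    refine mul_le_mul_of_nonneg_right ?_ (hu _ hx1)
    exact mul_le_mul_of_nonneg_left (Real.exp_le_exp.2 (neg_abs_le _)) hp.le
  · have : Real.exp (-(a i)) * (p * u x) ≤ u (x + 1) := by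
      refine (mul_le_mul_of_nonneg_left k2' (Real.exp_pos _).le).trans (le_of_eq ?_)
      rw [← mul_assoc, ← Real.exp_add]; simp
    refine le_trans ?_ this
    rw [mul_comm p, mul_assoc]
    refine mul_le_mul_of_nonneg_right (Real.exp_le_exp.2 (neg_le_neg (le_abs_self _))) ?_
    exact mul_nonneg hp.le (hu x hx)

/-- A positive eigenfunction of the jump operator along one axis is determined on each line up to a
constant. -/
lemma line_ratio_const {μ : (Fin d → ℤ) → ℝ} (hnn : ∀ z, 0 ≤ μ z) (hA1 : A1 μ)
    (hax : ∀ z : Fin d → ℤ, (∃ i j : Fin d, i ≠ j ∧ z i ≠ 0 ∧ z j ≠ 0) → μ z = 0)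
    {a : Fin d → ℝ} {r : ℝ} (hr : 0 < r) (hs : TiltSummable μ a r) {i : Fin d}
    (hT : tiltTotal μ a i ≤ 1) (hv : 0 ≤ tiltMean μ a i) {w : Fin d → ℤ → ℝ} {C : ℝ} (hC : 0 < C)
    (hw : ∀ j, SubBarrier (tiltMass μ a j) (w j)) {h H : (Fin d → ℤ) → ℝ≥0∞}
    (hh : ∀ z ∈ posAll, h z ≠ ⊤) (hHt : ∀ z ∈ posAll, H z ≠ ⊤)
    (hHb : ∀ z ∈ posAll, prodFn a w z ≤ H z ∧ H z ≤ prodFn a (fun i t => C * w i t) z)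
    (hhe : ∀ z ∈ posAll, axisOp (axisMassE μ i) i h z = ENNReal.ofReal (tiltTotal μ a i) * h z)
    (hHe : ∀ z ∈ posAll, axisOp (axisMassE μ i) i H z = ENNReal.ofReal (tiltTotal μ a i) * H z)
    {x : Fin d → ℤ} (hx : x ∈ posAll) {s t : ℤ} (hs0 : 0 < s) (ht0 : 0 < t) :
    (h (Function.update x i s)).toReal * (H (Function.update x i t)).toReal =
      (h (Function.update x i t)).toReal * (H (Function.update x i s)).toReal := by
  obtain ⟨p, hp0, hp1, hp⟩ := exists_axisHarnack_all hA1 hax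
  obtain ⟨j, hj, hmj⟩ := (exists_pos_jump hA1 hax i).1
  set S := ∑ j ∈ Finset.univ.erase i, a j * (x j : ℝ)
  have hline : ∀ (g : Fin d → ℤ → ℝ) (t : ℤ), 0 < t → (∀ j t, 0 < t → 0 < g j t) →
      Real.exp (-(a i * t)) * (prodFn a g (Function.update x i t)).toReal =
        Real.exp S * (∏ j ∈ Finset.univ.erase i, g j (x j)) * g i t := fun g t ht hg => by
    rw [prodFn, if_pos (update_mem_posAll hx i ht), prod_update, dotZ_update, ENNReal.toReal_ofReal,
      Real.exp_add, Real.exp_neg]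
    · have := (Real.exp_pos (a i * t)).ne'
      field_simp
      simp only [S]
      ring
    · exact mul_nonneg (Real.exp_pos _).le (mul_nonneg (hg i t ht).le
        (Finset.prod_nonneg fun j _ => (hg j _ (hx j)).le))
  have hwp : ∀ j t, 0 < t → 0 < w j t := fun j t ht => (hw j).pos t ht
  have hCw : ∀ j t, 0 < t → 0 < C * w j t := fun j t ht => mul_pos hC (hwp j t ht)
  have key := harmonic_ratio_const (f := tiltLine a i x h) (V := tiltLine a i x H)
    (κ₁ := Real.exp S * (∏ j ∈ Finset.univ.erase i, w j (x j)))
    (κ₂ := Real.exp S * (∏ j ∈ Finset.univ.erase i, C * w j (x j)) * C)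
    (p := p * Real.exp (-|a i|))
    (tiltMass_nonneg hnn a i) hr (hs i) (hw i) hv hj
    (mul_pos hmj (Real.exp_pos _)) (mul_pos hp0 (Real.exp_pos _))
    (mul_le_one₀ hp1 (Real.exp_pos _).le (Real.exp_le_one_iff.2 (neg_nonpos.2 (abs_nonneg _))))
    (fun u hu hs x hx => tilted_harnack hnn hT hp0 (hp i) u hu hs hx)
    (mul_pos (Real.exp_pos _) (Finset.prod_pos fun j _ => hwp j _ (hx j)))
    (mul_pos (mul_pos (Real.exp_pos _) (Finset.prod_pos fun j _ => hCw j _ (hx j))) hC)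
    (fun t ht => by
      rw [← hline w t ht hwp]
      have hm := update_mem_posAll hx i ht
      exact mul_le_mul_of_nonneg_left (ENNReal.toReal_mono (hHt _ hm) (hHb _ hm).1)
        (Real.exp_pos _).le)
    (fun t ht => by
      rw [mul_assoc, ← hline (fun j t => C * w j t) t ht hCw]
      have hm := update_mem_posAll hx i ht
      exact mul_le_mul_of_nonneg_left (ENNReal.toReal_mono (prodFn_ne_top _ _ _) (hHb _ hm).2)
        (Real.exp_pos _).le)
    (fun t _ => tiltLine_nonneg _ _ _ _ _)
    (fun t ht => tiltLine_harmonic hnn hx hh hhe ht)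
    (fun t ht => tiltLine_harmonic hnn hx hHt hHe ht) s t hs0 ht0
  simp only [tiltLine] at key
  refine mul_left_cancel₀ (mul_pos (Real.exp_pos (-(a i * s))) (Real.exp_pos (-(a i * t)))).ne' ?_
  linear_combination key

lemma eq_of_update_eq {β : Type*} {ρ : (Fin d → ℤ) → β}
    (h : ∀ i, ∀ x ∈ posAll, ∀ t, 0 < t → ρ (Function.update x i t) = ρ x)
    {x y : Fin d → ℤ} (hx : x ∈ posAll) (hy : y ∈ posAll) : ρ y = ρ x := by
  have key : ∀ s : Finset (Fin d), s.piecewise y x ∈ posAll ∧ ρ (s.piecewise y x) = ρ x := by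
    intro s
    induction s using Finset.induction_on with
    | empty => simpa using hx
    | insert j s _ ih =>
      rw [Finset.piecewise_insert]
      exact ⟨update_mem_posAll ih.1 j (hy j), (h j _ ih.1 _ (hy j)).trans ih.2⟩
  simpa using (key Finset.univ).2

end LineUniqueness

section MartinLimit

open ENNReal

variable {d : ℕ}

lemma IsSuperharmonic.smul {ν : Fin d → ℤ → ℝ≥0∞} {u : (Fin d → ℤ) → ℝ≥0∞}
    (hu : IsSuperharmonic ν u) (c : ℝ≥0∞) : IsSuperharmonic ν (c • u) := fun x hx => by
  rw [map_smul]
  exact mul_le_mul_right (hu x hx) c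

lemma eq_of_sum_eq_of_le {ι : Type*} {s : Finset ι} {f g : ι → ℝ≥0∞} (h : ∀ i ∈ s, f i ≤ g i)
    (hg : ∀ i ∈ s, g i ≠ ⊤) (hsum : ∑ i ∈ s, f i = ∑ i ∈ s, g i) : ∀ i ∈ s, f i = g i := by
  have hf : ∀ i ∈ s, f i ≠ ⊤ := fun i hi => ne_top_of_le_ne_top (hg i hi) (h i hi)
  have hs := congrArg ENNReal.toReal hsum
  rw [ENNReal.toReal_sum hf, ENNReal.toReal_sum hg] at hs
  have := (Finset.sum_eq_sum_iff_of_le fun i hi => ENNReal.toReal_mono (hg i hi) (h i hi)).1 hs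
  exact fun i hi => (ENNReal.toReal_eq_toReal_iff' (hf i hi) (hg i hi)).1 (this i hi)

/-- Every limit of the Martin kernels in direction `q` is a common eigenfunction of the jump
operators along the axes. -/
lemma exists_martin_limit {μ : (Fin d → ℤ) → ℝ} (hd : 0 < d) (hnn : ∀ z, 0 ≤ μ z)
    (hsum : HasSum μ 1) (hA1 : A1 μ) (hA2 : A2 μ) (hA3 : A3 μ)
    (hax : ∀ z : Fin d → ℤ, (∃ i j : Fin d, i ≠ j ∧ z i ≠ 0 ∧ z j ≠ 0) → μ z = 0)
    {q : Fin d → ℝ} (hq0 : ∀ i, 0 ≤ q i) (hq1 : rnorm q = 1) {a : Fin d → ℝ} (ha : a ∈ Dset μ)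
    (hmax : ∀ b ∈ Dset μ, dotR b q ≤ dotR a q) {r : ℝ} (hr : 0 < r) (hs : TiltSummable μ a r)
    (hc : ∑ i, tiltTotal μ a i = 1)
    (hfin : ∀ y : Fin d → ℤ, ∀ x ∈ posAll, potential (axisMassE μ) (Pi.single y 1) x ≠ ⊤)
    {ι : Type*} {U : Ultrafilter ι} {y : ι → Fin d → ℤ} (hy : ∀ n, y n ∈ posAll)
    (hN : Tendsto (fun n => znorm (y n)) U atTop)
    (hyq : Tendsto (fun n i => (y n i : ℝ) / znorm (y n)) U (𝓝 q))
    {x₀ : Fin d → ℤ} (hx₀ : x₀ ∈ posAll) :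
    ∃ h : (Fin d → ℤ) → ℝ≥0∞, h x₀ = 1 ∧ (∀ x ∈ posAll, h x ≠ ⊤) ∧
      (∀ x, Tendsto (fun n => (potential (axisMassE μ) (Pi.single (y n) 1) x₀)⁻¹ *
        potential (axisMassE μ) (Pi.single (y n) 1) x) U (𝓝 (h x))) ∧
      ∀ i, ∀ x ∈ posAll,
        axisOp (axisMassE μ i) i h x = ENNReal.ofReal (tiltTotal μ a i) * h x := by
  set G : ι → (Fin d → ℤ) → ℝ≥0∞ := fun n => potential (axisMassE μ) (Pi.single (y n) 1)
  set K : ι → (Fin d → ℤ) → ℝ≥0∞ := fun n => (G n x₀)⁻¹ • G n with hK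
  have hG0 : ∀ n, G n x₀ ≠ 0 := fun n => (potential_single_pos hA1 hax hx₀ (hy n)).ne'
  have hGt : ∀ n, G n x₀ ≠ ⊤ := fun n => hfin _ _ hx₀
  have hKx₀ : ∀ n, K n x₀ = 1 := fun n => ENNReal.inv_mul_cancel (hG0 n) (hGt n)
  have hKs : ∀ n, IsSuperharmonic (axisMassE μ) (K n) := fun n =>
    (isSuperharmonic_potential _ _).smul _
  obtain ⟨p, hp0, hp1, hp⟩ := exists_axisHarnack_all hA1 hax
  have hpE : ENNReal.ofReal p ≠ 0 := (ENNReal.ofReal_pos.2 hp0).ne'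
  set B : (Fin d → ℤ) → ℝ≥0∞ := fun x => (ENNReal.ofReal p ^ zdist x₀ x)⁻¹
  have hBt : ∀ x, B x ≠ ⊤ := fun x => ENNReal.inv_ne_top.2 (pow_ne_zero _ hpE)
  have hKB : ∀ x ∈ posAll, ∀ n, K n x ≤ B x := fun x hx n => by
    have := (hKs n).harnack (ENNReal.ofReal_le_one.2 hp1) hp hx₀ hx
    rw [hKx₀] at this
    rw [ENNReal.le_inv_iff_mul_le, mul_comm]
    exact this
  have hlim : ∀ x, ∃ c, Tendsto (fun n => K n x) U (𝓝 c) := fun x =>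
    ⟨_, (U.map fun n => K n x).le_nhds_lim⟩
  choose h hh using hlim
  have hht : ∀ x ∈ posAll, h x ≠ ⊤ := fun x hx =>
    ne_top_of_le_ne_top (hBt x) (le_of_tendsto (hh x) (Eventually.of_forall (hKB x hx)))
  have hQ : ∀ i, ∀ x ∈ posAll, Tendsto (fun n => axisOp (axisMassE μ i) i (K n) x) U
      (𝓝 (axisOp (axisMassE μ i) i h x)) := fun i x hx => by
    obtain ⟨D, hDt, hD⟩ := exists_axis_domination hd hnn hsum hA1 hA2 hA3 hax i hx
    refine tendsto_axisOp _ (fun k => ENNReal.ofReal_ne_top) i (D := B x • D) ?_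
      (fun z _ => hh z) (Eventually.of_forall fun n k hk => ?_)
    · rw [map_smul]
      exact ENNReal.mul_ne_top (hBt x) hDt
    · refine (hD _ (hKs n) k hk).trans ?_
      rw [mul_comm]
      exact mul_le_mul_left (hKB x hx n) _
  have hT0 : ∀ i, 0 ≤ tiltTotal μ a i := fun i =>
    tsum_nonneg fun k => tiltMass_nonneg hnn _ i k
  have hle : ∀ i, ∀ x ∈ posAll,
      axisOp (axisMassE μ i) i h x ≤ ENNReal.ofReal (tiltTotal μ a i) * h x := fun i x hx => by
    have hε : ∀ ε : ℝ, 0 < ε →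
        axisOp (axisMassE μ i) i h x ≤ ENNReal.ofReal (tiltTotal μ a i + ε) * h x := fun ε hε => by
      obtain ⟨E, hE, hle⟩ := exists_axisOp_green_le hd hnn hsum hA1 hA2 hA3 hax hq0 hq1 ha hmax hr
        hs hc hy hN hyq i hε hx hx₀
      have hlim : Tendsto (fun n => E n + ENNReal.ofReal (tiltTotal μ a i + ε) * K n x) U
          (𝓝 (0 + ENNReal.ofReal (tiltTotal μ a i + ε) * h x)) :=
        hE.add (ENNReal.Tendsto.const_mul (hh x) (Or.inr ENNReal.ofReal_ne_top))
      rw [zero_add] at hlim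
      refine le_of_tendsto_of_tendsto (hQ i x hx) hlim (hle.mono fun n hn => ?_)
      have h1 := mul_le_mul_right hn (G n x₀)⁻¹
      simp only [hK, map_smul, Pi.smul_apply, smul_eq_mul]
      refine h1.trans (le_of_eq ?_)
      rw [mul_add, mul_left_comm, ENNReal.inv_mul_cancel (hG0 n) (hGt n), mul_one,
        mul_left_comm]
    have hlim : Tendsto (fun ε : ℝ => ENNReal.ofReal (tiltTotal μ a i + ε) * h x) (𝓝[>] 0)
        (𝓝 (ENNReal.ofReal (tiltTotal μ a i + 0) * h x)) := by
      refine ENNReal.Tendsto.mul_const ?_ (Or.inr (hht x hx))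
      exact ENNReal.tendsto_ofReal ((tendsto_const_nhds.add tendsto_id).mono_left
        nhdsWithin_le_nhds)
    rw [add_zero] at hlim
    exact ge_of_tendsto hlim (eventually_nhdsWithin_of_forall hε)
  have hsumh : ∀ x ∈ posAll, ∑ i, axisOp (axisMassE μ i) i h x = h x := fun x hx => by
    have h1 : Tendsto (fun n => ∑ i, axisOp (axisMassE μ i) i (K n) x) U
        (𝓝 (∑ i, axisOp (axisMassE μ i) i h x)) :=
      tendsto_finsetSum _ fun i _ => hQ i x hx
    refine tendsto_nhds_unique (h1.congr' ?_) (hh x)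
    filter_upwards [hN.eventually_gt_atTop (znorm x)] with n hn
    have hne : x ≠ y n := fun e => by rw [e] at hn; exact lt_irrefl _ hn
    have h2 := walkOp_potential_add (axisMassE μ) (Pi.single (y n) 1) x
    rw [Pi.single_eq_of_ne hne, zero_add] at h2
    rw [← walkOp_apply]
    simp only [hK, map_smul, Pi.smul_apply, smul_eq_mul]
    rw [h2]
  refine ⟨h, ?_, hht, hh, fun i x hx => ?_⟩
  · exact tendsto_nhds_unique (hh x₀) (by simp only [hKx₀]; exact tendsto_const_nhds)
  · refine eq_of_sum_eq_of_le (s := Finset.univ) (fun j _ => hle j x hx)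
      (fun j _ => ENNReal.mul_ne_top ENNReal.ofReal_ne_top (hht x hx)) ?_ i (Finset.mem_univ i)
    rw [hsumh x hx, ← Finset.sum_mul, ← ENNReal.ofReal_sum_of_nonneg fun i _ => hT0 i, hc,
      ENNReal.ofReal_one, one_mul]

lemma harmOn_toReal {μ : (Fin d → ℤ) → ℝ} (hd : 0 < d) (hnn : ∀ z, 0 ≤ μ z)
    (hax : ∀ z : Fin d → ℤ, (∃ i j : Fin d, i ≠ j ∧ z i ≠ 0 ∧ z j ≠ 0) → μ z = 0)
    {H : (Fin d → ℤ) → ℝ≥0∞} {g : (Fin d → ℤ) → ℝ} (hHt : ∀ x ∈ posAll, H x ≠ ⊤)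
    (hg : ∀ x ∈ posAll, g x = (H x).toReal)
    (hH : ∀ x ∈ posAll, walkOp (axisMassE μ) H x = H x) : HarmOn μ posAll g := fun x hx => by
  rw [hg x hx, ← hH x hx, walkOp_axisMassE hd hax, ENNReal.tsum_toReal_eq]
  · refine tsum_congr fun z => ?_
    by_cases hz : z ∈ posAll
    · simp [hx, hz, hg z hz, ENNReal.toReal_mul, ENNReal.toReal_ofReal (hnn _)]
    · simp [hz]
  · intro z
    split_ifs with h
    · exact ENNReal.mul_ne_top ENNReal.ofReal_ne_top (hHt z h.2)
    · exact ENNReal.zero_ne_top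

end MartinLimit

theorem statement6 {d : ℕ} (μ : (Fin d → ℤ) → ℝ)
    (hnn : ∀ z, 0 ≤ μ z) (hsum : HasSum μ 1)
    (hA1 : A1 μ) (hA2 : A2 μ) (hA3 : A3 μ)
    (hA4' : ∀ z : Fin d → ℤ, (∃ i j : Fin d, i ≠ j ∧ z i ≠ 0 ∧ z j ≠ 0) → μ z = 0)
    (q : Fin d → ℝ) (hq1 : rnorm q = 1) (hq2 : ∀ i, 0 ≤ q i)
    -- `a(q)` : the (unique) maximizer over `D` of `a ↦ a·q`
    (aq : Fin d → ℝ) (haqD : aq ∈ Dset μ) (haqMax : ∀ a ∈ Dset μ, dotR a q ≤ dotR aq q)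
    (x₀ : Fin d → ℤ) (hx₀ : x₀ ∈ posAll) :
    -- (i)
    ((∀ x ∈ posAll, 0 < hq6 μ q aq x) ∧ HarmOn μ posAll (hq6 μ q aq)) ∧
    -- (ii)
    (∀ xs : ℕ → (Fin d → ℤ), (∀ n, xs n ∈ posAll) →
      Tendsto (fun n => znorm (xs n)) atTop atTop →
      Tendsto (fun n i => (xs n i : ℝ) / znorm (xs n)) atTop (𝓝 q) →
      Fundamental μ posAll x₀ xs ∧
      ∀ x ∈ posAll,
        Tendsto (fun n => green μ posAll x (xs n) / green μ posAll x₀ (xs n)) atTop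
          (𝓝 (hq6 μ q aq x / hq6 μ q aq x₀))) := by
  have hq : q ≠ 0 := fun h => by simp [h, rnorm] at hq1
  have hd : 0 < d := by
    rcases Nat.eq_zero_or_pos d with h | h
    · subst h
      exact absurd (Subsingleton.elim q 0) hq
    · exact h
  obtain ⟨r, hr, hs⟩ := exists_tiltSummable hd hnn hA4' hA2 haqD
  obtain ⟨hc, l, hl, hv⟩ := exists_tiltMean_eq hd hnn hsum hA1 hA3 hA4' haqD hr hs hq haqMax
  have hT0 : ∀ i, 0 ≤ tiltTotal μ aq i := fun i =>
    tsum_nonneg fun k => tiltMass_nonneg hnn _ i k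
  have hT1 : ∀ i, tiltTotal μ aq i ≤ 1 := fun i =>
    hc ▸ Finset.single_le_sum (fun j _ => hT0 j) (Finset.mem_univ i)
  obtain ⟨H, w, C, hC, hw, hHt, hHb, hHe⟩ := exists_axisHarmonic hd hnn hsum hA1 hA4' hr hs hc
    (q := q) (fun i h => by rw [hv, h, mul_zero])
    (fun i h => by rw [hv]; exact mul_pos hl (lt_of_le_of_ne (hq2 i) (Ne.symm h)))
  have hHpos : ∀ x ∈ posAll, 0 < (H x).toReal := fun x hx =>
    ENNReal.toReal_pos ((prodFn_pos aq (fun i t ht => (hw i).pos t ht) hx).trans_le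
      (hHb x hx).1).ne' (hHt x hx).1
  have hfin : ∀ y : Fin d → ℤ, ∀ x ∈ posAll, potential (axisMassE μ) (Pi.single y 1) x ≠ ⊤ :=
    fun y x hx => potential_single_ne_top hnn hr hs hc hl hv hq2 hq1 y hx
  refine ⟨⟨fun x hx => ?_, ?_⟩, fun xs hxs hN hdir => ?_⟩
  · rw [(hHt x hx).2]
    exact hHpos x hx
  · refine harmOn_toReal hd hnn hA4' (fun x hx => (hHt x hx).1) (fun x hx => (hHt x hx).2)
      fun x hx => ?_
    rw [walkOp_apply, Finset.sum_congr rfl fun i _ => hHe i x hx, ← Finset.sum_mul,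
      ← ENNReal.ofReal_sum_of_nonneg fun i _ => hT0 i, hc, ENNReal.ofReal_one, one_mul]
  · have main : ∀ x ∈ posAll,
        Tendsto (fun n => green μ posAll x (xs n) / green μ posAll x₀ (xs n)) atTop
          (𝓝 (hq6 μ q aq x / hq6 μ q aq x₀)) := fun x hx => by
      rw [tendsto_iff_ultrafilter]
      intro U hU
      obtain ⟨h, h1, hht, hlim, hhe⟩ := exists_martin_limit hd hnn hsum hA1 hA2 hA3 hA4' hq2 hq1
        haqD haqMax hr hs hc hfin hxs (hN.mono_left hU) (hdir.mono_left hU) hx₀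
      have hconst := eq_of_update_eq (ρ := fun z => (h z).toReal / (H z).toReal)
        (fun i z hz t ht => by
          have hz' := update_mem_posAll hz i ht
          have key := line_ratio_const hnn hA1 hA4' hr hs (hT1 i)
            (by rw [hv]; exact mul_nonneg hl.le (hq2 i)) hC hw hht (fun z hz => (hHt z hz).1) hHb
            (hhe i) (hHe i) hz ht (hz i)
          rw [Function.update_eq_self] at key
          exact (div_eq_div_iff (hHpos _ hz').ne' (hHpos _ hz).ne').2 key) hx₀ hx
      simp only [h1, ENNReal.toReal_one] at hconst
      rw [div_eq_div_iff (hHpos x hx).ne' (hHpos x₀ hx₀).ne', one_mul] at hconst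
      rw [(hHt x hx).2, (hHt x₀ hx₀).2, ← eq_div_of_mul_eq (hHpos x₀ hx₀).ne' hconst]
      refine ((ENNReal.tendsto_toReal (hht x hx)).comp (hlim x)).congr fun n => ?_
      simp only [Function.comp_apply]
      rw [green_eq_toReal hd hnn hsum hA4' x (hxs n), green_eq_toReal hd hnn hsum hA4' x₀ (hxs n),
        ENNReal.toReal_mul, ENNReal.toReal_inv, div_eq_inv_mul]
    exact ⟨fun x hx => ⟨_, main x hx⟩, main⟩
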